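/- Let ξ be a real number such that 1, ξ, ξ², ξ³ are linearly independent over ℚ, let c > 0 and suppose that for every sufficiently large X there exists a non-zero x ∈ ℤ⁴ with |x₀| ≤ X and max_{1≤i≤3}|x₀ξⁱ − x_i| ≤ cX^{−λ₃}, where λ₃ is the smallest positive root of T² − γ³T + γ and γ = (1+√5)/2. Let (x_i)_{i≥1} be a sequence of minimal points for ξ in ℤ⁴, set W_i = span_ℝ(x_{i−1}, x_i), I = {i ≥ 2 : W_i ≠ W_{i+1}}, U_i = W_i + W_{i+1} for i ∈ I, and J = {i ∈ I : U_i ≠ U_j where j is the successor of i in I}. Then there exists N such that for every pair of consecutive elements i < j of I with i ≥ N, exactly one of i and j belongs to J. -/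

import Mathlib

noncomputable section

/-- ‖x‖ for an integer point of ℤ⁴, as a real number. -/
def znorm (x : Fin 4 → ℤ) : ℝ :=
  max (max |(x 0 : ℝ)| |(x 1 : ℝ)|) (max |(x 2 : ℝ)| |(x 3 : ℝ)|)

/-- L(x) = max_{1≤k≤3}|x₀ξᵏ − x_k| for an integer point of ℤ⁴. -/
def zL (ξ : ℝ) (x : Fin 4 → ℤ) : ℝ :=
  max (max |(x 0 : ℝ) * ξ - (x 1 : ℝ)| |(x 0 : ℝ) * ξ ^ 2 - (x 2 : ℝ)|)
    |(x 0 : ℝ) * ξ ^ 3 - (x 3 : ℝ)|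

/-- The approximation hypothesis. -/
def ApproxHyp (ξ c lam : ℝ) : Prop :=
  ∃ X₀ : ℝ, ∀ X : ℝ, X₀ ≤ X →
    ∃ x : Fin 4 → ℤ, x ≠ 0 ∧ |(x 0 : ℝ)| ≤ X ∧
      ∀ i : Fin 4, 1 ≤ (i : ℕ) →
        |(x 0 : ℝ) * ξ ^ (i : ℕ) - (x i : ℝ)| ≤ c * X ^ (-lam)

/-- A sequence of minimal points for ξ in ℤ⁴ (indexed from 1). -/
def IsMinimalSeq (ξ : ℝ) (x : ℕ → Fin 4 → ℤ) : Prop :=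
  (∀ i, 1 ≤ i → x i ≠ 0) ∧
  (∀ i, 1 ≤ i → znorm (x i) < znorm (x (i + 1))) ∧
  (∀ i, 1 ≤ i → zL ξ (x (i + 1)) < zL ξ (x i)) ∧
  (∀ i, 1 ≤ i → ∀ y : Fin 4 → ℤ, y ≠ 0 → zL ξ y < zL ξ (x i) →
    znorm (x (i + 1)) ≤ znorm y)

/-- The real vector attached to an integer point. -/
def rvec (x : Fin 4 → ℤ) : Fin 4 → ℝ := fun k => (x k : ℝ)

/-- W_i = span_ℝ(x_{i−1}, x_i). -/
def Wspace (x : ℕ → Fin 4 → ℤ) (i : ℕ) : Submodule ℝ (Fin 4 → ℝ) :=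
  Submodule.span ℝ {rvec (x (i - 1)), rvec (x i)}

/-- I = {i ≥ 2 : W_i ≠ W_{i+1}}. -/
def Iset (x : ℕ → Fin 4 → ℤ) : Set ℕ :=
  {i | 2 ≤ i ∧ Wspace x i ≠ Wspace x (i + 1)}

/-- U_i = W_i + W_{i+1}. -/
def Uspace (x : ℕ → Fin 4 → ℤ) (i : ℕ) : Submodule ℝ (Fin 4 → ℝ) :=
  Wspace x i ⊔ Wspace x (i + 1)

/-- i < j are consecutive elements of S (j is the successor of i in S). -/
def ConsecIn (S : Set ℕ) (i j : ℕ) : Prop :=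
  i ∈ S ∧ j ∈ S ∧ i < j ∧ ∀ k ∈ S, i < k → j ≤ k

/-- J = {i ∈ I : U_i ≠ U_j where j is the successor of i in I}. -/
def Jset (x : ℕ → Fin 4 → ℤ) : Set ℕ :=
  {i | i ∈ Iset x ∧ ∀ j, ConsecIn (Iset x) i j → Uspace x i ≠ Uspace x j}


/-- The golden ratio γ = (1+√5)/2. -/
def gold : ℝ := (1 + Real.sqrt 5) / 2

/-- λ₃, the smallest positive root of T² − γ³T + γ. -/
def lambda3 : ℝ := (gold ^ 3 - Real.sqrt (gold ^ 6 - 4 * gold)) / 2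

/-- Logarithmic data attached to the minimal points `y k` indexed by `Iset`. -/
structure LogData where
  (Y A l p h σ en : ℕ → ℝ)
  J : ℕ → Prop
  es : ℕ → ℚ ⊕ ℕ
  ρ : ℚ ⊕ ℕ → ℝ
  cn : ℕ → ℕ → ℝ
  cs : ℕ → ℕ → ℚ ⊕ ℕ
  e : ℝ
  e_nonneg : 0 ≤ e
  e_small : e ≤ 1 / 10000000000 * Y 0
  Y_pos : 0 < Y 0
  Y_unbounded : ∀ M : ℝ, ∃ k, M ≤ Y k
  J_inf : ∀ k, ∃ m, k ≤ m ∧ J m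
  A_le_Y : ∀ k, A k ≤ Y k
  Y_le_A : ∀ k, Y k ≤ A (k + 1)
  l_le_p : ∀ k, l k ≤ p k
  p_le_l : ∀ k, p (k + 1) ≤ l k
  l_le : ∀ k, l k ≤ -0.4245069 * A (k + 1)
  p_le : ∀ k, p k ≤ -0.4245069 * Y k
  height_le : ∀ k, Y (k + 1) + p (k + 1) ≤ A (k + 1) + l k + e
  height_ge : ∀ k, A (k + 1) + l k ≤ Y (k + 1) + p (k + 1) + e
  h_le : ∀ k, h k ≤ Y (k + 1) + p (k + 1) + p k + e
  J_le : ∀ k, J k → Y (k + 1) + p (k + 1) ≤ h k + h (k + 1) + e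
  not_J_eq : ∀ k, ¬ J k → h k = h (k + 1)
  nondeg : ∀ k, 0 ≤ Y k + p k + l k + e
  σ_le : ∀ k, σ k ≤ p k + l k + e
  le_σ : ∀ k, -(Y k + p k + l k) ≤ 0.4245069 * (σ k + Y k) + e
  en_nonneg : ∀ k, 0 ≤ en k
  en_le : ∀ k, en k ≤ A (k + 1) + 2 * l k + e
  ed_le : ∀ k, en k - ρ (es k) ≤ Y k + σ (k + 1) + e
  le_ed : ∀ k, Y k + σ (k + 1) ≤ en k - ρ (es k) + e
  le_en : ∀ k, -0.4245069 * (en k - ρ (es k)) ≤ en k + e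
  point : ∀ k i, 0 ≤ en k + l i + e ∨ 0 ≤ en k - ρ (es k) + Y i + e
  nonpar : ∀ i k, es i ≠ es k →
    0 ≤ en i + (en k - ρ (es k)) + e ∨ 0 ≤ en k + (en i - ρ (es i)) + e
  cn_le : ∀ k j, k < j → Y k + 2 * l k + e < 0 → cn k j ≤ en k + Y j - A (k + 1) + e
  le_cn : ∀ k j, k < j → Y k + 2 * l k + e < 0 → en k + Y j - A (k + 1) ≤ cn k j + e
  cd_le : ∀ k j, k < j → Y k + 2 * l k + e < 0 →
    cn k j - ρ (cs k j) ≤ Y k + l k + l j + e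
  nonpar_c : ∀ k j i, k < j → Y k + 2 * l k + e < 0 → cs k j ≠ es i →
    0 ≤ cn k j + (en i - ρ (es i)) + e ∨ 0 ≤ en i + (cn k j - ρ (cs k j)) + e
  pluecker : ∀ k, Y k + 2 * l k + e < 0 → Y (k + 1) + 2 * l (k + 1) + e < 0 →
    σ (k + 1) + σ (k + 3) ≤ l k + l (k + 3) + (σ (k + 2) + Y (k + 2) - A (k + 2)) + e ∨
    ((Y (k + 1) + (σ (k + 1) + σ (k + 3) - l k - l (k + 2)) ≤
          cn (k + 1) (k + 3) - ρ (cs (k + 1) (k + 3)) + e ∨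
        Y (k + 1) + (σ (k + 1) + σ (k + 3) - l k - l (k + 2)) ≤
          2 * l (k + 1) + l (k + 3) + e) ∧
      (Y k + (σ (k + 1) + σ (k + 3) - l (k + 1) - l (k + 3)) ≤
          cn k (k + 2) - ρ (cs k (k + 2)) + e ∨
        Y k + (σ (k + 1) + σ (k + 3) - l (k + 1) - l (k + 3)) ≤
          2 * l k + l (k + 2) + e))

namespace LogData

variable (S : LogData)

lemma Y_mono (k : ℕ) : S.Y k ≤ S.Y (k + 1) := (S.Y_le_A k).trans (S.A_le_Y _)

lemma Y_monotone : Monotone S.Y := monotone_nat_of_le_succ S.Y_mono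

lemma e_le (k : ℕ) : S.e ≤ 1 / 10000000000 * S.Y k := by
  have := S.Y_monotone (Nat.zero_le k)
  linarith [S.e_small]

lemma Y_pos' (k : ℕ) : 0 < S.Y k := S.Y_pos.trans_le (S.Y_monotone (Nat.zero_le k))

/-- The inequalities relating the data at `k` and `k + 1`. -/
lemma step (k : ℕ) :
    S.A k ≤ S.Y k ∧ S.Y k ≤ S.A (k + 1) ∧ S.l k ≤ S.p k ∧ S.p (k + 1) ≤ S.l k ∧
    S.l k ≤ -0.4245069 * S.A (k + 1) ∧ S.p k ≤ -0.4245069 * S.Y k ∧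
    S.Y (k + 1) + S.p (k + 1) ≤ S.A (k + 1) + S.l k + S.e ∧
    S.A (k + 1) + S.l k ≤ S.Y (k + 1) + S.p (k + 1) + S.e ∧
    S.h k ≤ S.Y (k + 1) + S.p (k + 1) + S.p k + S.e ∧
    0 ≤ S.Y k + S.p k + S.l k + S.e :=
  ⟨S.A_le_Y k, S.Y_le_A k, S.l_le_p k, S.p_le_l k, S.l_le k, S.p_le k, S.height_le k,
    S.height_ge k, S.h_le k, S.nondeg k⟩

lemma no_NNJ (k : ℕ) (h0 : ¬ S.J k) (h1 : ¬ S.J (k + 1)) (h2 : S.J (k + 2)) : False := by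
  have e0 := S.e_nonneg
  have e1 := S.e_le k
  have y := S.Y_pos' k
  obtain ⟨a1, a2, a3, a4, a5, a6, a7, a8, a9, a10⟩ := S.step k
  obtain ⟨b1, b2, b3, b4, b5, b6, b7, b8, b9, b10⟩ := S.step (k + 1)
  obtain ⟨c1, c2, c3, c4, c5, c6, c7, c8, c9, c10⟩ := S.step (k + 2)
  obtain ⟨d1, d2, d3, d4, d5, d6, d7, d8, d9, d10⟩ := S.step (k + 3)
  have n0 := S.not_J_eq k h0
  have n1 := S.not_J_eq (k + 1) h1
  have n2 := S.J_le (k + 2) h2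
  simp only [add_assoc, Nat.reduceAdd] at *
  linarith

/-- The values forced at an index `k ∉ J` with `k + 1 ∈ J`, up to the scale `Y (k + 2)`. -/
lemma rigid (k : ℕ) (h0 : ¬ S.J k) (h1 : S.J (k + 1)) :
    0.6180330 * S.Y (k + 2) ≤ S.Y k ∧ S.Y k ≤ 0.6180350 * S.Y (k + 2) ∧
    0.8378518 * S.Y (k + 2) ≤ S.A (k + 1) ∧ S.A (k + 1) ≤ 0.8378538 * S.Y (k + 2) ∧
    0.8378518 * S.Y (k + 2) ≤ S.Y (k + 1) ∧ S.Y (k + 1) ≤ 0.8378538 * S.Y (k + 2) ∧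
    0.9999990 * S.Y (k + 2) ≤ S.A (k + 2) ∧ S.A (k + 2) ≤ 1.0000010 * S.Y (k + 2) ∧
    1.3556733 * S.Y (k + 2) ≤ S.A (k + 3) ∧ S.A (k + 3) ≤ 1.3556753 * S.Y (k + 2) ∧
    -0.3556753 * S.Y (k + 2) ≤ S.l k ∧ S.l k ≤ -0.3556733 * S.Y (k + 2) ∧
    -0.4245079 * S.Y (k + 2) ≤ S.l (k + 1) ∧ S.l (k + 1) ≤ -0.4245059 * S.Y (k + 2) ∧
    -0.5754941 * S.Y (k + 2) ≤ S.l (k + 2) ∧ S.l (k + 2) ≤ -0.5754921 * S.Y (k + 2) ∧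
    -0.2623607 * S.Y (k + 2) ≤ S.p k ∧ S.p k ≤ -0.2623587 * S.Y (k + 2) ∧
    -0.3556753 * S.Y (k + 2) ≤ S.p (k + 1) ∧ S.p (k + 1) ≤ -0.3556733 * S.Y (k + 2) ∧
    -0.4245079 * S.Y (k + 2) ≤ S.p (k + 2) ∧ S.p (k + 2) ≤ -0.4245059 * S.Y (k + 2) := by
  have e0 := S.e_nonneg
  have e1 := S.e_le k
  have y := S.Y_pos' k
  obtain ⟨a1, a2, a3, a4, a5, a6, a7, a8, a9, a10⟩ := S.step k
  obtain ⟨b1, b2, b3, b4, b5, b6, b7, b8, b9, b10⟩ := S.step (k + 1)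
  obtain ⟨c1, c2, c3, c4, c5, c6, c7, c8, c9, c10⟩ := S.step (k + 2)
  have d10 := S.nondeg (k + 3)
  have n0 := S.not_J_eq k h0
  have n1 := S.J_le (k + 1) h1
  simp only [add_assoc, Nat.reduceAdd] at *
  refine ⟨?_, ?_, ?_, ?_, ?_, ?_, ?_, ?_, ?_, ?_, ?_, ?_, ?_, ?_, ?_, ?_, ?_, ?_, ?_, ?_, ?_, ?_⟩ <;> linarith

end LogData

namespace LogData
variable (S : LogData)

lemma J_succ_of_not {k : ℕ} (h0 : ¬ S.J k) : S.J (k + 1) := by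
  by_contra h1
  obtain ⟨m, hm, hJ⟩ := S.J_inf k
  obtain ⟨d, rfl⟩ := Nat.exists_eq_add_of_le hm
  have key : ∀ d, ¬ S.J (k + d) ∧ ¬ S.J (k + d + 1) := by
    intro d
    induction d with
    | zero => exact ⟨h0, h1⟩
    | succ d ih => exact ⟨ih.2, fun h => S.no_NNJ _ ih.1 ih.2 h⟩
  exact (key d).1 hJ

lemma es_eq_of_not {k : ℕ} (h0 : ¬ S.J k) : S.es k = S.es (k + 1) := by
  by_contra hne
  have e0 := S.e_nonneg
  have e1 := S.e_le k
  have y := S.Y_pos' k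
  have h1 := S.J_succ_of_not h0
  obtain ⟨r1, r2, r3, r4, r5, r6, r7, r8, r9, r10, r11, r12, r13, r14, r15, r16, r17, r18, r19,
    r20, r21, r22⟩ := S.rigid k h0 h1
  have a1 := S.en_le k
  have a2 := S.ed_le k
  have a3 := S.σ_le (k + 1)
  have b1 := S.en_le (k + 1)
  have b2 := S.ed_le (k + 1)
  have b3 := S.σ_le (k + 2)
  have y2 := S.Y_pos' (k + 2)
  have := S.Y_mono k
  have := S.Y_mono (k + 1)
  simp only [add_assoc, Nat.reduceAdd] at *
  rcases S.nonpar _ _ hne with h | h <;> linarith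

lemma es_eq_of_J_J {k : ℕ} (h0 : S.J k) (h1 : S.J (k + 1)) :
    S.es (k + 1) = S.es (k + 2) := by
  by_contra hne
  have e0 := S.e_nonneg
  have e1 := S.e_le k
  have y := S.Y_pos' k
  obtain ⟨a1, a2, a3, a4, a5, a6, a7, a8, a9, a10⟩ := S.step k
  obtain ⟨b1, b2, b3, b4, b5, b6, b7, b8, b9, b10⟩ := S.step (k + 1)
  obtain ⟨c1, c2, c3, c4, c5, c6, c7, c8, c9, c10⟩ := S.step (k + 2)
  obtain ⟨d1, d2, d3, d4, d5, d6, d7, d8, d9, d10⟩ := S.step (k + 3)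
  have n0 := S.J_le k h0
  have n1 := S.J_le (k + 1) h1
  have u1 := S.en_le (k + 1)
  have u2 := S.ed_le (k + 1)
  have u3 := S.σ_le (k + 2)
  have v1 := S.en_le (k + 2)
  have v2 := S.ed_le (k + 2)
  have v3 := S.σ_le (k + 3)
  have f := S.nonpar _ _ hne
  by_cases h2 : S.J (k + 2)
  · have n2 := S.J_le (k + 2) h2
    have d11 := S.nondeg (k + 4)
    simp only [add_assoc, Nat.reduceAdd] at *
    rcases f with h | h <;> linarith
  · have n2 := S.not_J_eq (k + 2) h2
    have n3 := S.J_le (k + 3) (S.J_succ_of_not h2)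
    have d11 := S.step (k + 4)
    simp only [add_assoc, Nat.reduceAdd] at *
    rcases f with h | h <;> linarith

/-- Decay of the second component of the vector attached to `k + 1`. -/
lemma ed_decay {k : ℕ} (h0 : S.J k) (h1 : S.J (k + 1)) :
    S.en (k + 1) - S.ρ (S.es (k + 1)) ≤ -0.25 * S.Y (k + 1) := by
  have e0 := S.e_nonneg
  have e1 := S.e_le k
  have y := S.Y_pos' k
  obtain ⟨a1, a2, a3, a4, a5, a6, a7, a8, a9, a10⟩ := S.step k
  obtain ⟨b1, b2, b3, b4, b5, b6, b7, b8, b9, b10⟩ := S.step (k + 1)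
  obtain ⟨c1, c2, c3, c4, c5, c6, c7, c8, c9, c10⟩ := S.step (k + 2)
  obtain ⟨d1, d2, d3, d4, d5, d6, d7, d8, d9, d10⟩ := S.step (k + 3)
  have n0 := S.J_le k h0
  have n1 := S.J_le (k + 1) h1
  have u2 := S.ed_le (k + 1)
  have u3 := S.σ_le (k + 2)
  simp only [add_assoc, Nat.reduceAdd] at *
  linarith

lemma exists_not_J (k : ℕ) : ∃ m, k ≤ m ∧ ¬ S.J m := by
  by_contra! hJ
  have hes : ∀ d, S.es (k + 1 + d) = S.es (k + 1) := by
    intro d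
    induction d with
    | zero => rfl
    | succ d ih =>
      rw [← ih]
      have := S.es_eq_of_J_J (hJ (k + d) (by omega)) (hJ (k + d + 1) (by omega))
      rw [show k + 1 + (d + 1) = k + d + 2 by ring, show k + 1 + d = k + d + 1 by ring]
      exact this.symm
  obtain ⟨m, hm⟩ := S.Y_unbounded (4 * |S.ρ (S.es (k + 1))| + 1)
  have h1 := S.ed_decay (hJ (k + m) (by omega)) (hJ (k + m + 1) (by omega))
  rw [show k + m + 1 = k + 1 + m by ring, hes] at h1
  have h2 := S.en_nonneg (k + 1 + m)
  have h3 := S.Y_monotone (show m ≤ k + 1 + m by omega)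
  have := le_abs_self (S.ρ (S.es (k + 1)))
  linarith

/-- Two successive elements `a < a + n` outside `J`. -/
def Gap (a n : ℕ) : Prop := ¬ S.J a ∧ (∀ i, 0 < i → i < n → S.J (a + i)) ∧ ¬ S.J (a + n) ∧ 0 < n

lemma exists_gap {a : ℕ} (ha : ¬ S.J a) : ∃ n, S.Gap a n := by
  classical
  have hex : ∃ n, 0 < n ∧ ¬ S.J (a + n) := by
    obtain ⟨m, hm, h⟩ := S.exists_not_J (a + 1)
    exact ⟨m - a, by omega, by rwa [show a + (m - a) = m by omega]⟩
  refine ⟨Nat.find hex, ha, fun i h0 hi => ?_, (Nat.find_spec hex).2, (Nat.find_spec hex).1⟩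
  by_contra h
  exact Nat.find_min hex hi ⟨h0, h⟩

variable {S}

lemma Gap.two_le {a n : ℕ} (h : S.Gap a n) : 2 ≤ n := by
  by_contra hn
  have : n = 1 := by have := h.2.2.2; omega
  subst this
  exact h.2.2.1 (S.J_succ_of_not h.1)

lemma Gap.es_eq {a n : ℕ} (h : S.Gap a n) (hn : 3 ≤ n) {i : ℕ} (h2 : 2 ≤ i) (hi : i ≤ n + 1) :
    S.es (a + i) = S.es (a + 2) := by
  induction i, h2 using Nat.le_induction with
  | base => rfl
  | succ i h2 ih =>
    rw [← ih (by omega)]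
    rcases Nat.lt_or_ge i n with hin | hin
    · have := S.es_eq_of_J_J (h.2.1 (i - 1) (by omega) (by omega))
        (k := a + (i - 1)) (by rw [show a + (i - 1) + 1 = a + i by omega]; exact h.2.1 i (by omega) hin)
      rw [show a + (i - 1) + 1 = a + i by omega, show a + (i - 1) + 2 = a + (i + 1) by omega] at this
      exact this.symm
    · have : i = n := by omega
      subst this
      exact (S.es_eq_of_not h.2.2.1).symm

/-- The second component of the vector attached to `k + 1` when `k ∉ J`. -/
lemma ed_succ {k : ℕ} (h0 : ¬ S.J k) :
    -0.162155 * S.Y (k + 2) ≤ S.en (k + 1) - S.ρ (S.es (k + 1)) ∧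
    S.en (k + 1) - S.ρ (S.es (k + 1)) ≤ -0.162140 * S.Y (k + 2) := by
  have e0 := S.e_nonneg
  have e1 := S.e_le (k + 2)
  have y := S.Y_pos' (k + 2)
  obtain ⟨r1, r2, r3, r4, r5, r6, r7, r8, r9, r10, r11, r12, r13, r14, r15, r16, r17, r18, r19,
    r20, r21, r22⟩ := S.rigid k h0 (S.J_succ_of_not h0)
  have a1 := S.ed_le (k + 1)
  have a2 := S.le_ed (k + 1)
  have a3 := S.σ_le (k + 2)
  have a4 := S.le_σ (k + 2)
  simp only [add_assoc, Nat.reduceAdd] at *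
  constructor <;> linarith

end LogData

namespace LogData
variable {S : LogData}

lemma Gap.le_ρ {a n : ℕ} (h : S.Gap a n) (hn : 3 ≤ n) :
    0.3736 * S.Y (a + n) ≤ S.ρ (S.es (a + 2)) := by
  have e0 := S.e_nonneg
  have e1 := S.e_le (a + n)
  have y := S.Y_pos' (a + n)
  have h1 := S.le_en (a + n + 1)
  have h2 := (ed_succ h.2.2.1).2
  obtain ⟨r1, r2, -⟩ := S.rigid (a + n) h.2.2.1 (S.J_succ_of_not h.2.2.1)
  have h3 := h.es_eq hn (i := n + 1) (by omega) le_rfl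
  rw [← add_assoc] at h3
  rw [h3] at h1 h2
  linarith

/-- Upper bound for `ρ` from the vector attached to `a + 2`. -/
lemma Gap.ρ_le {a n : ℕ} (h : S.Gap a n) :
    S.ρ (S.es (a + 2)) ≤ 1.0427 * S.Y (a + 2) + S.Y (a + 3) - S.A (a + 4) := by
  have e0 := S.e_nonneg
  have e1 := S.e_le (a + 2)
  have y := S.Y_pos' (a + 2)
  obtain ⟨r1, r2, r3, r4, r5, r6, r7, r8, r9, r10, r11, r12, r13, r14, r15, r16, r17, r18, r19,
    r20, r21, r22⟩ := S.rigid a h.1 (S.J_succ_of_not h.1)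
  have a1 := S.en_le (a + 2)
  have a2 := S.le_ed (a + 2)
  have a3 := S.le_σ (a + 3)
  have a4 := S.height_le (a + 2)
  have a5 := S.l_le (a + 3)
  simp only [add_assoc, Nat.reduceAdd] at *
  linarith

lemma Gap.le_four {a n : ℕ} (h : S.Gap a n) : n ≤ 4 := by
  by_contra! hn
  have e0 := S.e_nonneg
  have e1 := S.e_le a
  have y := S.Y_pos' (a + 2)
  have y' := S.Y_mono a
  have y'' := S.Y_mono (a + 1)
  obtain ⟨r1, r2, r3, r4, r5, r6, r7, r8, r9, r10, r11, r12, r13, r14, r15, r16, r17, r18, r19,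
    r20, r21, r22⟩ := S.rigid a h.1 (S.J_succ_of_not h.1)
  have h1 := h.le_ρ (by omega)
  have h2 := h.ρ_le
  have h3 := S.Y_monotone (show a + 5 ≤ a + n by omega)
  have n1 := S.J_le (a + 1) (h.2.1 1 (by omega) (by omega))
  have n2 := S.J_le (a + 2) (h.2.1 2 (by omega) (by omega))
  have n3 := S.J_le (a + 3) (h.2.1 3 (by omega) (by omega))
  obtain ⟨b1, b2, b3, b4, b5, b6, b7, b8, b9, b10⟩ := S.step (a + 1)
  obtain ⟨c1, c2, c3, c4, c5, c6, c7, c8, c9, c10⟩ := S.step (a + 2)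
  obtain ⟨d1, d2, d3, d4, d5, d6, d7, d8, d9, d10⟩ := S.step (a + 3)
  obtain ⟨f1, f2, f3, f4, f5, f6, f7, f8, f9, f10⟩ := S.step (a + 4)
  have g1 := S.step (a + 5)
  simp only [add_assoc, Nat.reduceAdd] at *
  linarith

/-- Numerical constraints on a gap of length four. -/
lemma Gap.four {a : ℕ} (h : S.Gap a 4) :
    1.743 * S.Y (a + 2) ≤ S.Y (a + 4) ∧ S.Y (a + 4) ≤ 1.75 * S.Y (a + 2) ∧
    S.en (a + 5) ≤ 0.196 * S.Y (a + 2) := by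
  have e0 := S.e_nonneg
  have e1 := S.e_le a
  have y := S.Y_pos' (a + 2)
  have y' := S.Y_mono a
  have y'' := S.Y_mono (a + 1)
  obtain ⟨r1, r2, r3, r4, r5, r6, r7, r8, r9, r10, r11, r12, r13, r14, r15, r16, r17, r18, r19,
    r20, r21, r22⟩ := S.rigid a h.1 (S.J_succ_of_not h.1)
  obtain ⟨q1, q2, q3, q4, q5, q6, q7, q8, q9, q10, q11, q12, q13, q14, q15, q16, q17, q18, q19,
    q20, q21, q22⟩ := S.rigid (a + 4) h.2.2.1 (S.J_succ_of_not h.2.2.1)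
  have h1 := h.le_ρ (by omega)
  have h2 := h.ρ_le
  obtain ⟨b1, b2, b3, b4, b5, b6, b7, b8, b9, b10⟩ := S.step (a + 1)
  obtain ⟨c1, c2, c3, c4, c5, c6, c7, c8, c9, c10⟩ := S.step (a + 2)
  obtain ⟨d1, d2, d3, d4, d5, d6, d7, d8, d9, d10⟩ := S.step (a + 3)
  have f10 := S.nondeg (a + 4)
  have k1 := S.en_le (a + 3)
  have k2 := S.le_ed (a + 3)
  have k3 := S.le_σ (a + 4)
  have m1 := ed_succ h.2.2.1
  have m2 := h.es_eq (by omega) (i := 5) (by omega) le_rfl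
  have m3 := h.es_eq (by omega) (i := 3) (by omega) (by omega)
  have n1 := S.J_le (a + 1) (h.2.1 1 (by omega) (by omega))
  have n2 := S.J_le (a + 2) (h.2.1 2 (by omega) (by omega))
  have n3 := S.J_le (a + 3) (h.2.1 3 (by omega) (by omega))
  simp only [add_assoc, Nat.reduceAdd] at *
  rw [m3] at k2
  rw [m2] at m1
  refine ⟨?_, ?_, ?_⟩ <;> linarith

/-- Left neighbours of a gap. -/
lemma left_rigid {k : ℕ} (h0 : ¬ S.J (k + 1)) :
    S.l k ≤ -0.26235 * S.Y (k + 3) ∧ S.A (k + 1) ≤ 0.618036 * S.Y (k + 3) ∧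
    0.61802 * S.Y (k + 3) ≤ S.A (k + 1)  := by
  have e0 := S.e_nonneg
  have e1 := S.e_le (k + 3)
  obtain ⟨r1, r2, r3, r4, r5, r6, r7, r8, r9, r10, r11, r12, r13, r14, r15, r16, r17, r18, r19,
    r20, r21, r22⟩ := S.rigid (k + 1) h0 (S.J_succ_of_not h0)
  have y := S.Y_pos' (k + 3)
  obtain ⟨b1, b2, b3, b4, b5, b6, b7, b8, b9, b10⟩ := S.step k
  have c1 := S.A_le_Y (k + 1)
  simp only [add_assoc, Nat.reduceAdd] at *
  refine ⟨?_, ?_, ?_⟩ <;> linarith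

lemma Gap.ne_four {a m n : ℕ} (h : S.Gap a m) (h' : S.Gap (a + m) n) : n ≠ 4 := by
  rintro rfl
  have e0 := S.e_nonneg
  have hm := h.two_le
  have hm' := h.le_four
  obtain ⟨u1, u2, u3⟩ := h'.four
  have u4 := (ed_succ h'.2.2.1).2
  obtain ⟨r1, r2, r3, r4, r5, r6, r7, r8, r9, r10, r11, r12, r13, r14, r15, r16, r17, r18, r19,
    r20, r21, r22⟩ := S.rigid a h.1 (S.J_succ_of_not h.1)
  obtain ⟨q1, q2, -⟩ := S.rigid (a + m + 4) h'.2.2.1 (S.J_succ_of_not h'.2.2.1)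
  obtain ⟨t1, t2, -⟩ := S.rigid (a + m) h'.1 (S.J_succ_of_not h'.1)
  have e1 := S.e_le (a + m + 2)
  have y := S.Y_pos' (a + m + 2)
  have hm3 : m = 2 ∨ m = 3 ∨ m = 4 := by omega
  rcases hm3 with rfl | rfl | rfl
  · have v := S.point (a + 2 + 4 + 1) a
    simp only [add_assoc, Nat.reduceAdd] at *
    rcases v with v | v <;> linarith
  · obtain ⟨w1, w2, w3⟩ := left_rigid (k := a + 2) h'.1
    have v := S.point (a + 3 + 4 + 1) (a + 2)
    obtain ⟨w1, w2, w3⟩ := left_rigid (k := a + 2) h'.1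
    simp only [add_assoc, Nat.reduceAdd] at *
    rcases v with v | v <;> linarith
  · obtain ⟨w1, w2, w3⟩ := h.four
    have v := S.point (a + 4 + 4 + 1) (a + 2)
    simp only [add_assoc, Nat.reduceAdd] at *
    rcases v with v | v <;> linarith

end LogData

namespace LogData
variable {S : LogData}

/-- The vectors of slopes `cs k (k + 2)` and `es (k + 2)` are parallel at the start of a gap
of length three. -/
lemma Gap.cs_eq {a : ℕ} (h : S.Gap a 3) :
    S.cs a (a + 2) = S.es (a + 2) ∧
    S.en a + 0.1194 * S.Y (a + 2) ≤ S.en (a + 2) := by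
  have e0 := S.e_nonneg
  have e1 := S.e_le (a + 2)
  have y := S.Y_pos' (a + 2)
  obtain ⟨r1, r2, r3, r4, r5, r6, r7, r8, r9, r10, r11, r12, r13, r14, r15, r16, r17, r18, r19,
    r20, r21, r22⟩ := S.rigid a h.1 (S.J_succ_of_not h.1)
  obtain ⟨q1, q2, q3, q4, q5, q6, q7, q8, q9, q10, q11, q12, q13, q14, q15, q16, q17, q18, q19,
    q20, q21, q22⟩ := S.rigid (a + 3) h.2.2.1 (S.J_succ_of_not h.2.2.1)
  obtain ⟨w1, w2, w3⟩ := left_rigid (k := a + 2) h.2.2.1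
  have dom : S.Y a + 2 * S.l a + S.e < 0 := by linarith
  have a1 := S.en_le (a + 2)
  have a2 := S.le_ed (a + 2)
  have a3 := S.le_σ (a + 3)
  have a4 := S.ed_le (a + 2)
  have a5 := S.σ_le (a + 3)
  have b1 := S.en_le a
  have c1 := S.cn_le a (a + 2) (by omega) dom
  have c2 := S.le_cn a (a + 2) (by omega) dom
  have c3 := S.cd_le a (a + 2) (by omega) dom
  have c4 := S.nonpar_c a (a + 2) (a + 2) (by omega) dom
  simp only [add_assoc, Nat.reduceAdd] at *
  have key : S.cs a (a + 2) = S.es (a + 2) := by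
    by_contra hne
    rcases c4 hne with g | g <;> linarith
  refine ⟨key, ?_⟩
  rw [key] at c3
  linarith

lemma no_two_three {a : ℕ} (h : S.Gap a 2) (h' : S.Gap (a + 2) 3) : False := by
  have e0 := S.e_nonneg
  have e1 := S.e_le (a + 4)
  have y := S.Y_pos' (a + 4)
  obtain ⟨r1, r2, r3, r4, r5, r6, r7, r8, r9, r10, r11, r12, r13, r14, r15, r16, r17, r18, r19,
    r20, r21, r22⟩ := S.rigid a h.1 (S.J_succ_of_not h.1)
  obtain ⟨q1, q2, q3, q4, q5, q6, q7, q8, q9, q10, q11, q12, q13, q14, q15, q16, q17, q18, q19,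
    q20, q21, q22⟩ := S.rigid (a + 2) h'.1 (S.J_succ_of_not h'.1)
  have k1 := h'.cs_eq.2
  have k2 := S.es_eq_of_not h'.1
  have k3 := ed_succ h.1
  have k4 := ed_succ h'.1
  have k5 := S.le_en (a + 3)
  have k6 := S.en_le (a + 1)
  have k7 := S.en_le (a + 4)
  have k8 := S.ed_le (a + 2)
  have k9 := S.σ_le (a + 3)
  have k10 := S.nonpar (a + 1) (a + 2)
  simp only [add_assoc, Nat.reduceAdd] at *
  have hne : S.es (a + 1) ≠ S.es (a + 2) := by
    intro heq
    rw [heq, k2] at k3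
    linarith
  rcases k10 hne with g | g <;> linarith

lemma no_three_three {a : ℕ} (h : S.Gap a 3) (h' : S.Gap (a + 3) 3) : False := by
  have e0 := S.e_nonneg
  have e1 := S.e_le (a + 2)
  have y := S.Y_pos' (a + 2)
  obtain ⟨r1, r2, r3, r4, r5, r6, r7, r8, r9, r10, r11, r12, r13, r14, r15, r16, r17, r18, r19,
    r20, r21, r22⟩ := S.rigid a h.1 (S.J_succ_of_not h.1)
  obtain ⟨q1, q2, q3, q4, q5, q6, q7, q8, q9, q10, q11, q12, q13, q14, q15, q16, q17, q18, q19,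
    q20, q21, q22⟩ := S.rigid (a + 3) h'.1 (S.J_succ_of_not h'.1)
  obtain ⟨w1, w2, w3⟩ := left_rigid (k := a + 2) h'.1
  obtain ⟨p1, p2, p3⟩ := left_rigid (k := a + 5) h'.2.2.1
  obtain ⟨t1, t2, t3, t4, t5, t6, t7, t8, t9, t10, t11, t12, t13, t14, t15, t16, t17, t18, t19,
    t20, t21, t22⟩ := S.rigid (a + 6) h'.2.2.1 (S.J_succ_of_not h'.2.2.1)
  have f1 := h.es_eq le_rfl (i := 3) (by omega) (by omega)
  have f2 := h.es_eq le_rfl (i := 4) (by omega) (by omega)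
  obtain ⟨k1, k2⟩ := h.cs_eq
  obtain ⟨k3, k4⟩ := h'.cs_eq
  have k5 := ed_succ h.1
  have k6 := ed_succ h'.1
  have k7 := ed_succ h'.2.2.1
  have k8 := S.es_eq_of_not h.1
  have dom2 : S.Y (a + 2) + 2 * S.l (a + 2) + S.e < 0 := by linarith
  have dom3 : S.Y (a + 3) + 2 * S.l (a + 3) + S.e < 0 := by
    simp only [add_assoc, Nat.reduceAdd] at *
    linarith
  have m1 := S.le_σ (a + 3)
  have m2 := S.le_σ (a + 5)
  have m3 := S.le_σ (a + 6)
  have m4 := S.σ_le (a + 6)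
  have m5 := S.ed_le (a + 5)
  have m6 := S.le_ed (a + 5)
  have m7 := S.le_ed (a + 2)
  have m8 := S.ed_le (a + 2)
  have m9 := S.σ_le (a + 3)
  have i1 := S.le_en a
  have i2 := S.le_en (a + 1)
  have i3 := S.le_en (a + 3)
  have i4 := S.le_en (a + 4)
  have j1 := S.en_le (a + 2)
  have j2 := S.en_le (a + 5)
  have j3 := S.le_ed (a + 3)
  have j4 := S.ed_le (a + 3)
  have n1 := S.cn_le (a + 2) (a + 4) (by omega) dom2
  have n2 := S.le_cn (a + 2) (a + 4) (by omega) dom2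
  have n3 := S.cd_le (a + 2) (a + 4) (by omega) dom2
  have n4 := S.nonpar_c (a + 2) (a + 4) (a + 5) (by omega) dom2
  have n5 := S.cn_le (a + 3) (a + 5) (by omega) dom3
  have n6 := S.le_cn (a + 3) (a + 5) (by omega) dom3
  have pl := S.pluecker (a + 2) dom2 dom3
  simp only [add_assoc, Nat.reduceAdd] at *
  have key : S.cs (a + 2) (a + 4) = S.es (a + 5) := by
    by_contra hne
    rcases n4 hne with g | g <;> linarith
  rw [f1] at i3 j3 j4
  rw [f2] at i4 k6
  rw [← k8] at i2 k5
  rw [key] at pl n3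
  rw [k3] at pl
  rcases pl with pl | ⟨pl | pl, pl' | pl'⟩
  · linarith
  · linarith
  · linarith
  · linarith
  · linarith

lemma Gap.eq_two {a m n r : ℕ} (h : S.Gap a m) (h' : S.Gap (a + m) n)
    (h'' : S.Gap (a + m + n) r) : r = 2 := by
  have h1 := h'.two_le
  have h2 := h'.le_four
  have h3 := h.ne_four h'
  have h4 := h''.two_le
  have h5 := h''.le_four
  have h6 := h'.ne_four h''
  by_contra hr
  have : r = 3 := by omega
  subst this
  obtain rfl | rfl : n = 2 ∨ n = 3 := by omega
  · exact no_two_three h' h''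
  · exact no_three_three h' h''

variable (S)

/-- Eventually the elements in `J` and outside `J` alternate. -/
theorem eventually_xor : ∃ K, ∀ k, K ≤ k → Xor' (S.J k) (S.J (k + 1)) := by
  obtain ⟨a, -, ha⟩ := S.exists_not_J 0
  obtain ⟨m, hm⟩ := S.exists_gap ha
  obtain ⟨n, hn⟩ := S.exists_gap hm.2.2.1
  have key : ∀ d, ∃ b r s, S.Gap b r ∧ S.Gap (b + r) s ∧
      b + r + s = a + m + n + 2 * d := by
    intro d
    induction d with
    | zero => exact ⟨a, m, n, hm, hn, rfl⟩
    | succ d ih =>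
      obtain ⟨b, r, s, h1, h2, h3⟩ := ih
      obtain ⟨t, ht⟩ := S.exists_gap h2.2.2.1
      have := h1.eq_two h2 ht
      subst this
      exact ⟨b + r, s, 2, h2, ht, by omega⟩
  refine ⟨a + m + n, fun k hk => ?_⟩
  have hN : ∀ d, ¬ S.J (a + m + n + 2 * d) := by
    intro d
    obtain ⟨b, r, s, -, h2, h3⟩ := key d
    rw [← h3]
    exact h2.2.2.1
  obtain ⟨d, hd⟩ : ∃ d, k = a + m + n + 2 * d ∨ k = a + m + n + 2 * d + 1 :=
    ⟨(k - (a + m + n)) / 2, by omega⟩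
  rcases hd with rfl | rfl
  · exact Or.inr ⟨S.J_succ_of_not (hN d), hN d⟩
  · exact Or.inl ⟨S.J_succ_of_not (hN d), hN (d + 1)⟩

end LogData

section

lemma abs_add_le' {a b A B : ℝ} (ha : |a| ≤ A) (hb : |b| ≤ B) : |a + b| ≤ A + B :=
  (abs_add_le a b).trans (add_le_add ha hb)

lemma abs_sub_le' {a b A B : ℝ} (ha : |a| ≤ A) (hb : |b| ≤ B) : |a - b| ≤ A + B :=
  (abs_sub a b).trans (add_le_add ha hb)

lemma abs_mul_le' {a b A B : ℝ} (ha : |a| ≤ A) (hb : |b| ≤ B) : |a * b| ≤ A * B := by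
  rw [abs_mul]
  exact mul_le_mul ha hb (abs_nonneg _) ((abs_nonneg _).trans ha)

/-- The point `a` has coordinates at most `X` and successive errors at most `D`. -/
structure Bd (ξ : ℝ) (a : Fin 4 → ℤ) (X D : ℝ) : Prop where
  c0 : |(a 0 : ℝ)| ≤ X
  c1 : |(a 1 : ℝ)| ≤ X
  c2 : |(a 2 : ℝ)| ≤ X
  c3 : |(a 3 : ℝ)| ≤ X
  d1 : |(a 1 : ℝ) - ξ * a 0| ≤ D
  d2 : |(a 2 : ℝ) - ξ * a 1| ≤ D
  d3 : |(a 3 : ℝ) - ξ * a 2| ≤ D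

/-- Coefficients of the quadratic form attached to a point. -/
def q0 (a : Fin 4 → ℤ) : ℤ := a 1 * a 3 - a 2 ^ 2
/-- Second coefficient of the quadratic form attached to a point. -/
def q1 (a : Fin 4 → ℤ) : ℤ := a 1 * a 2 - a 0 * a 3
/-- Third coefficient of the quadratic form attached to a point. -/
def q2 (a : Fin 4 → ℤ) : ℤ := a 0 * a 2 - a 1 ^ 2
/-- First component of the vector `C(a, b)`. -/
def cf (a b : Fin 4 → ℤ) : ℤ := q0 a * b 0 + q1 a * b 1 + q2 a * b 2
/-- Second component of the vector `C(a, b)`. -/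
def cg (a b : Fin 4 → ℤ) : ℤ := q0 a * b 1 + q1 a * b 2 + q2 a * b 3
/-- The error `cg - ξ cf`. -/
def cdel (ξ : ℝ) (a b : Fin 4 → ℤ) : ℝ := cg a b - ξ * cf a b
/-- The value at `ξ` of the quadratic form attached to a point. -/
def qval (ξ : ℝ) (a : Fin 4 → ℤ) : ℝ := q0 a + q1 a * ξ + q2 a * ξ ^ 2
/-- The alternating form `det(Ξ, d_a, d_b)`. -/
def sform (ξ : ℝ) (a b : Fin 4 → ℤ) : ℝ :=
  ((a 2 - ξ * a 1) * (b 3 - ξ * b 2) - (a 3 - ξ * a 2) * (b 2 - ξ * b 1)) -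
  ξ * ((a 1 - ξ * a 0) * (b 3 - ξ * b 2) - (a 3 - ξ * a 2) * (b 1 - ξ * b 0)) +
  ξ ^ 2 * ((a 1 - ξ * a 0) * (b 2 - ξ * b 1) - (a 2 - ξ * a 1) * (b 1 - ξ * b 0))

lemma sform_pluecker (ξ : ℝ) (a b c d : Fin 4 → ℤ) :
    sform ξ c d * sform ξ b a + sform ξ d b * sform ξ c a + sform ξ b c * sform ξ d a = 0 := by
  simp only [sform]; ring

section estimates
variable {ξ N : ℝ} {a b : Fin 4 → ℤ} {X D X' D' : ℝ}

lemma Bd.q0_le (ha : Bd ξ a X D) : |(q0 a : ℝ)| ≤ 2 * X * D := by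
  have : (q0 a : ℝ) = a 1 * (a 3 - ξ * a 2) - a 2 * (a 2 - ξ * a 1) := by
    simp only [q0]; push_cast; ring
  rw [this]
  exact (abs_sub_le' (abs_mul_le' ha.c1 ha.d3) (abs_mul_le' ha.c2 ha.d2)).trans (by linarith)

lemma Bd.q1_le (ha : Bd ξ a X D) : |(q1 a : ℝ)| ≤ 2 * X * D := by
  have : (q1 a : ℝ) = a 2 * (a 1 - ξ * a 0) - a 0 * (a 3 - ξ * a 2) := by
    simp only [q1]; push_cast; ring
  rw [this]
  exact (abs_sub_le' (abs_mul_le' ha.c2 ha.d1) (abs_mul_le' ha.c0 ha.d3)).trans (by linarith)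

lemma Bd.q2_le (ha : Bd ξ a X D) : |(q2 a : ℝ)| ≤ 2 * X * D := by
  have : (q2 a : ℝ) = a 0 * (a 2 - ξ * a 1) - a 1 * (a 1 - ξ * a 0) := by
    simp only [q2]; push_cast; ring
  rw [this]
  exact (abs_sub_le' (abs_mul_le' ha.c0 ha.d2) (abs_mul_le' ha.c1 ha.d1)).trans (by linarith)

lemma Bd.cdel_le (ha : Bd ξ a X D) (hb : Bd ξ b X' D') :
    |cdel ξ a b| ≤ 6 * (X * D * D') := by
  have : cdel ξ a b = q0 a * (b 1 - ξ * b 0) + q1 a * (b 2 - ξ * b 1) + q2 a * (b 3 - ξ * b 2) := by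
    simp only [cdel, cf, cg]; push_cast; ring
  rw [this]
  exact (abs_add_le' (abs_add_le' (abs_mul_le' ha.q0_le hb.d1) (abs_mul_le' ha.q1_le hb.d2))
    (abs_mul_le' ha.q2_le hb.d3)).trans (by linarith)

lemma Bd.w_le (hN : 1 ≤ N) (hξ : |ξ| ≤ N) (ha : Bd ξ a X D) :
    |((a 2 : ℝ) - ξ * a 1) + ξ * (a 1 - ξ * a 0)| ≤ 2 * N * D := by
  have hD : 0 ≤ D := (abs_nonneg _).trans ha.d1
  exact (abs_add_le' ha.d2 (abs_mul_le' hξ ha.d1)).trans (by nlinarith)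

lemma Bd.qval_le (hN : 1 ≤ N) (hξ : |ξ| ≤ N) (ha : Bd ξ a X D) :
    |qval ξ a| ≤ 6 * N ^ 2 * (D * D) := by
  have hD : 0 ≤ D := (abs_nonneg _).trans ha.d1
  set w := ((a 2 : ℝ) - ξ * a 1) + ξ * (a 1 - ξ * a 0) with hw
  have : qval ξ a = ((a 1 - ξ * a 0) * (a 3 - ξ * a 2) - w * (a 2 - ξ * a 1)) +
      (ξ * (w * (a 1 - ξ * a 0)) - ξ * (ξ * ((a 1 - ξ * a 0) * (a 1 - ξ * a 0)))) := by
    simp only [qval, q0, q1, q2, hw]; push_cast; ring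
  rw [this]
  have hw' := ha.w_le hN hξ
  refine (abs_add_le' (abs_sub_le' (abs_mul_le' ha.d1 ha.d3) (abs_mul_le' hw' ha.d2))
    (abs_sub_le' (abs_mul_le' hξ (abs_mul_le' hw' ha.d1))
      (abs_mul_le' hξ (abs_mul_le' hξ (abs_mul_le' ha.d1 ha.d1))))).trans ?_
  have h1 : 0 ≤ D * D := by positivity
  nlinarith [mul_nonneg h1 (show 0 ≤ N - 1 by linarith), mul_nonneg h1 (show 0 ≤ (N - 1) * N by nlinarith)]

lemma Bd.cf_sub_le (hN : 1 ≤ N) (hξ : |ξ| ≤ N) (ha : Bd ξ a X D) (hb : Bd ξ b X' D') :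
    |(cf a b : ℝ) - b 0 * qval ξ a| ≤ 6 * N ^ 2 * (X * D * D') := by
  have hD : 0 ≤ D := (abs_nonneg _).trans ha.d1
  have hX : 0 ≤ X := (abs_nonneg _).trans ha.c1
  have hD' : 0 ≤ D' := (abs_nonneg _).trans hb.d1
  have : (cf a b : ℝ) - b 0 * qval ξ a = q1 a * (b 1 - ξ * b 0) +
      q2 a * (((b 2 : ℝ) - ξ * b 1) + ξ * (b 1 - ξ * b 0)) := by
    simp only [cf, qval]; push_cast; ring
  rw [this]
  refine (abs_add_le' (abs_mul_le' ha.q1_le hb.d1) (abs_mul_le' ha.q2_le (hb.w_le hN hξ))).trans ?_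
  have h1 : 0 ≤ X * D * D' := by positivity
  nlinarith [mul_nonneg h1 (show 0 ≤ N - 1 by linarith), mul_nonneg h1 (show 0 ≤ (N - 1) * N by nlinarith)]

lemma Bd.sform_le (hN : 1 ≤ N) (hξ : |ξ| ≤ N) (ha : Bd ξ a X D) (hb : Bd ξ b X' D') :
    |sform ξ a b| ≤ 6 * N ^ 2 * (D * D') := by
  have hD : 0 ≤ D := (abs_nonneg _).trans ha.d1
  have hD' : 0 ≤ D' := (abs_nonneg _).trans hb.d1
  have hξ2 : |ξ ^ 2| ≤ N ^ 2 := by rw [abs_pow]; gcongr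
  refine (abs_add_le' (abs_sub_le'
    (abs_sub_le' (abs_mul_le' ha.d2 hb.d3) (abs_mul_le' ha.d3 hb.d2))
    (abs_mul_le' hξ (abs_sub_le' (abs_mul_le' ha.d1 hb.d3) (abs_mul_le' ha.d3 hb.d1))))
    (abs_mul_le' hξ2 (abs_sub_le' (abs_mul_le' ha.d1 hb.d2) (abs_mul_le' ha.d2 hb.d1)))).trans ?_
  have h1 : 0 ≤ D * D' := by positivity
  nlinarith [mul_nonneg h1 (show 0 ≤ N - 1 by linarith), mul_nonneg h1 (show 0 ≤ (N - 1) * N by nlinarith)]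

lemma Bd.cdel_sub_le (hN : 1 ≤ N) (hξ : |ξ| ≤ N) (ha : Bd ξ a X D) (hb : Bd ξ b X' D') :
    |cdel ξ a b - a 0 * sform ξ a b| ≤ 6 * N ^ 2 * (D * D * D') := by
  have hD : 0 ≤ D := (abs_nonneg _).trans ha.d1
  have hD' : 0 ≤ D' := (abs_nonneg _).trans hb.d1
  have : cdel ξ a b - a 0 * sform ξ a b =
      (((a 2 : ℝ) - ξ * a 1) + ξ * (a 1 - ξ * a 0)) *
        ((a 1 - ξ * a 0) * (b 2 - ξ * b 1) - (a 2 - ξ * a 1) * (b 1 - ξ * b 0)) -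
      (a 1 - ξ * a 0) *
        ((a 1 - ξ * a 0) * (b 3 - ξ * b 2) - (a 3 - ξ * a 2) * (b 1 - ξ * b 0)) := by
    simp only [cdel, cf, cg, q0, q1, q2, sform]; push_cast; ring
  rw [this]
  refine (abs_sub_le' (abs_mul_le' (ha.w_le hN hξ) (abs_sub_le' (abs_mul_le' ha.d1 hb.d2)
    (abs_mul_le' ha.d2 hb.d1))) (abs_mul_le' ha.d1 (abs_sub_le' (abs_mul_le' ha.d1 hb.d3)
    (abs_mul_le' ha.d3 hb.d1)))).trans ?_
  have h1 : 0 ≤ D * D * D' := by positivity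
  nlinarith [mul_nonneg h1 (show 0 ≤ N - 1 by linarith), mul_nonneg h1 (show 0 ≤ (N - 1) * N by nlinarith)]

end estimates

end

section

lemma lambda3_gt : (0.4245069 : ℝ) < lambda3 := by
  have h5 : Real.sqrt 5 ^ 2 = 5 := Real.sq_sqrt (by norm_num)
  have h0 := Real.sqrt_nonneg 5
  have hlo : 2.2360679774 < Real.sqrt 5 := by nlinarith
  have hhi : Real.sqrt 5 < 2.2360679775 := by nlinarith
  have g3 : gold ^ 3 = 2 + Real.sqrt 5 := by
    unfold gold; nlinarith
  have g6 : gold ^ 6 = (2 + Real.sqrt 5) ^ 2 := by rw [← g3]; ring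
  unfold lambda3
  rw [g6, g3]
  unfold gold
  have : Real.sqrt ((2 + Real.sqrt 5) ^ 2 - 4 * ((1 + Real.sqrt 5) / 2)) <
      2 + Real.sqrt 5 - 2 * 0.4245069 := by
    rw [Real.sqrt_lt' (by linarith)]
    nlinarith
  linarith

section norms
variable {ξ : ℝ} (a : Fin 4 → ℤ)

lemma abs_le_znorm (j : Fin 4) : |(a j : ℝ)| ≤ znorm a := by
  unfold znorm; fin_cases j <;> simp

lemma znorm_le {a : Fin 4 → ℤ} {R : ℝ} (h : ∀ j, |(a j : ℝ)| ≤ R) : znorm a ≤ R := by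
  unfold znorm; simp [h]

lemma abs_le_zL (j : Fin 4) : |(a 0 : ℝ) * ξ ^ (j : ℕ) - a j| ≤ zL ξ a := by
  unfold zL; fin_cases j <;> simp

lemma zL_le {a : Fin 4 → ℤ} {R : ℝ} (h : ∀ j : Fin 4, 1 ≤ (j : ℕ) →
    |(a 0 : ℝ) * ξ ^ (j : ℕ) - a j| ≤ R) : zL ξ a ≤ R := by
  have h1 := h 1 (by simp)
  have h2 := h 2 (by simp)
  have h3 := h 3 (by simp)
  simp only [Fin.val_one, Fin.val_two, pow_one] at h1 h2
  have h3' : |(a 0 : ℝ) * ξ ^ 3 - a 3| ≤ R := h3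
  unfold zL; simp [h1, h2, h3']

lemma exists_eq_zL : ∃ j : Fin 4, zL ξ a = |(a 0 : ℝ) * ξ ^ (j : ℕ) - a j| := by
  unfold zL
  rcases max_choice (max |(a 0 : ℝ) * ξ - a 1| |(a 0 : ℝ) * ξ ^ 2 - a 2|)
    |(a 0 : ℝ) * ξ ^ 3 - a 3| with h | h
  · rcases max_choice |(a 0 : ℝ) * ξ - a 1| |(a 0 : ℝ) * ξ ^ 2 - a 2| with h' | h'
    · exact ⟨1, by rw [h, h']; simp⟩
    · exact ⟨2, by rw [h, h']; simp⟩
  · exact ⟨3, by rw [h]; simp⟩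

lemma exists_eq_znorm : ∃ j : Fin 4, znorm a = |(a j : ℝ)| := by
  unfold znorm
  rcases max_choice (max |(a 0 : ℝ)| |(a 1 : ℝ)|) (max |(a 2 : ℝ)| |(a 3 : ℝ)|) with h | h <;>
    rw [h]
  · rcases max_choice |(a 0 : ℝ)| |(a 1 : ℝ)| with h' | h' <;> rw [h'] <;> exact ⟨_, rfl⟩
  · rcases max_choice |(a 2 : ℝ)| |(a 3 : ℝ)| with h' | h' <;> rw [h'] <;> exact ⟨_, rfl⟩

lemma exists_znorm_eq_nat : ∃ m : ℕ, znorm a = m := by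
  obtain ⟨j, hj⟩ := exists_eq_znorm a
  exact ⟨(a j).natAbs, by rw [hj, Nat.cast_natAbs]; push_cast; rfl⟩

lemma zL_nonneg : 0 ≤ zL ξ a := (abs_nonneg _).trans (abs_le_zL a 0)

lemma znorm_nonneg : 0 ≤ znorm a := (abs_nonneg _).trans (abs_le_znorm a 0)

lemma one_le_znorm {a : Fin 4 → ℤ} (h : a ≠ 0) : 1 ≤ znorm a := by
  obtain ⟨j, hj⟩ := Function.ne_iff.1 h
  refine le_trans ?_ (abs_le_znorm a j)
  exact_mod_cast Int.one_le_abs hj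

end norms

/-- A sequence of minimal points with the estimates valid from the index `n₀` on. -/
structure MinCtx (ξ : ℝ) (x : ℕ → Fin 4 → ℤ) (N : ℝ) (n₀ : ℕ) : Prop where
  hmin : IsMinimalSeq ξ x
  hlin : ∀ n : Fin 4 → ℤ, (n 0 : ℝ) + n 1 * ξ + n 2 * ξ ^ 2 + n 3 * ξ ^ 3 = 0 → n = 0
  one_le : 1 ≤ N
  hξ : |ξ| ≤ N
  pow_le : ∀ j : Fin 4, |ξ| ^ (j : ℕ) ≤ N
  two_le : 2 ≤ n₀
  bd : ∀ i, n₀ ≤ i → Bd ξ (x i) (znorm (x i)) (N * zL ξ (x i))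
  X_le : ∀ i, n₀ ≤ i → znorm (x i) ≤ N * |(x i 0 : ℝ)|
  X_large : ∀ i, n₀ ≤ i → 100 * N ≤ znorm (x i)
  L_le : ∀ i, n₀ ≤ i →
    Real.log (zL ξ (x i)) ≤ -0.4245069 * Real.log (znorm (x (i + 1)))
  L_le_one : ∀ i, n₀ ≤ i → zL ξ (x i) ≤ 1
  L_pos : ∀ i, n₀ ≤ i → 0 < zL ξ (x i)

section construction
variable {ξ : ℝ} {x : ℕ → Fin 4 → ℤ}

lemma IsMinimalSeq.L_pos (h : IsMinimalSeq ξ x) {i : ℕ} (hi : 1 ≤ i) : 0 < zL ξ (x i) :=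
  (zL_nonneg _).trans_lt (h.2.2.1 i hi)

lemma IsMinimalSeq.X_ge (h : IsMinimalSeq ξ x) (i : ℕ) : (i : ℝ) ≤ znorm (x (i + 1)) := by
  induction i with
  | zero => simpa using znorm_nonneg _
  | succ i ih =>
    have h1 := h.2.1 (i + 1) (by omega)
    obtain ⟨m, hm⟩ := exists_znorm_eq_nat (x (i + 1))
    obtain ⟨m', hm'⟩ := exists_znorm_eq_nat (x (i + 1 + 1))
    rw [hm, hm'] at h1
    rw [hm] at ih
    rw [hm']
    have h2 : m < m' := by exact_mod_cast h1
    have h3 : i ≤ m := by exact_mod_cast ih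
    exact_mod_cast (show i + 1 ≤ m' by omega)

lemma IsMinimalSeq.tendsto_X (h : IsMinimalSeq ξ x) :
    Filter.Tendsto (fun i => znorm (x i)) Filter.atTop Filter.atTop := by
  rw [← Filter.tendsto_add_atTop_iff_nat 1]
  exact Filter.tendsto_atTop_mono h.X_ge tendsto_natCast_atTop_atTop

lemma pow_abs_le {B : ℝ} (hB : 1 + |ξ| = B) (j : Fin 4) : |ξ| ^ (j : ℕ) ≤ B ^ 3 := by
  have h0 := abs_nonneg ξ
  calc |ξ| ^ (j : ℕ) ≤ B ^ (j : ℕ) := by gcongr; linarith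
    _ ≤ B ^ 3 := pow_le_pow_right₀ (by linarith) (by omega)

lemma znorm_le_of_zL {B : ℝ} (hB : 1 + |ξ| = B) (a : Fin 4 → ℤ) :
    znorm a ≤ B ^ 3 * |(a 0 : ℝ)| + zL ξ a := by
  refine znorm_le fun j => ?_
  have h1 := abs_le_zL (ξ := ξ) a j
  have h2 : |(a 0 : ℝ) * ξ ^ (j : ℕ)| ≤ B ^ 3 * |(a 0 : ℝ)| := by
    rw [abs_mul, abs_pow, mul_comm]
    have := pow_abs_le hB j
    gcongr
  have h3 : (a j : ℝ) = a 0 * ξ ^ (j : ℕ) - (a 0 * ξ ^ (j : ℕ) - a j) := by ring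
  rw [h3]
  exact abs_sub_le' h2 h1

open Filter in
theorem MinCtx.exists (hξ : LinearIndependent ℚ ![(1 : ℝ), ξ, ξ ^ 2, ξ ^ 3])
    {c : ℝ} (hc : 0 < c) (happrox : ApproxHyp ξ c lambda3) (hmin : IsMinimalSeq ξ x) :
    ∃ N n₀, MinCtx ξ x N n₀ := by
  obtain ⟨X₀, hX₀⟩ := happrox
  obtain ⟨B, hB⟩ : ∃ B, 1 + |ξ| = B := ⟨_, rfl⟩
  have hB1 : 1 ≤ B := by linarith [abs_nonneg ξ]
  have hB3 : B ≤ B ^ 3 := by nlinarith [sq_nonneg B]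
  have hlam := lambda3_gt
  set κ := 2 * B ^ 3 with hκ
  have hκpos : 0 < κ := by positivity
  have hX := hmin.tendsto_X
  have hX1 : Tendsto (fun i => znorm (x (i + 1))) atTop atTop := (tendsto_add_atTop_iff_nat 1).2 hX
  have hR : Tendsto (fun i => znorm (x (i + 1)) / κ) atTop atTop :=
    hX1.atTop_div_const hκpos
  have hsmall : Tendsto (fun i => c * (znorm (x (i + 1)) / κ) ^ (-lambda3)) atTop (nhds 0) := by
    have := ((tendsto_rpow_neg_atTop (show 0 < lambda3 by linarith)).comp hR).const_mul c
    simpa using this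
  have hlog : Tendsto (fun i => (lambda3 - 0.4245069) * Real.log (znorm (x (i + 1)))) atTop atTop :=
    (Real.tendsto_log_atTop.comp hX1).const_mul_atTop (by linarith)
  have ev : ∀ᶠ i in atTop, 2 ≤ i ∧ X₀ ≤ znorm (x (i + 1)) / κ ∧ 2 < znorm (x (i + 1)) ∧
      c * (znorm (x (i + 1)) / κ) ^ (-lambda3) < 1 ∧
      Real.log c + lambda3 * Real.log κ ≤
        (lambda3 - 0.4245069) * Real.log (znorm (x (i + 1))) ∧ 100 * κ ≤ znorm (x i) := by
    filter_upwards [eventually_ge_atTop 2, hR.eventually_ge_atTop X₀, hX1.eventually_gt_atTop 2,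
      hsmall.eventually_lt_const zero_lt_one, hlog.eventually_ge_atTop _,
      hX.eventually_ge_atTop (100 * κ)] with i h1 h2 h3 h4 h5 h6
    exact ⟨h1, h2, h3, h4, h5, h6⟩
  obtain ⟨n₀, hn₀⟩ := eventually_atTop.1 ev
  have hL : ∀ i, n₀ ≤ i → zL ξ (x i) ≤ c * (znorm (x (i + 1)) / κ) ^ (-lambda3) := by
    intro i hi
    obtain ⟨h2, hX0, hX2, h1, -⟩ := hn₀ i hi
    by_contra! hlt
    obtain ⟨z, hz0, hz1, hz2⟩ := hX₀ _ hX0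
    have hzL := zL_le hz2
    have h3 := hmin.2.2.2 i (by omega) z hz0 (hzL.trans_lt hlt)
    have h4 := znorm_le_of_zL hB z
    have h5 : B ^ 3 * |(z 0 : ℝ)| ≤ B ^ 3 * (znorm (x (i + 1)) / κ) := by gcongr
    have h6 : B ^ 3 * (znorm (x (i + 1)) / κ) = znorm (x (i + 1)) / 2 := by
      rw [hκ]; field_simp
    linarith
  have hL1 : ∀ i, n₀ ≤ i → zL ξ (x i) ≤ 1 := fun i hi => (hL i hi).trans (hn₀ i hi).2.2.2.1.le
  refine ⟨κ, n₀, hmin, ?_, by linarith, by linarith,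
    fun j => (pow_abs_le hB j).trans (by linarith), (hn₀ n₀ le_rfl).1, ?_, ?_, ?_, ?_, hL1, ?_⟩
  · intro n hn
    rw [Fintype.linearIndependent_iff] at hξ
    have := hξ (fun j => (n j : ℚ)) (by
      simp only [Fin.sum_univ_four, Rat.smul_def]
      simpa using hn)
    ext j
    simpa using this j
  · intro i hi
    have hd : ∀ j : Fin 4, |(x i j : ℝ) - x i 0 * ξ ^ (j : ℕ)| ≤ zL ξ (x i) := fun j => by
      rw [abs_sub_comm]; exact abs_le_zL _ _
    have h1 := hd 1
    have h2 := hd 2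
    have h3 : |(x i 3 : ℝ) - x i 0 * ξ ^ 3| ≤ zL ξ (x i) := hd 3
    simp only [Fin.val_one, Fin.val_two, pow_one] at h1 h2
    have hle : |ξ| ≤ B := by linarith
    have hL0 := zL_nonneg (ξ := ξ) (x i)
    have hbd : zL ξ (x i) + B * zL ξ (x i) ≤ κ * zL ξ (x i) := by
      rw [hκ]; nlinarith
    refine ⟨abs_le_znorm _ _, abs_le_znorm _ _, abs_le_znorm _ _, abs_le_znorm _ _, ?_, ?_, ?_⟩
    · rw [mul_comm ξ]
      refine h1.trans ?_
      nlinarith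
    · refine le_trans ?_ hbd
      rw [show (x i 2 : ℝ) - ξ * x i 1 = (x i 2 - x i 0 * ξ ^ 2) - ξ * (x i 1 - x i 0 * ξ) by ring]
      exact abs_sub_le' h2 (abs_mul_le' hle h1)
    · refine le_trans ?_ hbd
      rw [show (x i 3 : ℝ) - ξ * x i 2 = (x i 3 - x i 0 * ξ ^ 3) - ξ * (x i 2 - x i 0 * ξ ^ 2) by ring]
      exact abs_sub_le' h3 (abs_mul_le' hle h2)
  · intro i hi
    have h1 := znorm_le_of_zL hB (x i)
    have h2 := hL1 i hi
    have h3 := (hn₀ i hi).2.2.2.2.2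
    have h4 : x i 0 ≠ 0 := by
      intro h0
      rw [h0] at h1
      simp only [Int.cast_zero, abs_zero, mul_zero, zero_add] at h1
      nlinarith
    have h5 : (1 : ℝ) ≤ |(x i 0 : ℝ)| := by exact_mod_cast Int.one_le_abs h4
    rw [hκ]
    nlinarith
  · exact fun i hi => (hn₀ i hi).2.2.2.2.2
  · intro i hi
    have h1 := hL i hi
    obtain ⟨h2, hX0, hX2, -, h5, -⟩ := hn₀ i hi
    have hpos := hmin.L_pos (i := i) (by omega)
    have h3 := Real.log_le_log hpos h1
    rw [Real.log_mul hc.ne' (by positivity), Real.log_rpow (by positivity),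
      Real.log_div (by positivity) (by positivity)] at h3
    linarith
  · exact fun i hi => hmin.L_pos (by have := (hn₀ n₀ le_rfl).1; omega)

end construction

end

section

/-- Two consecutive minimal points. -/
structure MinPair (ξ : ℝ) (a b : Fin 4 → ℤ) : Prop where
  X_lt : znorm a < znorm b
  L_lt : zL ξ b < zL ξ a
  minimal : ∀ y : Fin 4 → ℤ, y ≠ 0 → zL ξ y < zL ξ a → znorm b ≤ znorm y

/-- The `2 × 2` minors of a pair of integer points. -/
def mnr (a b : Fin 4 → ℤ) (p q : Fin 4) : ℤ := a p * b q - a q * b p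

lemma IsMinimalSeq.pair {ξ : ℝ} {x : ℕ → Fin 4 → ℤ} (h : IsMinimalSeq ξ x) {i : ℕ} (hi : 1 ≤ i) :
    MinPair ξ (x i) (x (i + 1)) :=
  ⟨h.2.1 i hi, h.2.2.1 i hi, h.2.2.2 i hi⟩

namespace MinPair
variable {ξ : ℝ} {a b : Fin 4 → ℤ}

lemma b_ne (h : MinPair ξ a b) : b ≠ 0 := by
  rintro rfl
  have h1 := h.X_lt
  simp [znorm] at h1
  linarith [abs_nonneg (a 0 : ℝ), h1.1.1]

lemma indep (h : MinPair ξ a b) {s t : ℝ} (hst : ∀ j, s * (a j : ℝ) + t * b j = 0) :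
    s = 0 ∧ t = 0 := by
  have hX : |t| * znorm b ≤ |s| * znorm a := by
    obtain ⟨j, hj⟩ := exists_eq_znorm b
    rw [hj, ← abs_mul, show t * (b j : ℝ) = -(s * a j) by linarith [hst j], abs_neg, abs_mul]
    gcongr
    exact abs_le_znorm _ _
  have hL : |s| * zL ξ a ≤ |t| * zL ξ b := by
    obtain ⟨j, hj⟩ := exists_eq_zL (ξ := ξ) a
    rw [hj, ← abs_mul, show s * ((a 0 : ℝ) * ξ ^ (j : ℕ) - a j) = -(t * (b 0 * ξ ^ (j : ℕ) - b j)) by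
      linear_combination ξ ^ (j : ℕ) * hst 0 - hst j, abs_neg, abs_mul]
    gcongr
    exact abs_le_zL _ _
  have h1 := h.X_lt
  have h2 := h.L_lt
  have h3 := znorm_nonneg a
  have h4 := zL_nonneg (ξ := ξ) b
  have ht : |t| = 0 := by
    by_contra hne
    have : 0 < |t| := lt_of_le_of_ne (abs_nonneg _) (Ne.symm hne)
    have hs := abs_nonneg s
    have h5 : |t| ≤ |s| := le_of_mul_le_mul_right (a := znorm b)
      (hX.trans (by gcongr)) (h3.trans_lt h1)
    have h6 : |s| < |t| := lt_of_mul_lt_mul_right (a := zL ξ a)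
      (hL.trans_lt (by gcongr)) (h4.trans h2.le)
    linarith
  have hs : |s| = 0 := by
    rw [ht] at hL
    nlinarith [abs_nonneg s]
  exact ⟨abs_eq_zero.1 hs, abs_eq_zero.1 ht⟩

lemma indep_int (h : MinPair ξ a b) {s t : ℤ} (hst : s • a + t • b = 0) : s = 0 ∧ t = 0 := by
  have := h.indep (s := s) (t := t) fun j => by
    have := congrFun hst j
    simp at this
    exact_mod_cast this
  exact_mod_cast this

/-- A pair of consecutive minimal points is a basis of the integer points of its span. -/
lemma exists_int (h : MinPair ξ a b) {z : Fin 4 → ℤ} {s t : ℝ}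
    (hz : ∀ j, (z j : ℝ) = s * a j + t * b j) : ∃ m n : ℤ, z = m • a + n • b := by
  refine ⟨round s, round t, ?_⟩
  by_contra hne
  set w := z - (round s • a + round t • b) with hw
  have hw0 : w ≠ 0 := sub_ne_zero.2 hne
  have hs := abs_sub_round s
  have ht := abs_sub_round t
  have hwj : ∀ j, (w j : ℝ) = (s - round s) * a j + (t - round t) * b j := fun j => by
    simp [hw, hz j]; ring
  have h1 : zL ξ w < zL ξ a := by
    refine (zL_le (R := 1 / 2 * zL ξ a + 1 / 2 * zL ξ b) fun j _ => ?_).trans_lt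
      (by linarith [h.L_lt])
    rw [show (w 0 : ℝ) * ξ ^ (j : ℕ) - w j = (s - round s) * (a 0 * ξ ^ (j : ℕ) - a j) +
      (t - round t) * (b 0 * ξ ^ (j : ℕ) - b j) by rw [hwj, hwj]; ring]
    exact abs_add_le' (abs_mul_le' hs (abs_le_zL _ _)) (abs_mul_le' ht (abs_le_zL _ _))
  have h2 : znorm w < znorm b := by
    refine (znorm_le (R := 1 / 2 * znorm a + 1 / 2 * znorm b) fun j => ?_).trans_lt
      (by linarith [h.X_lt])
    rw [hwj]
    exact abs_add_le' (abs_mul_le' hs (abs_le_znorm _ _)) (abs_mul_le' ht (abs_le_znorm _ _))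
  exact absurd (h.minimal w hw0 h1) (not_le.2 h2)

/-- The second point of a minimal pair is primitive. -/
lemma primitive (h : MinPair ξ a b) {d : ℤ} {z : Fin 4 → ℤ} (hz : b = d • z) : IsUnit d := by
  have hd : d ≠ 0 := by
    rintro rfl
    exact h.b_ne (by simpa using hz)
  have hdR : (d : ℝ) ≠ 0 := by exact_mod_cast hd
  obtain ⟨m, n, hmn⟩ := h.exists_int (z := z) (s := 0) (t := (d : ℝ)⁻¹) fun j => by
    rw [hz]; simp; field_simp
  have := h.indep_int (s := d * m) (t := d * n - 1) (by
    rw [sub_smul, mul_smul, mul_smul]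
    have : d • (m • a + n • b) = b := by rw [← hmn, hz]
    rw [smul_add] at this
    rw [one_smul]
    linear_combination (exp := 1) this)
  exact IsUnit.of_mul_eq_one n (by linarith [this.2])

/-- The minors of a minimal pair have no common divisor. -/
lemma minors_primitive (h : MinPair ξ a b) {d : ℤ} (hd : ∀ p q, d ∣ mnr a b p q) : IsUnit d := by
  by_cases hd0 : d = 0
  · exfalso
    subst hd0
    have hm : ∀ p q, mnr a b p q = 0 := fun p q => by simpa using hd p q
    have hb : ∀ p, b p = 0 := fun p => by
      have := h.indep_int (s := b p) (t := -a p) (by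
        ext q; have := hm p q; simp [mnr] at this ⊢; linarith)
      exact this.1
    exact h.b_ne (funext hb)
  have hdR : (d : ℝ) ≠ 0 := by exact_mod_cast hd0
  have key : ∀ p, d ∣ b p := fun p => by
    choose z hz using fun q => hd p q
    obtain ⟨m, n, hmn⟩ := h.exists_int (z := z) (s := -(b p : ℝ) / d) (t := (a p : ℝ) / d)
      fun j => by
        have := hz j
        simp only [mnr] at this
        have h2 : (a p : ℝ) * b j - a j * b p = d * z j := by exact_mod_cast this
        field_simp; linarith
    have := h.indep_int (s := b p + d * m) (t := -a p + d * n) (by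
      ext q
      have h1 := hz q
      have h2 := congrFun hmn q
      simp [mnr] at h1 h2 ⊢
      rw [h2] at h1
      linarith)
    exact ⟨-m, by linarith [this.1]⟩
  choose z hz using key
  exact h.primitive (z := z) (funext hz)

end MinPair

end

section

namespace MinCtx
variable {ξ N : ℝ} {x : ℕ → Fin 4 → ℤ} {n₀ : ℕ}

lemma pair (H : MinCtx ξ x N n₀) {i : ℕ} (hi : n₀ ≤ i) : MinPair ξ (x i) (x (i + 1)) :=
  H.hmin.pair (by have := H.two_le; omega)

lemma X_lt (H : MinCtx ξ x N n₀) {i j : ℕ} (hi : n₀ ≤ i) (hij : i < j) :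
    znorm (x i) < znorm (x j) := by
  induction j, hij using Nat.le_induction with
  | base => exact (H.pair hi).X_lt
  | succ j hj ih => exact ih.trans (H.pair (by omega)).X_lt

lemma L_lt (H : MinCtx ξ x N n₀) {i j : ℕ} (hi : n₀ ≤ i) (hij : i < j) :
    zL ξ (x j) < zL ξ (x i) := by
  induction j, hij using Nat.le_induction with
  | base => exact (H.pair hi).L_lt
  | succ j hj ih => exact (H.pair (by omega)).L_lt.trans ih

lemma mnr_le (H : MinCtx ξ x N n₀) {i j : ℕ} (hi : n₀ ≤ i) (hij : i < j) (p q : Fin 4) :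
    |(mnr (x i) (x j) p q : ℝ)| ≤ 4 * N * (znorm (x j) * zL ξ (x i)) := by
  have hX := (H.X_lt hi hij).le
  have hL := (H.L_lt hi hij).le
  set a := x i
  set b := x j
  have e : (mnr a b p q : ℝ) =
      ((a 0 * ((ξ ^ (q : ℕ)) * (b 0 * ξ ^ (p : ℕ) - b p))) -
        (a 0 * ((ξ ^ (p : ℕ)) * (b 0 * ξ ^ (q : ℕ) - b q)))) +
      ((a 0 * ξ ^ (q : ℕ) - a q) * b p - (a 0 * ξ ^ (p : ℕ) - a p) * b q) := by
    simp only [mnr]; push_cast; ring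
  have hp : ∀ j : Fin 4, |ξ ^ (j : ℕ)| ≤ N := fun j => by rw [abs_pow]; exact H.pow_le j
  rw [e]
  refine (abs_add_le' (abs_sub_le'
    (abs_mul_le' (abs_le_znorm a 0) (abs_mul_le' (hp q) (abs_le_zL b p)))
    (abs_mul_le' (abs_le_znorm a 0) (abs_mul_le' (hp p) (abs_le_zL b q))))
    (abs_sub_le' (abs_mul_le' (abs_le_zL a q) (abs_le_znorm b p))
      (abs_mul_le' (abs_le_zL a p) (abs_le_znorm b q)))).trans ?_
  have h1 : znorm a * zL ξ b ≤ znorm b * zL ξ a :=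
    mul_le_mul hX hL (zL_nonneg _) (znorm_nonneg _)
  have h2 : 0 ≤ znorm b * zL ξ a := mul_nonneg (znorm_nonneg _) (zL_nonneg _)
  have h3 := H.one_le
  nlinarith

lemma exists_le_mnr (H : MinCtx ξ x N n₀) {i : ℕ} (hi : n₀ ≤ i) :
    ∃ q : Fin 4, znorm (x (i + 1)) * zL ξ (x i) ≤ 4 * N * |(mnr (x i) (x (i + 1)) 0 q : ℝ)| := by
  have h := H.pair hi
  have hXa := H.X_le i hi
  have hXb := H.X_le (i + 1) (by omega)
  have hla := H.X_large i hi
  have hLa := H.L_le_one i hi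
  have hLb := H.L_le_one (i + 1) (by omega)
  have hN := H.one_le
  have hpow := H.pow_le
  set a := x i
  set b := x (i + 1)
  have hLa0 := zL_nonneg (ξ := ξ) a
  have hLb0 := zL_nonneg (ξ := ξ) b
  have ha0 : 100 ≤ |(a 0 : ℝ)| := by
    by_contra! hlt
    nlinarith
  rcases le_or_gt (3 / 2 * |(a 0 : ℝ)|) |(b 0 : ℝ)| with hc | hc
  · obtain ⟨q, hq⟩ := exists_eq_zL (ξ := ξ) a
    refine ⟨q, ?_⟩
    have e : (mnr a b 0 q : ℝ) = b 0 * (a 0 * ξ ^ (q : ℕ) - a q) - a 0 * (b 0 * ξ ^ (q : ℕ) - b q) := by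
      simp only [mnr]; push_cast; ring
    have h1 := abs_sub_abs_le_abs_sub ((b 0 : ℝ) * (a 0 * ξ ^ (q : ℕ) - a q))
      (a 0 * (b 0 * ξ ^ (q : ℕ) - b q))
    rw [← e, abs_mul, abs_mul, ← hq] at h1
    have h2 : |(a 0 : ℝ)| * |b 0 * ξ ^ (q : ℕ) - b q| ≤ |(a 0 : ℝ)| * zL ξ a := by
      gcongr
      exact (abs_le_zL b q).trans h.L_lt.le
    have h3 : znorm b * zL ξ a ≤ N * |(b 0 : ℝ)| * zL ξ a := by gcongr
    have h4 : |(b 0 : ℝ)| * zL ξ a ≤ 4 * |(mnr a b 0 q : ℝ)| := by nlinarith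
    nlinarith
  · obtain ⟨s, hs, hs'⟩ : ∃ s : ℤ, |(s : ℝ)| = 1 ∧
        |(b 0 : ℝ) - s * a 0| = |(|(b 0 : ℝ)| - |(a 0 : ℝ)|)| := by
      rcases le_total 0 (a 0 : ℝ) with h1 | h1 <;> rcases le_total 0 (b 0 : ℝ) with h2 | h2
      · exact ⟨1, by simp, by simp [abs_of_nonneg h1, abs_of_nonneg h2]⟩
      · refine ⟨-1, by simp, ?_⟩
        rw [abs_of_nonneg h1, abs_of_nonpos h2, ← abs_neg]; congr 1; push_cast; ring
      · refine ⟨-1, by simp, ?_⟩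
        rw [abs_of_nonpos h1, abs_of_nonneg h2]; congr 1; push_cast; ring
      · refine ⟨1, by simp, ?_⟩
        rw [abs_of_nonpos h1, abs_of_nonpos h2, ← abs_neg]; congr 1; push_cast; ring
    set c := b - s • a with hcdef
    have hcj : ∀ j, (c j : ℝ) = b j - s * a j := fun j => by simp [hcdef]
    have hc0 : |(c 0 : ℝ)| = |(|(b 0 : ℝ)| - |(a 0 : ℝ)|)| := by rw [hcj, hs']
    have hne : c ≠ 0 := by
      intro h0
      have := (h.indep_int (s := -s) (t := 1) (by rw [← h0, hcdef]; simp; abel)).2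
      exact one_ne_zero this
    -- comparison of `znorm` with the zeroth coordinate
    obtain ⟨M, hM1, hMN, hMpow, hMlow⟩ : ∃ M : ℝ, 1 ≤ M ∧ M ≤ N ∧ (∀ j : Fin 4, |ξ| ^ (j : ℕ) ≤ M) ∧
        ∀ z : Fin 4 → ℤ, M * |(z 0 : ℝ)| ≤ znorm z + zL ξ z := by
      obtain ⟨k, hk⟩ := Finite.exists_max fun j : Fin 4 => |ξ| ^ (j : ℕ)
      refine ⟨|ξ| ^ (k : ℕ), by simpa using hk 0, hpow k, hk, fun z => ?_⟩
      have h1 := abs_le_zL (ξ := ξ) z k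
      have h2 := abs_le_znorm z k
      have h3 := abs_add_le' h2 h1
      rwa [add_sub_cancel, abs_mul, abs_pow, mul_comm] at h3
    have hcL : zL ξ c ≤ 2 := by
      refine zL_le fun j _ => ?_
      rw [show (c 0 : ℝ) * ξ ^ (j : ℕ) - c j = (b 0 * ξ ^ (j : ℕ) - b j) -
        s * (a 0 * ξ ^ (j : ℕ) - a j) by rw [hcj, hcj]; ring]
      refine (abs_sub_le' (abs_le_zL b j) (abs_mul_le' hs.le (abs_le_zL a j))).trans ?_
      linarith
    have hMa := hMlow a
    have hMb : znorm b ≤ M * |(b 0 : ℝ)| + zL ξ b := by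
      refine znorm_le fun j => ?_
      rw [show (b j : ℝ) = ξ ^ (j : ℕ) * b 0 - (b 0 * ξ ^ (j : ℕ) - b j) by ring]
      exact abs_sub_le' (abs_mul_le' (by rw [abs_pow]; exact hMpow j) le_rfl) (abs_le_zL b j)
    have hcX : znorm c ≤ M * |(c 0 : ℝ)| + zL ξ c := by
      refine znorm_le fun j => ?_
      rw [show (c j : ℝ) = ξ ^ (j : ℕ) * c 0 - (c 0 * ξ ^ (j : ℕ) - c j) by ring]
      exact abs_sub_le' (abs_mul_le' (by rw [abs_pow]; exact hMpow j) le_rfl) (abs_le_zL c j)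
    have hlow : |(a 0 : ℝ)| - 2 ≤ |(b 0 : ℝ)| := by
      by_contra! hlt
      nlinarith [h.X_lt]
    have hc0' : |(c 0 : ℝ)| ≤ 1 / 2 * |(a 0 : ℝ)| := by
      rw [hc0, abs_le]; constructor <;> linarith
    have hcX' : znorm c < znorm b := by
      have : M * |(c 0 : ℝ)| ≤ M * (1 / 2 * |(a 0 : ℝ)|) := by gcongr
      nlinarith [h.X_lt]
    have hcL' : zL ξ a ≤ zL ξ c := by
      by_contra! hlt
      exact absurd (h.minimal c hne hlt) (not_le.2 hcX')
    obtain ⟨q, hq⟩ := exists_eq_zL (ξ := ξ) c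
    refine ⟨q, ?_⟩
    have e : (mnr a b 0 q : ℝ) = c 0 * (a 0 * ξ ^ (q : ℕ) - a q) - a 0 * (c 0 * ξ ^ (q : ℕ) - c q) := by
      simp only [mnr, hcj]; push_cast; ring
    have h1 := abs_sub_abs_le_abs_sub ((a 0 : ℝ) * (c 0 * ξ ^ (q : ℕ) - c q))
      (c 0 * (a 0 * ξ ^ (q : ℕ) - a q))
    rw [abs_sub_comm, ← e, abs_mul, abs_mul, ← hq] at h1
    have h2 : |(c 0 : ℝ)| * |a 0 * ξ ^ (q : ℕ) - a q| ≤ 1 / 2 * |(a 0 : ℝ)| * zL ξ a := by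
      gcongr
      exact abs_le_zL a q
    have h3 : znorm b * zL ξ a ≤ N * |(b 0 : ℝ)| * zL ξ a := by gcongr
    have h4 : |(b 0 : ℝ)| * zL ξ a ≤ 3 / 2 * |(a 0 : ℝ)| * zL ξ a := by gcongr
    have h5 : |(a 0 : ℝ)| * zL ξ a ≤ |(a 0 : ℝ)| * zL ξ c := by gcongr
    have h6 : |(b 0 : ℝ)| * zL ξ a ≤ 4 * |(mnr a b 0 q : ℝ)| := by nlinarith
    nlinarith

end MinCtx

end

section

lemma exists_bezout {ι : Type*} [Fintype ι] {u : ι → ℤ}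
    (hu : ∀ d : ℤ, (∀ i, d ∣ u i) → IsUnit d) : ∃ r : ι → ℤ, ∑ i, r i * u i = 1 := by
  obtain ⟨d, hd⟩ := (IsPrincipalIdealRing.principal (Ideal.span (Set.range u))).principal
  have h1 : IsUnit d := hu d fun i => by
    have : u i ∈ Ideal.span (Set.range u) := Ideal.subset_span ⟨i, rfl⟩
    rw [hd] at this
    exact Ideal.mem_span_singleton.1 this
  have h2 : (1 : ℤ) ∈ Ideal.span (Set.range u) := by
    rw [hd]
    exact Ideal.mem_span_singleton.2 h1.dvd
  exact Ideal.mem_span_range_iff_exists_fun.1 h2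

/-- An integer vector parallel to a primitive one is at least as large. -/
lemma abs_le_of_parallel {ι : Type*} [Fintype ι] {u v : ι → ℤ}
    (hu : ∀ d : ℤ, (∀ i, d ∣ u i) → IsUnit d) (huv : ∀ i j, u i * v j = u j * v i)
    (hv : ∃ i, v i ≠ 0) (j : ι) : |u j| ≤ |v j| := by
  obtain ⟨r, hr⟩ := exists_bezout hu
  have key : ∀ j, v j = (∑ i, r i * v i) * u j := fun j => by
    rw [Finset.sum_mul]
    calc v j = (∑ i, r i * u i) * v j := by rw [hr, one_mul]
      _ = _ := by
        rw [Finset.sum_mul]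
        exact Finset.sum_congr rfl fun i _ => by linear_combination r i * huv i j
  obtain ⟨i, hi⟩ := hv
  have h0 : (∑ i, r i * v i) ≠ 0 := fun h => hi (by rw [key i, h, zero_mul])
  rw [key j, abs_mul]
  exact le_mul_of_one_le_left (abs_nonneg _) (Int.one_le_abs h0)

/-- The scalar product of integer points. -/
def dot (n a : Fin 4 → ℤ) : ℤ := n 0 * a 0 + n 1 * a 1 + n 2 * a 2 + n 3 * a 3

lemma dot_comb (n a b : Fin 4 → ℤ) (s t : ℤ) : dot n (s • a + t • b) = s * dot n a + t * dot n b := by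
  simp [dot]; ring

/-- The vector of `2 × 2` minors. -/
def pl (a b : Fin 4 → ℤ) : Fin 6 → ℤ :=
  ![mnr a b 0 1, mnr a b 0 2, mnr a b 0 3, mnr a b 1 2, mnr a b 1 3, mnr a b 2 3]

/-- The vector of complementary `2 × 2` minors. -/
def plDual (a b : Fin 4 → ℤ) : Fin 6 → ℤ :=
  ![mnr a b 2 3, -mnr a b 1 3, mnr a b 1 2, mnr a b 0 3, -mnr a b 0 2, mnr a b 0 1]

lemma pl_parallel {m n a b : Fin 4 → ℤ} (hma : dot m a = 0) (hmb : dot m b = 0)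
    (hna : dot n a = 0) (hnb : dot n b = 0) (i j : Fin 6) :
    pl m n i * plDual a b j = pl m n j * plDual a b i := by
  have key : ∀ i l : Fin 4, mnr m n i 0 * mnr a b 0 l + mnr m n i 1 * mnr a b 1 l +
      mnr m n i 2 * mnr a b 2 l + mnr m n i 3 * mnr a b 3 l = 0 := fun i l => by
    simp only [dot, mnr] at *
    linear_combination (m i * b l) * hna - (m i * a l) * hnb - (n i * b l) * hma +
      (n i * a l) * hmb
  have self : ∀ (a b : Fin 4 → ℤ) p, mnr a b p p = 0 := fun a b p => by simp only [mnr]; ring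
  have swap : ∀ (a b : Fin 4 → ℤ) p q, mnr a b p q = -mnr a b q p := fun a b p q => by
    simp only [mnr]; ring
  have k00 := key 0 0
  have k01 := key 0 1
  have k02 := key 0 2
  have k03 := key 0 3
  have k10 := key 1 0
  have k11 := key 1 1
  have k12 := key 1 2
  have k13 := key 1 3
  have k20 := key 2 0
  have k21 := key 2 1
  have k22 := key 2 2
  have k23 := key 2 3
  have k30 := key 3 0
  have k31 := key 3 1
  have k32 := key 3 2
  have k33 := key 3 3
  simp only [self, swap _ _ 1 0, swap _ _ 2 0, swap _ _ 3 0, swap _ _ 2 1,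
    swap _ _ 3 1, swap _ _ 3 2, zero_mul, mul_zero, neg_mul, mul_neg, neg_neg, zero_add,
    add_zero] at k00 k01 k02 k03 k10 k11 k12 k13 k20 k21 k22 k23 k30 k31 k32 k33
  clear key hma hmb hna hnb self swap
  generalize hP01 : mnr m n 0 1 = P01 at *
  generalize hP02 : mnr m n 0 2 = P02 at *
  generalize hP03 : mnr m n 0 3 = P03 at *
  generalize hP12 : mnr m n 1 2 = P12 at *
  generalize hP13 : mnr m n 1 3 = P13 at *
  generalize hP23 : mnr m n 2 3 = P23 at *
  generalize hR01 : mnr a b 0 1 = R01 at *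
  generalize hR02 : mnr a b 0 2 = R02 at *
  generalize hR03 : mnr a b 0 3 = R03 at *
  generalize hR12 : mnr a b 1 2 = R12 at *
  generalize hR13 : mnr a b 1 3 = R13 at *
  generalize hR23 : mnr a b 2 3 = R23 at *
  have e : ∀ A B : Fin 6 → ℤ, A = ![P01, P02, P03, P12, P13, P23] →
      B = ![R23, -R13, R12, R03, -R02, R01] → ∀ i j, A i * B j = A j * B i := by
    rintro A B rfl rfl i j
    fin_cases i <;> fin_cases j <;> simp <;> linarith
  exact e _ _ (by simp only [pl, *]) (by simp only [plDual, *]) i j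

/-- The generalized cross product of three points. -/
def cross3 (a b c : Fin 4 → ℤ) : Fin 4 → ℤ :=
  ![mnr a b 2 3 * c 1 - mnr a b 1 3 * c 2 + mnr a b 1 2 * c 3,
    -(mnr a b 2 3 * c 0 - mnr a b 0 3 * c 2 + mnr a b 0 2 * c 3),
    mnr a b 1 3 * c 0 - mnr a b 0 3 * c 1 + mnr a b 0 1 * c 3,
    -(mnr a b 1 2 * c 0 - mnr a b 0 2 * c 1 + mnr a b 0 1 * c 2)]

lemma dot_cross3 (a b c : Fin 4 → ℤ) :
    dot (cross3 a b c) a = 0 ∧ dot (cross3 a b c) b = 0 ∧ dot (cross3 a b c) c = 0 := by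
  refine ⟨?_, ?_, ?_⟩ <;> simp [dot, cross3, mnr] <;> ring

lemma parallel_cross3 {m a b c : Fin 4 → ℤ} (ha : dot m a = 0) (hb : dot m b = 0)
    (hc : dot m c = 0) (i j : Fin 4) :
    m i * cross3 a b c j = m j * cross3 a b c i := by
  have key : ∀ p q r s : Fin 4, ∀ _ : m p * a p + m q * a q + m r * a r + m s * a s = 0,
      ∀ _ : m p * b p + m q * b q + m r * b r + m s * b s = 0,
      ∀ _ : m p * c p + m q * c q + m r * c r + m s * c s = 0,
      m p * (mnr a b r s * c p - mnr a b p s * c r + mnr a b p r * c s) +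
      m q * (mnr a b r s * c q - mnr a b q s * c r + mnr a b q r * c s) = 0 := by
    intro p q r s h1 h2 h3
    simp only [mnr]
    linear_combination (b r * c s - b s * c r) * h1 - (a r * c s - a s * c r) * h2 +
      (a r * b s - a s * b r) * h3
  simp only [dot] at ha hb hc
  have k01 := key 0 1 2 3 (by linarith) (by linarith) (by linarith)
  have k02 := key 0 2 1 3 (by linarith) (by linarith) (by linarith)
  have k03 := key 0 3 1 2 (by linarith) (by linarith) (by linarith)
  have k12 := key 1 2 0 3 (by linarith) (by linarith) (by linarith)
  have k13 := key 1 3 0 2 (by linarith) (by linarith) (by linarith)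
  have k23 := key 2 3 0 1 (by linarith) (by linarith) (by linarith)
  clear key ha hb hc
  fin_cases i <;> fin_cases j <;> simp [cross3, mnr] at * <;> linarith

end

section

lemma rvec_comb (a b : Fin 4 → ℤ) (s t : ℤ) :
    rvec (s • a + t • b) = (s : ℝ) • rvec a + (t : ℝ) • rvec b := by
  ext j; simp [rvec]

namespace IsMinimalSeq
variable {ξ : ℝ} {x : ℕ → Fin 4 → ℤ}

lemma pair' (h : IsMinimalSeq ξ x) {i : ℕ} (hi : 2 ≤ i) : MinPair ξ (x (i - 1)) (x i) := by
  have := h.pair (i := i - 1) (by omega)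
  rwa [show i - 1 + 1 = i by omega] at this

lemma exists_int (h : IsMinimalSeq ξ x) {i : ℕ} (hi : 2 ≤ i) {z : Fin 4 → ℤ}
    (hz : rvec z ∈ Wspace x i) : ∃ s t : ℤ, z = s • x (i - 1) + t • x i := by
  obtain ⟨s, t, hst⟩ := Submodule.mem_span_pair.1 hz
  refine (h.pair' hi).exists_int (s := s) (t := t) fun j => ?_
  have := congrFun hst j
  simp [rvec] at this
  exact this.symm

lemma Wspace_succ_eq (h : IsMinimalSeq ξ x) {i : ℕ} (hi : 2 ≤ i)
    (hz : rvec (x (i + 1)) ∈ Wspace x i) : Wspace x i = Wspace x (i + 1) := by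
  obtain ⟨s, t, hst⟩ := h.exists_int hi hz
  have hs : s ≠ 0 := by
    rintro rfl
    have := (h.pair (i := i) (by omega)).indep_int (s := t) (t := -1) (by
      rw [hst]; simp)
    omega
  have hsR : (s : ℝ) ≠ 0 := by exact_mod_cast hs
  have hst' := congrArg rvec hst
  rw [rvec_comb] at hst'
  refine le_antisymm (Submodule.span_le.2 ?_) (Submodule.span_le.2 ?_)
  · rintro z (rfl | rfl)
    · refine Submodule.mem_span_pair.2 ⟨-(t / s : ℝ), (s : ℝ)⁻¹, ?_⟩
      simp only [Nat.add_sub_cancel]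
      rw [hst']
      ext j
      simp
      field_simp
      ring
    · exact Submodule.subset_span (by simp)
  · rintro z (rfl | rfl)
    · exact Submodule.subset_span (by simp)
    · exact hz

lemma recurrence (h : IsMinimalSeq ξ x) {i : ℕ} (hi : 2 ≤ i) (hI : i ∉ Iset x) :
    ∃ s t : ℤ, |s| = 1 ∧ x (i + 1) = s • x (i - 1) + t • x i := by
  have hW : Wspace x i = Wspace x (i + 1) := by
    by_contra hne
    exact hI ⟨hi, hne⟩
  obtain ⟨s, t, hst⟩ := h.exists_int hi (z := x (i + 1)) (by
    rw [hW]; exact Submodule.subset_span (by simp))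
  obtain ⟨s', t', hst'⟩ := h.exists_int (i := i + 1) (by omega) (z := x (i - 1)) (by
    rw [← hW]; exact Submodule.subset_span (by simp))
  refine ⟨s, t, ?_, hst⟩
  simp only [Nat.add_sub_cancel] at hst'
  have := (h.pair' hi).indep_int (s := 1 - t' * s) (t := -s' - t' * t) (by
    have h2 : x (i - 1) = s' • x i + t' • (s • x (i - 1) + t • x i) := by rw [← hst]; exact hst'
    ext j
    have := congrFun h2 j
    simp at this ⊢
    linarith)
  have h1 : s * t' = 1 := by linarith [this.1]
  exact Int.isUnit_iff_abs_eq.1 (IsUnit.of_mul_eq_one _ h1)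

/-- Between two elements of `Iset` the pairs of consecutive points differ by a unimodular matrix. -/
lemma unimodular (h : IsMinimalSeq ξ x) {i j : ℕ} (hi : 1 ≤ i) (hij : i < j)
    (hgap : ∀ m, i < m → m < j → m ∉ Iset x) :
    ∃ α β γ δ : ℤ, |α * δ - β * γ| = 1 ∧ x (j - 1) = α • x i + β • x (i + 1) ∧
      x j = γ • x i + δ • x (i + 1) := by
  induction j, hij using Nat.le_induction with
  | base => exact ⟨1, 0, 0, 1, by simp, by simp, by simp⟩
  | succ j hj ih =>
    obtain ⟨α, β, γ, δ, hdet, h1, h2⟩ := ih fun m hm hm' => hgap m hm (by omega)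
    obtain ⟨s, t, hs, hst⟩ := h.recurrence (i := j) (by omega) (hgap j (by omega) (by omega))
    refine ⟨γ, δ, s * α + t * γ, s * β + t * δ, ?_, by simpa using h2, ?_⟩
    · rw [show γ * (s * β + t * δ) - δ * (s * α + t * γ) = -(s * (α * δ - β * γ)) by ring, abs_neg,
        abs_mul, hs, hdet, one_mul]
    · rw [hst, h1, h2]
      ext k
      simp
      ring

end IsMinimalSeq

lemma MinCtx.exists_mnr_ne {ξ N : ℝ} {x : ℕ → Fin 4 → ℤ} {n₀ : ℕ} (H : MinCtx ξ x N n₀) {i : ℕ}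
    (hi : n₀ ≤ i) : ∃ q, mnr (x i) (x (i + 1)) 0 q ≠ 0 := by
  obtain ⟨q, hq⟩ := H.exists_le_mnr hi
  refine ⟨q, fun h0 => ?_⟩
  rw [h0] at hq
  have h1 := H.L_pos i hi
  have h2 := (znorm_nonneg _).trans_lt (H.pair hi).X_lt
  simp at hq
  nlinarith [mul_pos h2 h1]

lemma MinCtx.cross3_ne {ξ N : ℝ} {x : ℕ → Fin 4 → ℤ} {n₀ : ℕ} (H : MinCtx ξ x N n₀) {i : ℕ}
    (hi : n₀ + 1 ≤ i) (hI : i ∈ Iset x) : cross3 (x (i - 1)) (x i) (x (i + 1)) ≠ 0 := by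
  intro h0
  obtain ⟨q, hq⟩ := H.exists_mnr_ne (i := i - 1) (by omega)
  rw [show i - 1 + 1 = i by omega] at hq
  refine hI.2 (H.hmin.Wspace_succ_eq hI.1 ?_)
  set a := x (i - 1)
  set b := x i
  set c := x (i + 1)
  have key : ∀ r, mnr a b 0 q * c r = mnr a b 0 r * c q - mnr a b q r * c 0 := by
    have e0 := congrFun h0 0
    have e1 := congrFun h0 1
    have e2 := congrFun h0 2
    have e3 := congrFun h0 3
    simp [cross3, mnr] at e0 e1 e2 e3
    intro r
    clear hq
    fin_cases q <;> fin_cases r <;> simp [mnr] <;> linarith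
  have hqR : (mnr a b 0 q : ℝ) ≠ 0 := by exact_mod_cast hq
  refine Submodule.mem_span_pair.2 ⟨(b q * c 0 - b 0 * c q : ℝ) / mnr a b 0 q,
    (a 0 * c q - a q * c 0 : ℝ) / mnr a b 0 q, ?_⟩
  ext r
  have hr : (mnr a b 0 q : ℝ) * c r = mnr a b 0 r * c q - mnr a b q r * c 0 := by
    exact_mod_cast key r
  simp [rvec]
  field_simp
  rw [hr]
  simp only [mnr, a, b]
  push_cast
  ring

end

section

lemma exists_normal (a b c : Fin 4 → ℤ) :
    ∃ n : Fin 4 → ℤ, n ≠ 0 ∧ dot n a = 0 ∧ dot n b = 0 ∧ dot n c = 0 := by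
  obtain ⟨t, ht, h, -⟩ := Int.Matrix.exists_ne_zero_int_vec_norm_le
    (Matrix.of ![a, b, c]) (by simp) (by simp)
  refine ⟨t, ht, ?_, ?_, ?_⟩
  · have := congrFun h 0
    simp [Matrix.mulVec, dotProduct, Fin.sum_univ_four] at this
    simp only [dot]; linarith
  · have := congrFun h 1
    simp [Matrix.mulVec, dotProduct, Fin.sum_univ_four] at this
    simp only [dot]; linarith
  · have := congrFun h 2
    simp [Matrix.mulVec, dotProduct, Fin.sum_univ_four] at this
    simp only [dot]; linarith

/-- The real hyperplane orthogonal to an integer point. -/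
def perpSpace (n : Fin 4 → ℤ) : Submodule ℝ (Fin 4 → ℝ) where
  carrier := {z | n 0 * z 0 + n 1 * z 1 + n 2 * z 2 + n 3 * z 3 = 0}
  add_mem' := by
    intro a b ha hb
    simp at ha hb ⊢
    linarith
  zero_mem' := by simp
  smul_mem' := by
    intro c a ha
    simp at ha ⊢
    linear_combination c * ha

lemma rvec_mem_perpSpace {n a : Fin 4 → ℤ} : rvec a ∈ perpSpace n ↔ dot n a = 0 := by
  change (n 0 : ℝ) * a 0 + n 1 * a 1 + n 2 * a 2 + n 3 * a 3 = 0 ↔ _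
  rw [dot]
  exact_mod_cast Iff.rfl

lemma Uspace_le_perpSpace {x : ℕ → Fin 4 → ℤ} {n : Fin 4 → ℤ} {i : ℕ} :
    Uspace x i ≤ perpSpace n ↔ dot n (x (i - 1)) = 0 ∧ dot n (x i) = 0 ∧ dot n (x (i + 1)) = 0 := by
  simp only [Uspace, Wspace, sup_le_iff, Submodule.span_le, Set.insert_subset_iff,
    Set.singleton_subset_iff, SetLike.mem_coe, rvec_mem_perpSpace, Nat.add_sub_cancel]
  tauto

/-- The least norm of a nonzero integer point orthogonal to a subspace. -/
def normalHeight (U : Submodule ℝ (Fin 4 → ℝ)) : ℕ :=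
  sInf {m : ℕ | ∃ n : Fin 4 → ℤ, n ≠ 0 ∧ U ≤ perpSpace n ∧ znorm n = m}

lemma normalHeight_le {U : Submodule ℝ (Fin 4 → ℝ)} {n : Fin 4 → ℤ} (h0 : n ≠ 0)
    (hn : U ≤ perpSpace n) : (normalHeight U : ℝ) ≤ znorm n := by
  obtain ⟨m, hm⟩ := exists_znorm_eq_nat n
  rw [hm]
  have : normalHeight U ≤ m := Nat.sInf_le ⟨n, h0, hn, hm⟩
  exact_mod_cast this

lemma exists_normalHeight (x : ℕ → Fin 4 → ℤ) (i : ℕ) : ∃ n : Fin 4 → ℤ, n ≠ 0 ∧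
    Uspace x i ≤ perpSpace n ∧ znorm n = normalHeight (Uspace x i) := by
  obtain ⟨n, h0, h1, h2, h3⟩ := exists_normal (x (i - 1)) (x i) (x (i + 1))
  obtain ⟨m, hm⟩ := exists_znorm_eq_nat n
  exact Nat.sInf_mem (s := {m : ℕ | ∃ n : Fin 4 → ℤ, n ≠ 0 ∧ Uspace x i ≤ perpSpace n ∧
    znorm n = m}) ⟨m, n, h0, Uspace_le_perpSpace.2 ⟨h1, h2, h3⟩, hm⟩

lemma perpSpace_eq_of_parallel {n m : Fin 4 → ℤ} (hn : n ≠ 0) (h : ∀ p q, mnr n m p q = 0)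
    (hm : m ≠ 0) : perpSpace n = perpSpace m := by
  have key : ∀ n m : Fin 4 → ℤ, n ≠ 0 → (∀ p q, mnr n m p q = 0) → perpSpace n ≤ perpSpace m := by
    intro n m hn h z hz
    obtain ⟨p, hp⟩ := Function.ne_iff.1 hn
    have hpR : (n p : ℝ) ≠ 0 := by exact_mod_cast hp
    have hq : ∀ q, (n p : ℝ) * m q = n q * m p := fun q => by
      have := h p q
      rw [mnr, sub_eq_zero] at this
      exact_mod_cast this
    change (n 0 : ℝ) * z 0 + n 1 * z 1 + n 2 * z 2 + n 3 * z 3 = 0 at hz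
    change (m 0 : ℝ) * z 0 + m 1 * z 1 + m 2 * z 2 + m 3 * z 3 = 0
    refine (mul_eq_zero_iff_left hpR).1 ?_
    linear_combination z 0 * hq 0 + z 1 * hq 1 + z 2 * hq 2 + z 3 * hq 3 + m p * hz
  refine le_antisymm (key n m hn h) (key m n hm fun p q => ?_)
  have := h p q
  simp only [mnr] at this ⊢
  linarith

lemma IsMinimalSeq.Uspace_eq_perpSpace {ξ : ℝ} {x : ℕ → Fin 4 → ℤ} (h : IsMinimalSeq ξ x) {i : ℕ}
    (hi : i ∈ Iset x) {n : Fin 4 → ℤ} (hn : n ≠ 0) (hU : Uspace x i ≤ perpSpace n) :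
    Uspace x i = perpSpace n := by
  have hp := h.pair' hi.1
  have h1 : (⊥ : Submodule ℝ (Fin 4 → ℝ)) < Submodule.span ℝ {rvec (x (i - 1))} := by
    rw [bot_lt_iff_ne_bot, Ne, Submodule.span_singleton_eq_bot]
    intro h0
    refine h.1 (i - 1) (by have := hi.1; omega) (funext fun j => ?_)
    have := congrFun h0 j
    simp [rvec] at this
    exact this
  have h2 : Submodule.span ℝ {rvec (x (i - 1))} < Wspace x i := by
    refine lt_of_le_of_ne (Submodule.span_mono (by simp)) fun he => ?_
    have : rvec (x i) ∈ Submodule.span ℝ {rvec (x (i - 1))} := by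
      rw [he]; exact Submodule.subset_span (by simp)
    obtain ⟨c, hc⟩ := Submodule.mem_span_singleton.1 this
    have := hp.indep (s := c) (t := -1) fun j => by
      have := congrFun hc j
      simp [rvec] at this
      linarith
    norm_num at this
  have h3 : Wspace x i < Uspace x i := by
    refine lt_of_le_of_ne le_sup_left fun he => hi.2 (h.Wspace_succ_eq hi.1 ?_)
    rw [he]
    exact (le_sup_right : Wspace x (i + 1) ≤ _) (Submodule.subset_span (by simp))
  have h4 : perpSpace n < ⊤ := by
    rw [lt_top_iff_ne_top]
    intro ht
    refine hn (funext fun j => ?_)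
    have hm : rvec (Pi.single j 1) ∈ perpSpace n := by rw [ht]; trivial
    rw [rvec_mem_perpSpace] at hm
    fin_cases j <;> simpa [dot, Pi.single_apply] using hm
  have k1 := Submodule.finrank_lt_finrank_of_lt h1
  have k2 := Submodule.finrank_lt_finrank_of_lt h2
  have k3 := Submodule.finrank_lt_finrank_of_lt h3
  have k4 := Submodule.finrank_lt_finrank_of_lt h4
  rw [finrank_top, Module.finrank_fin_fun] at k4
  exact Submodule.eq_of_le_of_finrank_le hU (by omega)

section infinite
variable {ξ N : ℝ} {x : ℕ → Fin 4 → ℤ} {n₀ : ℕ}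

lemma MinCtx.eq_zero_of_dot (H : MinCtx ξ x N n₀) {n : Fin 4 → ℤ}
    (h : ∀ M, ∃ i, M ≤ i ∧ dot n (x i) = 0) : n = 0 := by
  refine H.hlin n ?_
  set τ := (n 0 : ℝ) + n 1 * ξ + n 2 * ξ ^ 2 + n 3 * ξ ^ 3 with hτ
  by_contra hne
  have hpos : 0 < |τ| := abs_pos.2 hne
  obtain ⟨M, hM⟩ := Filter.eventually_atTop.1
    (H.hmin.tendsto_X.eventually_gt_atTop (N * (3 * znorm n / |τ|)))
  obtain ⟨i, hi, hd⟩ := h (max M n₀)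
  have h1 := hM i (by omega)
  have h2 := H.X_le i (by omega)
  have h3 : 3 * znorm n / |τ| < |(x i 0 : ℝ)| :=
    lt_of_mul_lt_mul_left (h1.trans_le h2) (by linarith [H.one_le])
  rw [div_lt_iff₀ hpos, ← abs_mul] at h3
  have hdR : (n 0 : ℝ) * x i 0 + n 1 * x i 1 + n 2 * x i 2 + n 3 * x i 3 = 0 := by
    rw [dot] at hd
    exact_mod_cast hd
  have e : (x i 0 : ℝ) * τ = n 1 * (x i 0 * ξ ^ ((1 : Fin 4) : ℕ) - x i 1) +
      n 2 * (x i 0 * ξ ^ ((2 : Fin 4) : ℕ) - x i 2) +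
      n 3 * (x i 0 * ξ ^ ((3 : Fin 4) : ℕ) - x i 3) := by
    rw [hτ, Fin.val_one, Fin.val_two, show ((3 : Fin 4) : ℕ) = 3 from rfl]
    linear_combination hdR
  have hL := H.L_le_one i (by omega)
  have hd' : ∀ j : Fin 4, |(x i 0 : ℝ) * ξ ^ (j : ℕ) - x i j| ≤ 1 := fun j => (abs_le_zL _ _).trans hL
  rw [e] at h3
  have := abs_add_le' (abs_add_le' (abs_mul_le' (abs_le_znorm n 1) (hd' 1))
    (abs_mul_le' (abs_le_znorm n 2) (hd' 2))) (abs_mul_le' (abs_le_znorm n 3) (hd' 3))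
  linarith

lemma MinCtx.Iset_infinite (H : MinCtx ξ x N n₀) : (Iset x).Infinite := by
  intro hfin
  obtain ⟨m, hm⟩ := hfin.bddAbove
  set i := max (m + 1) n₀ with hi
  have h2 := H.two_le
  obtain ⟨n, hn, h0, h1, -⟩ := exists_normal (x i) (x (i + 1)) 0
  refine hn (H.eq_zero_of_dot fun M => ⟨max M (i + 1), by omega, ?_⟩)
  obtain ⟨-, -, γ, δ, -, -, h⟩ := H.hmin.unimodular (i := i) (j := max M (i + 1)) (by omega) (by omega)
    fun k hk _ hkI => by
      have := hm hkI
      omega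
  rw [h, dot_comb, h0, h1]
  simp

/-- `s` enumerates consecutive elements of `Iset x` beyond `n₀`. -/
structure IsEnum (x : ℕ → Fin 4 → ℤ) (n₀ : ℕ) (s : ℕ → ℕ) : Prop where
  mem : ∀ k, s k ∈ Iset x
  mono : StrictMono s
  gap : ∀ k m, s k < m → m < s (k + 1) → m ∉ Iset x
  ge : ∀ k, n₀ + 1 ≤ s k

lemma MinCtx.J_infinite (H : MinCtx ξ x N n₀) {s : ℕ → ℕ} (hs : IsEnum x n₀ s) (k : ℕ) :
    ∃ m, k ≤ m ∧ Uspace x (s m) ≠ Uspace x (s (m + 1)) := by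
  by_contra! hcon
  have hU : ∀ m, k ≤ m → Uspace x (s m) = Uspace x (s k) := fun m hm => by
    induction m, hm using Nat.le_induction with
    | base => rfl
    | succ m hm ih => rw [← hcon m hm, ih]
  obtain ⟨n, hn, hnU, -⟩ := exists_normalHeight x (s k)
  refine hn (H.eq_zero_of_dot fun M => ⟨s (max M k), ?_, ?_⟩)
  · exact (le_max_left _ _).trans hs.mono.le_apply
  · rw [← hU (max M k) (by omega)] at hnU
    exact (Uspace_le_perpSpace.1 hnU).2.1

end infinite

end

section

lemma eq_twisted_cubic {b : Fin 4 → ℤ} (h1 : q1 b = 0) (h2 : q2 b = 0)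
    (hb : b 0 ≠ 0) : ∃ m p q : ℤ, b = m • ![q ^ 3, q ^ 2 * p, q * p ^ 2, p ^ 3] := by
  obtain ⟨g, p, q, hg, hpq, hq, hp⟩ : ∃ g p q : ℤ, g ≠ 0 ∧ IsCoprime q p ∧ b 0 = g * q ∧ b 1 = g * p := by
    have hg : 0 < Int.gcd (b 0) (b 1) := Int.gcd_pos_of_ne_zero_left _ hb
    obtain ⟨q, p, hc, hq, hp⟩ := Int.exists_gcd_one hg
    exact ⟨Int.gcd (b 0) (b 1), p, q, by exact_mod_cast hg.ne', Int.isCoprime_iff_gcd_eq_one.2 hc,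
      by rw [mul_comm]; exact hq, by rw [mul_comm]; exact hp⟩
  have hq0 : q ≠ 0 := by rintro rfl; exact hb (by simp [hq])
  simp only [q1, q2] at h1 h2
  rw [hq, hp] at h2
  have e1 : q * b 2 = g * p ^ 2 := mul_left_cancel₀ hg (by linear_combination h2)
  obtain ⟨g', rfl⟩ : q ∣ g := (hpq.pow_right (n := 2)).dvd_of_dvd_mul_right ⟨b 2, e1.symm⟩
  have hg' : g' ≠ 0 := right_ne_zero_of_mul hg
  have e2 : b 2 = g' * p ^ 2 := mul_left_cancel₀ hq0 (by linear_combination e1)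
  rw [hq, hp, e2] at h1
  have e3 : q * b 3 = g' * p ^ 3 :=
    mul_left_cancel₀ (mul_ne_zero hq0 hg') (by linear_combination -h1)
  obtain ⟨m, rfl⟩ : q ∣ g' := (hpq.pow_right (n := 3)).dvd_of_dvd_mul_right ⟨b 3, e3.symm⟩
  have e4 : b 3 = m * p ^ 3 := mul_left_cancel₀ hq0 (by linear_combination e3)
  refine ⟨m, p, q, funext fun j => ?_⟩
  fin_cases j
  · simp [hq]; ring
  · simp [hp]; ring
  · simp [e2]; ring
  · simp [e4]

namespace MinCtx
variable {ξ N : ℝ} {x : ℕ → Fin 4 → ℤ} {n₀ : ℕ}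

lemma X_pos (H : MinCtx ξ x N n₀) {i : ℕ} (hi : n₀ ≤ i) : 0 < znorm (x i) := by
  have := H.X_large i hi
  linarith [H.one_le]

lemma x0_ne (H : MinCtx ξ x N n₀) {i : ℕ} (hi : n₀ ≤ i) : x i 0 ≠ 0 := by
  intro h0
  have h1 := H.X_le i hi
  have h2 := H.X_pos hi
  rw [h0] at h1
  simp at h1
  linarith

lemma log_x0 (H : MinCtx ξ x N n₀) {i : ℕ} (hi : n₀ ≤ i) :
    Real.log (znorm (x i)) - Real.log N ≤ Real.log |(x i 0 : ℝ)| ∧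
    Real.log |(x i 0 : ℝ)| ≤ Real.log (znorm (x i)) := by
  have h0 : 0 < |(x i 0 : ℝ)| := by have := H.x0_ne hi; positivity
  have hN : 0 < N := by linarith [H.one_le]
  refine ⟨?_, Real.log_le_log h0 (abs_le_znorm _ _)⟩
  have := Real.log_le_log (H.X_pos hi) (H.X_le i hi)
  rw [Real.log_mul hN.ne' h0.ne'] at this
  linarith

lemma tendsto_log_X (H : MinCtx ξ x N n₀) :
    Filter.Tendsto (fun i => Real.log (znorm (x i))) Filter.atTop Filter.atTop :=
  Real.tendsto_log_atTop.comp H.hmin.tendsto_X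

lemma exists_q_ne (H : MinCtx ξ x N n₀) :
    ∃ n₁, n₀ ≤ n₁ ∧ ∀ i, n₁ ≤ i → ¬ (q0 (x i) = 0 ∧ q1 (x i) = 0 ∧ q2 (x i) = 0) := by
  obtain ⟨M, hM⟩ := Filter.eventually_atTop.1
    (H.tendsto_log_X.eventually_ge_atTop (20 * (Real.log N + 1)))
  refine ⟨max (n₀ + 1) M, by omega, fun i hi => ?_⟩
  rintro ⟨-, h1, h2⟩
  have ht := hM i (by omega)
  have hia : n₀ ≤ i - 1 := by omega
  have hib : n₀ ≤ i := by omega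
  have hp := H.hmin.pair' (i := i) (by have := H.two_le; omega)
  have hb0 := H.x0_ne hib
  have hXb := H.log_x0 hib
  have hN := H.one_le
  have hlN : 0 ≤ Real.log N := Real.log_nonneg hN
  have hLa := H.L_le (i - 1) hia
  rw [show i - 1 + 1 = i by omega] at hLa
  have hLb := H.L_le i hib
  have hXX := Real.log_le_log (H.X_pos hib) (H.X_lt hib (Nat.lt_succ_self i)).le
  have hLa0 := H.L_pos (i - 1) hia
  have hLb0 := H.L_pos i hib
  have hbda := H.bd (i - 1) hia
  have hXa0 := H.X_pos hia
  have hXb0 := H.X_pos hib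
  set a := x (i - 1)
  set b := x i
  obtain ⟨m, p, q, hm⟩ := eq_twisted_cubic h1 h2 hb0
  have hmu : |m| = 1 := Int.isUnit_iff_abs_eq.1 (hp.primitive hm)
  have hmuR : |(m : ℝ)| = 1 := by exact_mod_cast hmu
  have e0 : b 0 = m * q ^ 3 := by rw [hm]; simp
  have e1 : b 1 = m * (q ^ 2 * p) := by rw [hm]; simp
  have e2 : b 2 = m * (q * p ^ 2) := by rw [hm]; simp
  have e3 : b 3 = m * p ^ 3 := by rw [hm]; simp
  have hq : q ≠ 0 := by rintro rfl; exact hb0 (by simp [e0])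
  have hqR : (q : ℝ) ≠ 0 := by exact_mod_cast hq
  have hq0 : 0 < |(q : ℝ)| := abs_pos.2 hqR
  have hlog : Real.log |(b 0 : ℝ)| = 3 * Real.log |(q : ℝ)| := by
    rw [e0]; push_cast
    rw [abs_mul, hmuR, one_mul, abs_pow, Real.log_pow]; norm_num
  rw [hlog] at hXb
  have hlog2 : Real.log 2 < 1 := by have := Real.log_two_lt_d9; linarith
  have hdel : |(q : ℝ) * ξ - p| ≤ zL ξ b / |(q : ℝ)| ^ 2 := by
    rw [le_div_iff₀ (by positivity), ← abs_pow, ← abs_mul]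
    have := abs_le_zL (ξ := ξ) b 1
    rw [e0, e1] at this
    push_cast at this
    rw [Fin.val_one, show (m : ℝ) * q ^ 3 * ξ ^ 1 - m * (q ^ 2 * p) = m * ((q * ξ - p) * q ^ 2) by ring,
      abs_mul, hmuR, one_mul] at this
    exact this
  have s1 : |(q : ℝ)| * (N * zL ξ a) < 1 / 2 := by
    rw [← Real.log_lt_log_iff (by positivity) (by norm_num), Real.log_mul hq0.ne' (by positivity),
      Real.log_mul (by positivity) hLa0.ne', Real.log_div (by norm_num) (by norm_num), Real.log_one]
    linarith
  have s2 : (zL ξ b / |(q : ℝ)| ^ 2) * znorm a < 1 / 2 := by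
    refine (mul_le_mul_of_nonneg_left hp.X_lt.le (by positivity)).trans_lt ?_
    rw [← Real.log_lt_log_iff (by positivity) (by norm_num), Real.log_mul (by positivity) (by positivity),
      Real.log_div hLb0.ne' (by positivity), Real.log_pow,
      Real.log_div (by norm_num) (by norm_num), Real.log_one]
    push_cast
    linarith
  have key : ∀ u v : ℤ, |(u : ℝ)| ≤ znorm a → |(v : ℝ) - ξ * u| ≤ N * zL ξ a → q * v = p * u := by
    intro u v hu hv
    have h3 : |((q * v - p * u : ℤ) : ℝ)| < 1 := by
      push_cast
      rw [show (q : ℝ) * v - p * u = q * (v - ξ * u) + (q * ξ - p) * u by ring]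
      have := abs_add_le' (abs_mul_le' (le_refl |(q : ℝ)|) hv) (abs_mul_le' hdel hu)
      linarith
    have h4 : |q * v - p * u| < 1 := by exact_mod_cast h3
    linarith [Int.abs_lt_one_iff.1 h4]
  have k1 := key _ _ hbda.c0 hbda.d1
  have k2 := key _ _ hbda.c1 hbda.d2
  have k3 := key _ _ hbda.c2 hbda.d3
  refine hb0 (hp.indep_int (s := b 0) (t := -a 0) (funext fun j => ?_)).1
  fin_cases j
  · simp; ring
  · simp [e0, e1]; linear_combination m * q ^ 2 * k1
  · simp [e0, e2]; linear_combination m * q ^ 2 * k2 + m * q * p * k1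
  · simp [e0, e3]; linear_combination m * q ^ 2 * k3 + m * q * p * k2 + m * p ^ 2 * k1

end MinCtx

end

section

/-- The form `z ↦ A · z⁻`. -/
def fm (A : Fin 3 → ℤ) : Fin 4 → ℤ := ![A 0, A 1, A 2, 0]
/-- The form `z ↦ A · z⁺`. -/
def fp (A : Fin 3 → ℤ) : Fin 4 → ℤ := ![0, A 0, A 1, A 2]
/-- The cross product of `a⁻` and `a⁺`. -/
def qv (a : Fin 4 → ℤ) : Fin 3 → ℤ := ![q0 a, q1 a, q2 a]

lemma dot_fm (A : Fin 3 → ℤ) (b : Fin 4 → ℤ) : dot (fm A) b = A 0 * b 0 + A 1 * b 1 + A 2 * b 2 := by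
  simp [dot, fm]

lemma dot_fp (A : Fin 3 → ℤ) (b : Fin 4 → ℤ) : dot (fp A) b = A 0 * b 1 + A 1 * b 2 + A 2 * b 3 := by
  simp [dot, fp]

lemma cf_eq (a b : Fin 4 → ℤ) : cf a b = dot (fm (qv a)) b := by simp [cf, dot_fm, qv]
lemma cg_eq (a b : Fin 4 → ℤ) : cg a b = dot (fp (qv a)) b := by simp [cg, dot_fp, qv]
lemma cf_self (a : Fin 4 → ℤ) : cf a a = 0 := by simp only [cf, q0, q1, q2]; ring
lemma cg_self (a : Fin 4 → ℤ) : cg a a = 0 := by simp only [cg, q0, q1, q2]; ring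

/-- The triple `A` annihilates the point `b`. -/
def Kills (A : Fin 3 → ℤ) (b : Fin 4 → ℤ) : Prop := dot (fm A) b = 0 ∧ dot (fp A) b = 0

lemma Kills.comb {A : Fin 3 → ℤ} {a b : Fin 4 → ℤ} (ha : Kills A a) (hb : Kills A b) (s t : ℤ) :
    Kills A (s • a + t • b) := by
  constructor <;> rw [dot_comb]
  · rw [ha.1, hb.1]; simp
  · rw [ha.2, hb.2]; simp

lemma kills_qv (a : Fin 4 → ℤ) : Kills (qv a) a := ⟨by rw [← cf_eq, cf_self], by rw [← cg_eq, cg_self]⟩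

lemma eq_zero_of_kills {A : Fin 3 → ℤ} {a b c : Fin 4 → ℤ} (hc : cross3 a b c ≠ 0)
    (h1 : Kills A a) (h2 : Kills A b) (h3 : Kills A c) : A = 0 := by
  obtain ⟨j, hj⟩ := Function.ne_iff.1 hc
  have hm : ∀ i k, mnr (fm A) (fp A) i k = 0 := fun i k => by
    have e1 := parallel_cross3 h1.1 h2.1 h3.1
    have e2 := parallel_cross3 h1.2 h2.2 h3.2
    refine (mul_eq_zero_iff_left (mul_ne_zero hj hj)).1 ?_
    simp only [mnr, Pi.zero_apply] at *
    linear_combination (fp A k * cross3 a b c j) * e1 i j + (fm A j * cross3 a b c i) * e2 k j -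
      (fp A i * cross3 a b c j) * e1 k j - (fm A j * cross3 a b c k) * e2 i j
  have k0 := hm 0 1
  have k1 := hm 1 2
  have k2 := hm 2 3
  simp [mnr, fm, fp] at k0 k1 k2
  have : A 1 = 0 := by simpa [k0] using k1
  ext i
  fin_cases i <;> simp [*]

lemma parallel_qv {A : Fin 3 → ℤ} {a : Fin 4 → ℤ} (h : Kills A a) (i j : Fin 3) :
    A i * qv a j = A j * qv a i := by
  obtain ⟨h1, h2⟩ := h
  rw [dot_fm] at h1
  rw [dot_fp] at h2
  have e01 : A 0 * q1 a = A 1 * q0 a := by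
    simp only [q0, q1]; linear_combination -(a 3 * h1) + a 2 * h2
  have e02 : A 0 * q2 a = A 2 * q0 a := by
    simp only [q0, q2]; linear_combination a 2 * h1 - a 1 * h2
  have e12 : A 1 * q2 a = A 2 * q1 a := by
    simp only [q1, q2]; linear_combination -(a 1 * h1) + a 0 * h2
  fin_cases i <;> fin_cases j <;> simp [qv] <;> linarith

lemma Kills.of_parallel {A B : Fin 3 → ℤ} {b : Fin 4 → ℤ} (h : Kills A b) (hA : A ≠ 0)
    (hAB : ∀ i j, A i * B j = A j * B i) : Kills B b := by
  obtain ⟨i, hi⟩ := Function.ne_iff.1 hA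
  obtain ⟨h1, h2⟩ := h
  rw [dot_fm] at h1
  rw [dot_fp] at h2
  constructor
  · rw [dot_fm]
    refine (mul_eq_zero_iff_left hi).1 ?_
    linear_combination b 0 * hAB i 0 + b 1 * hAB i 1 + b 2 * hAB i 2 + B i * h1
  · rw [dot_fp]
    refine (mul_eq_zero_iff_left hi).1 ?_
    linear_combination b 1 * hAB i 0 + b 2 * hAB i 1 + b 3 * hAB i 2 + B i * h2

lemma exists_primitive {A : Fin 3 → ℤ} (hA : A ≠ 0) : ∃ B : Fin 3 → ℤ, B ≠ 0 ∧
    (∀ d : ℤ, (∀ i, d ∣ B i) → IsUnit d) ∧ ∀ i j, A i * B j = A j * B i := by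
  obtain ⟨B, h1, h2⟩ := Finset.extract_gcd A (Finset.univ_nonempty (α := Fin 3))
  refine ⟨B, ?_, fun d hd => ?_, fun i j => ?_⟩
  · rintro rfl
    exact hA (funext fun i => by simpa using h1 i (Finset.mem_univ _))
  · exact isUnit_of_dvd_one (h2 ▸ Finset.dvd_gcd fun i _ => hd i)
  · rw [h1 i (Finset.mem_univ _), h1 j (Finset.mem_univ _)]; ring

lemma pl_primitive {A : Fin 3 → ℤ} (hA : ∀ d : ℤ, (∀ i, d ∣ A i) → IsUnit d) (d : ℤ)
    (hd : ∀ i, d ∣ pl (fm A) (fp A) i) : IsUnit d := by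
  by_contra hu
  obtain ⟨p, hp, hpd⟩ := Int.exists_prime_and_dvd (n := d) fun h => hu (Int.isUnit_iff_natAbs_eq.2 h)
  have h0 := hpd.trans (hd 0)
  have h3 := hpd.trans (hd 3)
  have h5 := hpd.trans (hd 5)
  simp [pl, mnr, fm, fp] at h0 h3 h5
  have k0 : p ∣ A 0 := (hp.dvd_or_dvd h0).elim id id
  have k2 : p ∣ A 2 := (hp.dvd_or_dvd h5).elim id id
  have k1 : p ∣ A 1 := by
    have : p ∣ A 1 * A 1 := (dvd_sub_left (k2.mul_right _)).1 h3
    exact (hp.dvd_or_dvd this).elim id id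
  exact hp.not_isUnit (hA p fun i => by fin_cases i <;> assumption)

end

section

namespace MinCtx
variable {ξ N : ℝ} {x : ℕ → Fin 4 → ℤ} {n₀ : ℕ}

lemma mono (H : MinCtx ξ x N n₀) {n₁ : ℕ} (h : n₀ ≤ n₁) : MinCtx ξ x N n₁ where
  hmin := H.hmin
  hlin := H.hlin
  one_le := H.one_le
  hξ := H.hξ
  pow_le := H.pow_le
  two_le := H.two_le.trans h
  bd i hi := H.bd i (h.trans hi)
  X_le i hi := H.X_le i (h.trans hi)
  X_large i hi := H.X_large i (h.trans hi)
  L_le i hi := H.L_le i (h.trans hi)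
  L_le_one i hi := H.L_le_one i (h.trans hi)
  L_pos i hi := H.L_pos i (h.trans hi)

lemma cf_le (H : MinCtx ξ x N n₀) {i j : ℕ} (hi : n₀ ≤ i) (hj : n₀ ≤ j) :
    |(cf (x i) (x j) : ℝ)| ≤ 6 * N ^ 4 * (znorm (x i) * zL ξ (x i) * zL ξ (x j) +
      znorm (x j) * zL ξ (x i) * zL ξ (x i)) := by
  have h1 := (H.bd i hi).cf_sub_le H.one_le H.hξ (H.bd j hj)
  have h2 := abs_mul_le' (abs_le_znorm (x j) 0) ((H.bd i hi).qval_le H.one_le H.hξ)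
  have h3 := abs_add_le' h1 h2
  rw [sub_add_cancel] at h3
  refine h3.trans (le_of_eq ?_)
  ring

lemma cdel_le (H : MinCtx ξ x N n₀) {i j : ℕ} (hi : n₀ ≤ i) (hj : n₀ ≤ j) :
    |cdel ξ (x i) (x j)| ≤ 6 * N ^ 2 * (znorm (x i) * zL ξ (x i) * zL ξ (x j)) :=
  ((H.bd i hi).cdel_le (H.bd j hj)).trans (le_of_eq (by ring))

/-- A nonzero vector `C(x i, x (i - 1))` forces a lower bound on the product of the errors. -/
lemma one_le_of_C_ne (H : MinCtx ξ x N n₀) {i : ℕ} (hi : n₀ + 1 ≤ i)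
    (hC : ¬ (cf (x i) (x (i - 1)) = 0 ∧ cg (x i) (x (i - 1)) = 0)) :
    1 ≤ 18 * N ^ 5 * (znorm (x i) * zL ξ (x i) * zL ξ (x (i - 1))) := by
  have hN := H.one_le
  have hcf := H.cf_le (i := i) (j := i - 1) (by omega) (by omega)
  have hcd := H.cdel_le (i := i) (j := i - 1) (by omega) (by omega)
  have hX := (H.X_lt (i := i - 1) (j := i) (by omega) (by omega)).le
  have hL := (H.L_lt (i := i - 1) (j := i) (by omega) (by omega)).le
  have hL0 := zL_nonneg (ξ := ξ) (x i)
  have hX0 := znorm_nonneg (x i)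
  have hL1 := zL_nonneg (ξ := ξ) (x (i - 1))
  have hle : znorm (x (i - 1)) * zL ξ (x i) * zL ξ (x i) ≤
      znorm (x i) * zL ξ (x i) * zL ξ (x (i - 1)) := by gcongr
  set T := znorm (x i) * zL ξ (x i) * zL ξ (x (i - 1))
  have hT : 0 ≤ T := by positivity
  have hcf' : |(cf (x i) (x (i - 1)) : ℝ)| ≤ 12 * N ^ 4 * T := by
    refine hcf.trans ?_
    have : 6 * N ^ 4 * (T + znorm (x (i - 1)) * zL ξ (x i) * zL ξ (x i)) ≤ 6 * N ^ 4 * (T + T) := by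
      gcongr
    linarith
  have hN4 : N ^ 4 ≤ N ^ 5 := pow_le_pow_right₀ hN (by norm_num)
  have hN2 : N ^ 2 ≤ N ^ 5 := pow_le_pow_right₀ hN (by norm_num)
  have hNT : N ^ 4 * T ≤ N ^ 5 * T := by gcongr
  have hNT' : N ^ 2 * T ≤ N ^ 5 * T := by gcongr
  have hNT0 : 0 ≤ N ^ 5 * T := by positivity
  by_cases h0 : cf (x i) (x (i - 1)) = 0
  · have h1 : cg (x i) (x (i - 1)) ≠ 0 := fun h => hC ⟨h0, h⟩
    have h2 : (1 : ℝ) ≤ |(cg (x i) (x (i - 1)) : ℝ)| := by exact_mod_cast Int.one_le_abs h1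
    rw [cdel, h0] at hcd
    simp at hcd
    linarith
  · have h2 : (1 : ℝ) ≤ |(cf (x i) (x (i - 1)) : ℝ)| := by exact_mod_cast Int.one_le_abs h0
    linarith

lemma kills_bound (H : MinCtx ξ x N n₀) {i : ℕ} (hi : n₀ ≤ i) {A : Fin 3 → ℤ}
    (hA : ∀ d : ℤ, (∀ i, d ∣ A i) → IsUnit d) (h1 : Kills A (x i)) (h2 : Kills A (x (i + 1)))
    (j : Fin 3) : (A j : ℝ) ^ 2 ≤ 8 * N * (znorm (x (i + 1)) * zL ξ (x i)) := by
  have hpl := abs_le_of_parallel (pl_primitive hA) (pl_parallel h1.1 h2.1 h1.2 h2.2) (by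
    obtain ⟨q, hq⟩ := H.exists_mnr_ne hi
    fin_cases q
    · exact absurd (by simp [mnr]) hq
    · exact ⟨5, hq⟩
    · exact ⟨4, by simpa [plDual] using hq⟩
    · exact ⟨3, hq⟩)
  set R := 4 * N * (znorm (x (i + 1)) * zL ξ (x i)) with hR
  have hle : ∀ p q, |(mnr (x i) (x (i + 1)) p q : ℝ)| ≤ R := H.mnr_le hi (Nat.lt_succ_self i)
  have hR0 : 0 ≤ R := (abs_nonneg _).trans (hle 0 0)
  have k0 : |((A 0 * A 0 : ℤ) : ℝ)| ≤ R := by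
    have h := hpl 0
    simp [pl, plDual, mnr, fm, fp] at h
    refine le_trans ?_ (hle 2 3)
    simp only [mnr]
    rw [abs_of_nonneg (by push_cast; exact mul_self_nonneg _)]
    exact_mod_cast h
  have k2 : |((A 2 * A 2 : ℤ) : ℝ)| ≤ R := by
    have h := hpl 5
    simp [pl, plDual, mnr, fm, fp] at h
    refine le_trans ?_ (hle 0 1)
    simp only [mnr]
    rw [abs_of_nonneg (by push_cast; exact mul_self_nonneg _)]
    exact_mod_cast h
  have k1 : |((A 1 * A 1 - A 2 * A 0 : ℤ) : ℝ)| ≤ R := by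
    have h := hpl 3
    simp [pl, plDual, mnr, fm, fp] at h
    refine le_trans ?_ (hle 0 3)
    simp only [mnr]
    exact_mod_cast h
  push_cast at k0 k1 k2
  rw [show 8 * N * (znorm (x (i + 1)) * zL ξ (x i)) = 2 * R by rw [hR]; ring]
  have k0' := (abs_le.1 k0).2
  have k1' := (abs_le.1 k1).2
  have k2' := (abs_le.1 k2).2
  fin_cases j <;> simp <;> nlinarith [sq_nonneg ((A 0 : ℝ) - A 2), sq_nonneg ((A 0 : ℝ) + A 2)]

lemma kills_small (H : MinCtx ξ x N n₀) {i : ℕ} (hi : n₀ + 1 ≤ i) {A : Fin 3 → ℤ} {B : ℝ}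
    (hA : ∀ j, |(A j : ℝ)| ≤ B) (h1 : Kills A (x i)) :
    |(dot (fm A) (x (i - 1)) : ℝ)| ≤ 6 * N ^ 3 * (B * zL ξ (x (i - 1))) ∧
    |(dot (fp A) (x (i - 1)) : ℝ)| ≤ 6 * N ^ 3 * (B * zL ξ (x (i - 1))) := by
  have hN := H.one_le
  have hy := H.bd i (by omega)
  have hw := H.bd (i - 1) (by omega)
  have hX := (H.X_lt (i := i - 1) (j := i) (by omega) (by omega)).le
  have hL := (H.L_lt (i := i - 1) (j := i) (by omega) (by omega)).le
  have hXy := H.X_le i (by omega)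
  have hX0 := H.X_pos (i := i) (by omega)
  have hy2 := hy.w_le hN H.hξ
  have hw2 := hw.w_le hN H.hξ
  set y := x i
  set w := x (i - 1)
  have hL0 := zL_nonneg (ξ := ξ) y
  have hLw0 := zL_nonneg (ξ := ξ) w
  have hB : 0 ≤ B := (abs_nonneg _).trans (hA 0)
  set τ := (A 0 : ℝ) + A 1 * ξ + A 2 * ξ ^ 2 with hτ
  have hker := h1.1
  rw [dot_fm] at hker
  have hkerR : (A 0 : ℝ) * y 0 + A 1 * y 1 + A 2 * y 2 = 0 := by exact_mod_cast hker
  have e : (y 0 : ℝ) * τ = -(A 1 * (y 1 - ξ * y 0) + A 2 * ((y 2 - ξ * y 1) + ξ * (y 1 - ξ * y 0))) := by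
    rw [hτ]; linear_combination hkerR
  have hNN : N ≤ N ^ 2 := by nlinarith
  have ht1 : |(y 0 : ℝ)| * |τ| ≤ 3 * N ^ 2 * (B * zL ξ y) := by
    rw [← abs_mul, e, abs_neg]
    refine (abs_add_le' (abs_mul_le' (hA 1) hy.d1) (abs_mul_le' (hA 2) hy2)).trans ?_
    have : N * (B * zL ξ y) ≤ N ^ 2 * (B * zL ξ y) := by gcongr
    linarith
  have ht2 : znorm w * |τ| ≤ 3 * N ^ 3 * (B * zL ξ w) := by
    calc znorm w * |τ| ≤ N * |(y 0 : ℝ)| * |τ| := by gcongr; exact hX.trans hXy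
      _ = N * (|(y 0 : ℝ)| * |τ|) := by ring
      _ ≤ N * (3 * N ^ 2 * (B * zL ξ y)) := by gcongr
      _ ≤ N * (3 * N ^ 2 * (B * zL ξ w)) := by gcongr
      _ = _ := by ring
  have hN3 : N * (B * zL ξ w) ≤ N ^ 3 * (B * zL ξ w) := by
    gcongr
    exact le_self_pow₀ hN (by norm_num)
  have hN23 : N ^ 2 * (B * zL ξ w) ≤ N ^ 3 * (B * zL ξ w) := by
    exact mul_le_mul_of_nonneg_right (pow_le_pow_right₀ hN (by norm_num)) (by positivity)
  constructor
  · rw [dot_fm]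
    push_cast
    rw [show (A 0 : ℝ) * w 0 + A 1 * w 1 + A 2 * w 2 = w 0 * τ + (A 1 * (w 1 - ξ * w 0) +
      A 2 * ((w 2 - ξ * w 1) + ξ * (w 1 - ξ * w 0))) by rw [hτ]; ring]
    have := abs_add_le' (abs_mul_le' hw.c0 (le_refl |τ|))
      (abs_add_le' (abs_mul_le' (hA 1) hw.d1) (abs_mul_le' (hA 2) hw2))
    linarith
  · rw [dot_fp]
    push_cast
    rw [show (A 0 : ℝ) * w 1 + A 1 * w 2 + A 2 * w 3 = w 1 * τ + (A 1 * (w 2 - ξ * w 1) +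
      A 2 * ((w 3 - ξ * w 2) + ξ * (w 2 - ξ * w 1))) by rw [hτ]; ring]
    have := abs_add_le' (abs_mul_le' hw.c1 (le_refl |τ|))
      (abs_add_le' (abs_mul_le' (hA 1) hw.d2) (abs_mul_le' (hA 2) (abs_add_le' hw.d3
        (abs_mul_le' H.hξ hw.d2))))
    have h5 : B * (N * zL ξ w + N * (N * zL ξ w)) = N * (B * zL ξ w) + N ^ 2 * (B * zL ξ w) := by ring
    linarith

/-- Beyond some index no nonzero triple annihilates `x i` and `x (i + 1)` for `i ∈ Iset x`. -/
lemma exists_kills_eq_zero (H : MinCtx ξ x N n₀)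
    (hQ : ∀ i, n₀ ≤ i → ¬ (q0 (x i) = 0 ∧ q1 (x i) = 0 ∧ q2 (x i) = 0)) :
    ∃ n₁, n₀ ≤ n₁ ∧ ∀ i ∈ Iset x, n₁ ≤ i → ∀ A : Fin 3 → ℤ, Kills A (x i) →
      Kills A (x (i + 1)) → A = 0 := by
  have hN := H.one_le
  set C₁ := Real.log (288 * N ^ 7) with hC₁
  set C₂ := Real.log (18 * N ^ 5) with hC₂
  have hC₁0 : 0 ≤ C₁ := Real.log_nonneg (by have := one_le_pow₀ hN (n := 7); linarith)
  have hC₂0 : 0 ≤ C₂ := Real.log_nonneg (by have := one_le_pow₀ hN (n := 5); linarith)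
  obtain ⟨M, hM⟩ := Filter.eventually_atTop.1
    (H.tendsto_log_X.eventually_gt_atTop (100 * (C₁ + C₂)))
  refine ⟨max (n₀ + 1) M, by omega, fun i hI hi A hA1 hA2 => ?_⟩
  by_contra hA0
  have hY := hM i (by omega)
  have hi0 : n₀ ≤ i := by omega
  have hi1 : n₀ ≤ i - 1 := by omega
  obtain ⟨B, hB0, hBp, hAB⟩ := exists_primitive hA0
  have hB1 := hA1.of_parallel hA0 hAB
  have hB2 := hA2.of_parallel hA0 hAB
  have hcr := H.cross3_ne (i := i) (by omega) hI
  have hBw : ¬ Kills B (x (i - 1)) := fun h => hB0 (eq_zero_of_kills hcr h hB1 hB2)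
  have hC : ¬ (cf (x i) (x (i - 1)) = 0 ∧ cg (x i) (x (i - 1)) = 0) := by
    rintro ⟨h1, h2⟩
    rw [cf_eq] at h1
    rw [cg_eq] at h2
    have hq : qv (x i) ≠ 0 := fun h => hQ i hi0 ⟨congrFun h 0, congrFun h 1, congrFun h 2⟩
    exact hBw (Kills.of_parallel ⟨h1, h2⟩ hq fun j k => by
      have := parallel_qv hB1 j k
      linarith)
  have hL0 := H.L_pos i hi0
  have hL1 := H.L_pos (i - 1) hi1
  have hX0 := H.X_pos hi0
  have hX1 := H.X_pos (i := i + 1) (by omega)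
  have hl := H.L_le i hi0
  have hp := H.L_le (i - 1) hi1
  rw [show i - 1 + 1 = i by omega] at hp
  have hYA := Real.log_le_log hX0 (H.X_lt hi0 (Nat.lt_succ_self i)).le
  have e2 : 0 ≤ C₂ + (Real.log (znorm (x i)) + Real.log (zL ξ (x i)) + Real.log (zL ξ (x (i - 1)))) := by
    have := Real.log_le_log one_pos (H.one_le_of_C_ne (by omega) hC)
    rwa [Real.log_one, Real.log_mul (by positivity) (by positivity), Real.log_mul (by positivity) hL1.ne',
      Real.log_mul hX0.ne' hL0.ne'] at this
  set S := znorm (x (i + 1)) * zL ξ (x i) with hS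
  have hS0 : 0 < S := by positivity
  have hBj : ∀ j, |(B j : ℝ)| ≤ Real.sqrt (8 * N * S) := fun j =>
    Real.abs_le_sqrt (H.kills_bound hi0 hBp hB1 hB2 j)
  obtain ⟨k1, k2⟩ := H.kills_small (by omega) hBj hB1
  have hone : 1 ≤ 6 * N ^ 3 * (Real.sqrt (8 * N * S) * zL ξ (x (i - 1))) := by
    by_cases h0 : dot (fm B) (x (i - 1)) = 0
    · have h1 : dot (fp B) (x (i - 1)) ≠ 0 := fun h => hBw ⟨h0, h⟩
      exact le_trans (by exact_mod_cast Int.one_le_abs h1) k2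
    · exact le_trans (by exact_mod_cast Int.one_le_abs h0) k1
  have e1 : 0 ≤ C₁ + (Real.log (znorm (x (i + 1))) + Real.log (zL ξ (x i)) +
      2 * Real.log (zL ξ (x (i - 1)))) := by
    have h2 : (1 : ℝ) ≤ 288 * N ^ 7 * (S * zL ξ (x (i - 1)) ^ 2) := by
      calc (1 : ℝ) ≤ (6 * N ^ 3 * (Real.sqrt (8 * N * S) * zL ξ (x (i - 1)))) ^ 2 := one_le_pow₀ hone
        _ = 36 * N ^ 6 * (Real.sqrt (8 * N * S) ^ 2 * zL ξ (x (i - 1)) ^ 2) := by ring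
        _ = _ := by rw [Real.sq_sqrt (by positivity)]; ring
    have := Real.log_le_log one_pos h2
    rw [Real.log_one, Real.log_mul (by positivity) (by positivity), Real.log_mul hS0.ne' (by positivity),
      Real.log_pow, hS, Real.log_mul hX1.ne' hL0.ne'] at this
    push_cast at this
    exact this
  linarith

end MinCtx

end

section

/-- A sequence of minimal points together with an enumeration of a final segment of `Iset` on which
the relevant quadratic forms do not vanish. -/
structure EnumCtx (ξ : ℝ) (x : ℕ → Fin 4 → ℤ) (N : ℝ) (n₀ : ℕ) (s : ℕ → ℕ) : Prop where
  toMin : MinCtx ξ x N n₀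
  enum : IsEnum x n₀ s
  q_ne : ∀ i, n₀ ≤ i → ¬ (q0 (x i) = 0 ∧ q1 (x i) = 0 ∧ q2 (x i) = 0)
  kills : ∀ i ∈ Iset x, n₀ ≤ i → ∀ A : Fin 3 → ℤ, Kills A (x i) → Kills A (x (i + 1)) → A = 0

/-- Logarithm of the norm of a point. -/
def lX (x : ℕ → Fin 4 → ℤ) (i : ℕ) : ℝ := Real.log (znorm (x i))

/-- Logarithm of the error of a point. -/
def lL (ξ : ℝ) (x : ℕ → Fin 4 → ℤ) (i : ℕ) : ℝ := Real.log (zL ξ (x i))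

lemma cdel_ne_zero {ξ : ℝ} (hlin : ∀ n : Fin 4 → ℤ,
    (n 0 : ℝ) + n 1 * ξ + n 2 * ξ ^ 2 + n 3 * ξ ^ 3 = 0 → n = 0) {f g : ℤ}
    (h : ¬ (f = 0 ∧ g = 0)) : (g : ℝ) - ξ * f ≠ 0 := by
  intro h0
  have := hlin ![g, -f, 0, 0] (by simp; linarith)
  exact h ⟨by simpa using congrFun this 1, by simpa using congrFun this 0⟩

lemma mnr_comb (a b : Fin 4 → ℤ) (α β γ δ : ℤ) (p q : Fin 4) :
    mnr (α • a + β • b) (γ • a + δ • b) p q = (α * δ - β * γ) * mnr a b p q := by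
  simp [mnr]; ring

lemma sform_comb (ξ : ℝ) (a b : Fin 4 → ℤ) (α β γ δ : ℤ) :
    sform ξ (α • a + β • b) (γ • a + δ • b) = ((α * δ - β * γ : ℤ) : ℝ) * sform ξ a b := by
  simp [sform]; ring

namespace EnumCtx
variable {ξ N : ℝ} {x : ℕ → Fin 4 → ℤ} {n₀ : ℕ} {s : ℕ → ℕ}

lemma lt (G : EnumCtx ξ x N n₀ s) (k : ℕ) : s k < s (k + 1) := G.enum.mono (Nat.lt_succ_self k)

lemma unimodular (G : EnumCtx ξ x N n₀ s) (k : ℕ) :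
    ∃ α β γ δ : ℤ, |α * δ - β * γ| = 1 ∧
      x (s (k + 1) - 1) = α • x (s k) + β • x (s k + 1) ∧
      x (s (k + 1)) = γ • x (s k) + δ • x (s k + 1) := by
  have := G.enum.ge k
  exact G.toMin.hmin.unimodular (by omega) (G.lt k) fun m hm hm' => G.enum.gap k m hm hm'

lemma abs_mnr_eq (G : EnumCtx ξ x N n₀ s) (k : ℕ) (p q : Fin 4) :
    |(mnr (x (s (k + 1) - 1)) (x (s (k + 1))) p q : ℝ)| =
      |(mnr (x (s k)) (x (s k + 1)) p q : ℝ)| := by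
  obtain ⟨α, β, γ, δ, hd, h1, h2⟩ := G.unimodular k
  have : |mnr (x (s (k + 1) - 1)) (x (s (k + 1))) p q| = |mnr (x (s k)) (x (s k + 1)) p q| := by
    rw [h1, h2, mnr_comb, abs_mul, hd, one_mul]
  exact_mod_cast this

lemma abs_sform_eq (G : EnumCtx ξ x N n₀ s) (k : ℕ) :
    |sform ξ (x (s (k + 1) - 1)) (x (s (k + 1)))| = |sform ξ (x (s k)) (x (s k + 1))| := by
  obtain ⟨α, β, γ, δ, hd, h1, h2⟩ := G.unimodular k
  rw [h1, h2, sform_comb, abs_mul, ← Int.cast_abs, hd, Int.cast_one, one_mul]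

lemma E_ne (G : EnumCtx ξ x N n₀ s) (k : ℕ) :
    ¬ (cf (x (s k)) (x (s k + 1)) = 0 ∧ cg (x (s k)) (x (s k + 1)) = 0) := by
  rintro ⟨h1, h2⟩
  have hk := G.enum.ge k
  have h := G.kills _ (G.enum.mem k) (by omega) (qv (x (s k))) (kills_qv _)
    ⟨by rw [← cf_eq]; exact h1, by rw [← cg_eq]; exact h2⟩
  exact G.q_ne (s k) (by omega) ⟨congrFun h 0, congrFun h 1, congrFun h 2⟩

lemma exists_inverse (G : EnumCtx ξ x N n₀ s) (k : ℕ) : ∃ α β γ δ : ℤ,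
    x (s k) = α • x (s (k + 1) - 1) + β • x (s (k + 1)) ∧
    x (s k + 1) = γ • x (s (k + 1) - 1) + δ • x (s (k + 1)) := by
  obtain ⟨α, β, γ, δ, hd, hv, hy⟩ := G.unimodular k
  set ε := α * δ - β * γ with hε
  have hεε : ε * ε = 1 := by rw [← abs_mul_abs_self, hd, one_mul]
  have e1 : x (s k) = (ε * δ) • x (s (k + 1) - 1) + (-(ε * β)) • x (s (k + 1)) := by
    rw [hv, hy]
    ext j
    simp
    linear_combination (-(x (s k) j)) * hεε + ε * x (s k) j * hε
  have e2 : x (s k + 1) = (-(ε * γ)) • x (s (k + 1) - 1) + (ε * α) • x (s (k + 1)) := by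
    rw [hv, hy]
    ext j
    simp
    linear_combination (-(x (s k + 1) j)) * hεε + ε * x (s k + 1) j * hε
  exact ⟨_, _, _, _, e1, e2⟩

lemma D_ne (G : EnumCtx ξ x N n₀ s) (k : ℕ) :
    ¬ (cf (x (s (k + 1))) (x (s (k + 1) - 1)) = 0 ∧ cg (x (s (k + 1))) (x (s (k + 1) - 1)) = 0) := by
  rintro ⟨h1, h2⟩
  have hk := G.enum.ge k
  have hk1 := G.enum.ge (k + 1)
  obtain ⟨α, β, γ, δ, e1, e2⟩ := G.exists_inverse k
  have k1 : Kills (qv (x (s (k + 1)))) (x (s (k + 1) - 1)) :=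
    ⟨by rw [← cf_eq]; exact h1, by rw [← cg_eq]; exact h2⟩
  have k2 : Kills (qv (x (s (k + 1)))) (x (s (k + 1))) := kills_qv _
  have h := G.kills _ (G.enum.mem k) (by omega) (qv (x (s (k + 1))))
    (by rw [e1]; exact k1.comb k2 _ _) (by rw [e2]; exact k1.comb k2 _ _)
  exact G.q_ne (s (k + 1)) (by omega) ⟨congrFun h 0, congrFun h 1, congrFun h 2⟩

end EnumCtx

lemma log_le_of_le_mul {K a b : ℝ} (ha : 0 < a) (hb : 0 < b) (h : a ≤ K * b) :
    Real.log a ≤ Real.log K + Real.log b := by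
  have hK : 0 < K := by
    by_contra hK
    nlinarith
  rw [← Real.log_mul hK.ne' hb.ne']
  exact Real.log_le_log ha h

namespace MinCtx
variable {ξ N : ℝ} {x : ℕ → Fin 4 → ℤ} {n₀ : ℕ}

lemma log_XL (H : MinCtx ξ x N n₀) {i j : ℕ} (hi : n₀ ≤ i) (hj : n₀ ≤ j) :
    Real.log (znorm (x i) * zL ξ (x j)) = lX x i + lL ξ x j :=
  Real.log_mul (H.X_pos hi).ne' (H.L_pos j hj).ne'

lemma log_XLL (H : MinCtx ξ x N n₀) {i j m : ℕ} (hi : n₀ ≤ i) (hj : n₀ ≤ j) (hm : n₀ ≤ m) :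
    Real.log (znorm (x i) * zL ξ (x j) * zL ξ (x m)) = lX x i + lL ξ x j + lL ξ x m := by
  rw [Real.log_mul (mul_pos (H.X_pos hi) (H.L_pos j hj)).ne' (H.L_pos m hm).ne', H.log_XL hi hj]
  rfl

lemma log_LL (H : MinCtx ξ x N n₀) {i j : ℕ} (hi : n₀ ≤ i) (hj : n₀ ≤ j) :
    Real.log (zL ξ (x i) * zL ξ (x j)) = lL ξ x i + lL ξ x j :=
  Real.log_mul (H.L_pos i hi).ne' (H.L_pos j hj).ne'

lemma lX_le (H : MinCtx ξ x N n₀) {i j : ℕ} (hi : n₀ ≤ i) (hij : i ≤ j) : lX x i ≤ lX x j := by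
  rcases hij.eq_or_lt with rfl | h
  · exact le_rfl
  · exact Real.log_le_log (H.X_pos hi) (H.X_lt hi h).le

lemma lL_le (H : MinCtx ξ x N n₀) {i j : ℕ} (hi : n₀ ≤ i) (hij : i ≤ j) : lL ξ x j ≤ lL ξ x i := by
  rcases hij.eq_or_lt with rfl | h
  · exact le_rfl
  · exact Real.log_le_log (H.L_pos j (hi.trans hij)) (H.L_lt hi h).le

end MinCtx

namespace EnumCtx
variable {ξ N : ℝ} {x : ℕ → Fin 4 → ℤ} {n₀ : ℕ} {s : ℕ → ℕ}

lemma height_le (G : EnumCtx ξ x N n₀ s) : ∃ C, ∀ k,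
    lX x (s (k + 1)) + lL ξ x (s (k + 1) - 1) ≤ lX x (s k + 1) + lL ξ x (s k) + C := by
  have H := G.toMin
  have hN := H.one_le
  refine ⟨Real.log (16 * N ^ 2), fun k => ?_⟩
  have hk := G.enum.ge k
  have hk1 := G.lt k
  obtain ⟨q, hq⟩ := H.exists_le_mnr (i := s (k + 1) - 1) (by omega)
  rw [show s (k + 1) - 1 + 1 = s (k + 1) by omega, G.abs_mnr_eq] at hq
  have h2 := H.mnr_le (i := s k) (j := s k + 1) (by omega) (by omega) 0 q
  have h3 := log_le_of_le_mul (K := 16 * N ^ 2)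
    (mul_pos (H.X_pos (i := s (k + 1)) (by omega)) (H.L_pos (s (k + 1) - 1) (by omega)))
    (mul_pos (H.X_pos (i := s k + 1) (by omega)) (H.L_pos (s k) (by omega)))
    (by nlinarith)
  rw [H.log_XL (by omega) (by omega), H.log_XL (by omega) (by omega)] at h3
  linarith

lemma height_ge (G : EnumCtx ξ x N n₀ s) : ∃ C, ∀ k,
    lX x (s k + 1) + lL ξ x (s k) ≤ lX x (s (k + 1)) + lL ξ x (s (k + 1) - 1) + C := by
  have H := G.toMin
  have hN := H.one_le
  refine ⟨Real.log (16 * N ^ 2), fun k => ?_⟩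
  have hk := G.enum.ge k
  have hk1 := G.lt k
  obtain ⟨q, hq⟩ := H.exists_le_mnr (i := s k) (by omega)
  rw [← G.abs_mnr_eq] at hq
  have h2 := H.mnr_le (i := s (k + 1) - 1) (j := s (k + 1)) (by omega) (by omega) 0 q
  have h3 := log_le_of_le_mul (K := 16 * N ^ 2)
    (mul_pos (H.X_pos (i := s k + 1) (by omega)) (H.L_pos (s k) (by omega)))
    (mul_pos (H.X_pos (i := s (k + 1)) (by omega)) (H.L_pos (s (k + 1) - 1) (by omega)))
    (by nlinarith)
  rw [H.log_XL (by omega) (by omega), H.log_XL (by omega) (by omega)] at h3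
  linarith

lemma nondeg (G : EnumCtx ξ x N n₀ s) : ∃ C, ∀ k,
    0 ≤ lX x (s (k + 1)) + lL ξ x (s (k + 1) - 1) + lL ξ x (s (k + 1)) + C := by
  have H := G.toMin
  refine ⟨Real.log (18 * N ^ 5), fun k => ?_⟩
  have hk := G.enum.ge (k + 1)
  have h := log_le_of_le_mul one_pos (mul_pos (mul_pos (H.X_pos (by omega)) (H.L_pos _ (by omega)))
    (H.L_pos _ (by omega))) (H.one_le_of_C_ne hk (G.D_ne k))
  rw [H.log_XLL (by omega) (by omega) (by omega), Real.log_one] at h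
  linarith

lemma sform_le (G : EnumCtx ξ x N n₀ s) {i j : ℕ} (hi : n₀ ≤ i) (hj : n₀ ≤ j) :
    |sform ξ (x i) (x j)| ≤ 6 * N ^ 4 * (zL ξ (x i) * zL ξ (x j)) :=
  ((G.toMin.bd i hi).sform_le G.toMin.one_le G.toMin.hξ (G.toMin.bd j hj)).trans (le_of_eq (by ring))

end EnumCtx

end

section

lemma abs_det_le {a₀ a₁ a₂ b₀ b₁ b₂ c₀ c₁ c₂ X A B C : ℝ} (ha₀ : |a₀| ≤ X) (hb₀ : |b₀| ≤ X)
    (hc₀ : |c₀| ≤ X) (ha₁ : |a₁| ≤ A) (ha₂ : |a₂| ≤ A) (hb₁ : |b₁| ≤ B) (hb₂ : |b₂| ≤ B)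
    (hc₁ : |c₁| ≤ C) (hc₂ : |c₂| ≤ C) (hCB : C ≤ B) (hBA : B ≤ A) :
    |a₀ * (b₁ * c₂ - b₂ * c₁) - b₀ * (a₁ * c₂ - a₂ * c₁) + c₀ * (a₁ * b₂ - a₂ * b₁)| ≤
      6 * (X * B * A) := by
  have hX : 0 ≤ X := (abs_nonneg _).trans ha₀
  have hC : 0 ≤ C := (abs_nonneg _).trans hc₁
  have hB : 0 ≤ B := hC.trans hCB
  have hA : 0 ≤ A := hB.trans hBA
  refine (abs_add_le' (abs_sub_le' (abs_mul_le' ha₀ (abs_sub_le' (abs_mul_le' hb₁ hc₂)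
    (abs_mul_le' hb₂ hc₁))) (abs_mul_le' hb₀ (abs_sub_le' (abs_mul_le' ha₁ hc₂)
    (abs_mul_le' ha₂ hc₁)))) (abs_mul_le' hc₀ (abs_sub_le' (abs_mul_le' ha₁ hb₂)
    (abs_mul_le' ha₂ hb₁)))).trans ?_
  have h1 : X * (B * C) ≤ X * (B * A) := by gcongr; exact hCB.trans hBA
  have h2 : X * (A * C) ≤ X * (A * B) := by gcongr
  linarith

lemma znorm_le_of_forall {n : Fin 4 → ℤ} {B : ℝ} (h : ∀ j, |(n j : ℝ)| ≤ B) : znorm n ≤ B :=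
  max_le (max_le (h 0) (h 1)) (max_le (h 2) (h 3))

namespace MinCtx
variable {ξ N : ℝ} {x : ℕ → Fin 4 → ℤ} {n₀ : ℕ}

lemma abs_cross3_le (H : MinCtx ξ x N n₀) {i : ℕ} (hi : n₀ + 1 ≤ i) :
    znorm (cross3 (x (i - 1)) (x i) (x (i + 1))) ≤
      18 * N * (znorm (x (i + 1)) * zL ξ (x i) * zL ξ (x (i - 1))) := by
  have hN := H.one_le
  have hX1 := (H.X_lt (i := i - 1) (j := i) (by omega) (by omega)).le
  have hX2 := (H.X_lt (i := i) (j := i + 1) (by omega) (by omega)).le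
  have hL1 := (H.L_lt (i := i - 1) (j := i) (by omega) (by omega)).le
  have hL2 := (H.L_lt (i := i) (j := i + 1) (by omega) (by omega)).le
  have hy0 := H.X_le i (by omega)
  have hX0 := H.X_pos (i := i) (by omega)
  obtain ⟨-, hdot, -⟩ := dot_cross3 (x (i - 1)) (x i) (x (i + 1))
  set v := x (i - 1)
  set y := x i
  set u := x (i + 1)
  set T := znorm u * zL ξ y * zL ξ v with hT
  have hT0 : 0 ≤ T := mul_nonneg (mul_nonneg (znorm_nonneg _) (zL_nonneg _)) (zL_nonneg _)
  have hv0 : |(v 0 : ℝ)| ≤ znorm u := (abs_le_znorm v 0).trans (hX1.trans hX2)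
  have hyu : |(y 0 : ℝ)| ≤ znorm u := (abs_le_znorm y 0).trans hX2
  have hu0 := abs_le_znorm u 0
  have E : ∀ (w : Fin 4 → ℤ), |(w 0 : ℝ) * ξ - w 1| ≤ zL ξ w ∧ |(w 0 : ℝ) * ξ ^ 2 - w 2| ≤ zL ξ w ∧
      |(w 0 : ℝ) * ξ ^ 3 - w 3| ≤ zL ξ w := fun w =>
    ⟨(le_max_left _ _).trans (le_max_left _ _), (le_max_right _ _).trans (le_max_left _ _),
      le_max_right _ _⟩
  obtain ⟨v1, v2, v3⟩ := E v
  obtain ⟨y1, y2, y3⟩ := E y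
  obtain ⟨u1, u2, u3⟩ := E u
  have c1 : |(cross3 v y u 1 : ℝ)| ≤ 6 * T := by
    rw [← abs_neg]
    refine le_trans (le_of_eq (congrArg _ ?_)) (abs_det_le hv0 hyu hu0 v2 v3 y2 y3 u2 u3 hL2 hL1)
    simp [cross3, mnr]; ring
  have c2 : |(cross3 v y u 2 : ℝ)| ≤ 6 * T := by
    refine le_trans (le_of_eq (congrArg _ ?_)) (abs_det_le hv0 hyu hu0 v1 v3 y1 y3 u1 u3 hL2 hL1)
    simp [cross3, mnr]; ring
  have c3 : |(cross3 v y u 3 : ℝ)| ≤ 6 * T := by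
    rw [← abs_neg]
    refine le_trans (le_of_eq (congrArg _ ?_)) (abs_det_le hv0 hyu hu0 v1 v2 y1 y2 u1 u2 hL2 hL1)
    simp [cross3, mnr]; ring
  set n := cross3 v y u
  have hNT : T ≤ N * T := le_mul_of_one_le_left hT0 hN
  have c0 : |(n 0 : ℝ)| ≤ 18 * N * T := by
    have hd : (n 0 : ℝ) * y 0 + n 1 * y 1 + n 2 * y 2 + n 3 * y 3 = 0 := by exact_mod_cast hdot
    have h1 : |(n 0 : ℝ)| * |(y 0 : ℝ)| ≤ 18 * T * znorm y := by
      rw [← abs_mul, show (n 0 : ℝ) * y 0 = -(n 1 * y 1 + n 2 * y 2 + n 3 * y 3) by linarith, abs_neg]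
      refine (abs_add_le' (abs_add_le' (abs_mul_le' c1 (abs_le_znorm y 1))
        (abs_mul_le' c2 (abs_le_znorm y 2))) (abs_mul_le' c3 (abs_le_znorm y 3))).trans
        (le_of_eq (by ring))
    have hyp : 0 < |(y 0 : ℝ)| := by
      by_contra h
      have : |(y 0 : ℝ)| = 0 := le_antisymm (not_lt.1 h) (abs_nonneg _)
      rw [this] at hy0
      linarith
    refine le_of_mul_le_mul_right (h1.trans ?_) hyp
    calc 18 * T * znorm y ≤ 18 * T * (N * |(y 0 : ℝ)|) := by gcongr
      _ = _ := by ring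
  refine znorm_le_of_forall fun j => ?_
  fin_cases j
  · exact c0
  · exact c1.trans (by linarith)
  · exact c2.trans (by linarith)
  · exact c3.trans (by linarith)

end MinCtx

namespace EnumCtx
variable {ξ N : ℝ} {x : ℕ → Fin 4 → ℤ} {n₀ : ℕ} {s : ℕ → ℕ}

lemma normalHeight_pos (x : ℕ → Fin 4 → ℤ) (i : ℕ) : (0 : ℝ) < normalHeight (Uspace x i) := by
  obtain ⟨n, hn, -, h⟩ := exists_normalHeight x i
  rw [← h]
  linarith [one_le_znorm hn]

lemma h_le (G : EnumCtx ξ x N n₀ s) : ∃ C, ∀ k,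
    Real.log (normalHeight (Uspace x (s k))) ≤
      lX x (s (k + 1)) + lL ξ x (s (k + 1) - 1) + lL ξ x (s k - 1) + C := by
  have H := G.toMin
  obtain ⟨C, hC⟩ := G.height_ge
  refine ⟨C + Real.log (18 * N), fun k => ?_⟩
  have hk := G.enum.ge k
  obtain ⟨h1, h2, h3⟩ := dot_cross3 (x (s k - 1)) (x (s k)) (x (s k + 1))
  have hle := (normalHeight_le (H.cross3_ne hk (G.enum.mem k))
    (Uspace_le_perpSpace.2 ⟨h1, h2, h3⟩)).trans (H.abs_cross3_le hk)
  have h := log_le_of_le_mul (normalHeight_pos x _) (mul_pos (mul_pos (H.X_pos (by omega))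
    (H.L_pos _ (by omega))) (H.L_pos _ (by omega))) hle
  rw [H.log_XLL (by omega) (by omega) (by omega)] at h
  linarith [hC k]

lemma J_le (G : EnumCtx ξ x N n₀ s) : ∃ C, ∀ k, Uspace x (s k) ≠ Uspace x (s (k + 1)) →
    lX x (s (k + 1)) + lL ξ x (s (k + 1) - 1) ≤ Real.log (normalHeight (Uspace x (s k))) +
      Real.log (normalHeight (Uspace x (s (k + 1)))) + C := by
  have H := G.toMin
  have hN := H.one_le
  obtain ⟨C, hC⟩ := G.height_le
  refine ⟨C + Real.log (8 * N), fun k hJ => ?_⟩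
  have hk := G.enum.ge k
  obtain ⟨n, hn, hnU, hnh⟩ := exists_normalHeight x (s k)
  obtain ⟨m, hm, hmU, hmh⟩ := exists_normalHeight x (s (k + 1))
  have hnm : ∃ i, pl n m i ≠ 0 := by
    by_contra! h0
    refine hJ ?_
    rw [H.hmin.Uspace_eq_perpSpace (G.enum.mem k) hn hnU,
      H.hmin.Uspace_eq_perpSpace (G.enum.mem (k + 1)) hm hmU]
    refine perpSpace_eq_of_parallel hn (fun p q => ?_) hm
    have e := fun i => h0 i
    have e0 := e 0; have e1 := e 1; have e2 := e 2; have e3 := e 3; have e4 := e 4; have e5 := e 5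
    simp [pl, mnr] at e0 e1 e2 e3 e4 e5
    fin_cases p <;> fin_cases q <;> simp [mnr] <;> linarith
  obtain ⟨-, n1, n2⟩ := Uspace_le_perpSpace.1 hnU
  obtain ⟨m1, m2, -⟩ := Uspace_le_perpSpace.1 hmU
  obtain ⟨α, β, γ, δ, e1, e2⟩ := G.exists_inverse k
  have m1' : dot m (x (s k)) = 0 := by rw [e1, dot_comb, m1, m2]; ring
  have m2' : dot m (x (s k + 1)) = 0 := by rw [e2, dot_comb, m1, m2]; ring
  have hle := abs_le_of_parallel (u := plDual (x (s k)) (x (s k + 1))) (v := pl n m) (by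
      intro d hd
      refine (H.pair (by omega : n₀ ≤ s k)).minors_primitive ?_
      have e0 := hd 0; have e1 := hd 1; have e2 := hd 2; have e3 := hd 3; have e4 := hd 4
      have e5 := hd 5
      simp [plDual] at e0 e1 e2 e3 e4 e5
      have hanti : ∀ p q, mnr (x (s k)) (x (s k + 1)) p q = -mnr (x (s k)) (x (s k + 1)) q p := by
        intro p q; simp [mnr]
      have hz : ∀ p, mnr (x (s k)) (x (s k + 1)) p p = 0 := by intro p; simp [mnr]
      intro p q
      fin_cases p <;> fin_cases q <;> simp [hz] <;>
        first | assumption | (rw [hanti, dvd_neg]; assumption))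
    (fun i j => by
      have := pl_parallel n1 n2 m1' m2' i j
      linarith) hnm
  have hpl : ∀ i, |(pl n m i : ℝ)| ≤ 2 * (znorm n * znorm m) := by
    have hmn : ∀ p q, |(mnr n m p q : ℝ)| ≤ 2 * (znorm n * znorm m) := by
      intro p q
      simp only [mnr]
      push_cast
      refine (abs_sub_le' (abs_mul_le' (abs_le_znorm n p) (abs_le_znorm m q))
        (abs_mul_le' (abs_le_znorm n q) (abs_le_znorm m p))).trans (by linarith)
    intro i
    fin_cases i <;> exact hmn _ _
  obtain ⟨q, hq⟩ := H.exists_le_mnr (i := s k) (by omega)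
  have hq2 : |(mnr (x (s k)) (x (s k + 1)) 0 q : ℝ)| ≤ 2 * (znorm n * znorm m) := by
    have hle' : ∀ i, |(plDual (x (s k)) (x (s k + 1)) i : ℝ)| ≤ 2 * (znorm n * znorm m) := fun i =>
      le_trans (by exact_mod_cast hle i) (hpl i)
    fin_cases q
    · simp [mnr]
      exact mul_nonneg (znorm_nonneg _) (znorm_nonneg _)
    · exact hle' 5
    · have := hle' 4
      simpa [plDual] using this
    · exact hle' 3
  rw [hnh, hmh] at hq2
  have p1 := normalHeight_pos x (s k)
  have p2 := normalHeight_pos x (s (k + 1))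
  have h := log_le_of_le_mul (K := 8 * N) (mul_pos (H.X_pos (by omega)) (H.L_pos _ (by omega)))
    (mul_pos p1 p2) (hq.trans (by nlinarith))
  rw [H.log_XL (by omega) (by omega), Real.log_mul p1.ne' p2.ne'] at h
  linarith [hC k]

end EnumCtx

end

section

namespace EnumCtx
variable {ξ N : ℝ} {x : ℕ → Fin 4 → ℤ} {n₀ : ℕ} {s : ℕ → ℕ}

lemma one_le_of_ne (G : EnumCtx ξ x N n₀ s) {i : ℕ} (hi : n₀ ≤ i) {f g : ℤ}
    (h : ¬ (f = 0 ∧ g = 0)) :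
    1 ≤ |(g : ℝ) - ξ * f| * znorm (x i) + |(f : ℝ)| * (N * zL ξ (x i)) := by
  have hb := G.toMin.bd i hi
  have hq := G.q_ne i hi
  set a := x i
  have key : ∀ (u w : ℤ), |(u : ℝ)| ≤ znorm a → |(w : ℝ) - ξ * u| ≤ N * zL ξ a → g * u - f * w ≠ 0 →
      1 ≤ |(g : ℝ) - ξ * f| * znorm a + |(f : ℝ)| * (N * zL ξ a) := by
    intro u w hu hw hne
    have h1 : (1 : ℝ) ≤ |((g * u - f * w : ℤ) : ℝ)| := by exact_mod_cast Int.one_le_abs hne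
    refine h1.trans ?_
    rw [show ((g * u - f * w : ℤ) : ℝ) = ((g : ℝ) - ξ * f) * u - f * (w - ξ * u) by push_cast; ring]
    exact abs_sub_le' (abs_mul_le' le_rfl hu) (abs_mul_le' le_rfl hw)
  by_contra hcon
  have z0 : g * a 0 - f * a 1 = 0 := by
    by_contra hne; exact hcon (key _ _ hb.c0 hb.d1 hne)
  have z1 : g * a 1 - f * a 2 = 0 := by
    by_contra hne; exact hcon (key _ _ hb.c1 hb.d2 hne)
  have z2 : g * a 2 - f * a 3 = 0 := by
    by_contra hne; exact hcon (key _ _ hb.c2 hb.d3 hne)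
  apply hq
  have cancel : ∀ q : ℤ, f * q = 0 → g * q = 0 → q = 0 := by
    intro q hf hg
    by_contra hq0
    exact h ⟨(mul_eq_zero.1 hf).resolve_right hq0, (mul_eq_zero.1 hg).resolve_right hq0⟩
  refine ⟨cancel _ ?_ ?_, cancel _ ?_ ?_, cancel _ ?_ ?_⟩ <;> simp only [q0, q1, q2]
  · linear_combination (a 2) * z1 - (a 1) * z2
  · linear_combination (a 3) * z1 - (a 2) * z2
  · linear_combination (a 0) * z2 - (a 2) * z0
  · linear_combination (a 1) * z2 - (a 3) * z0
  · linear_combination (a 1) * z0 - (a 0) * z1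
  · linear_combination (a 2) * z0 - (a 1) * z1

lemma exists_log_le (G : EnumCtx ξ x N n₀ s) : ∃ C, ∀ (f g : ℤ) (F : ℝ), ¬ (f = 0 ∧ g = 0) → 1 ≤ F →
    |(f : ℝ)| ≤ F → -0.4245069 * Real.log |(g : ℝ) - ξ * f| ≤ Real.log F + C := by
  have H := G.toMin
  have hN := H.one_le
  have hlN : 0 ≤ Real.log N := Real.log_nonneg hN
  have hl2 : 0 ≤ Real.log 2 := Real.log_nonneg (by norm_num)
  have hX1 : 0 ≤ Real.log (znorm (x n₀)) := by
    refine Real.log_nonneg ?_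
    linarith [H.X_large n₀ le_rfl]
  refine ⟨Real.log (2 * N) + Real.log 2 + Real.log (znorm (x n₀)), fun f g F hne hF hfF => ?_⟩
  have hΔ : 0 < |(g : ℝ) - ξ * f| := abs_pos.2 (cdel_ne_zero H.hlin hne)
  have hone := fun i hi => G.one_le_of_ne (i := i) hi hne
  set Δ := |(g : ℝ) - ξ * f|
  have hlF : 0 ≤ Real.log F := Real.log_nonneg hF
  rw [Real.log_mul two_ne_zero (by positivity)]
  by_cases hR : 1 / (2 * Δ) < znorm (x n₀)
  · have := Real.log_le_log (by positivity) hR.le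
    rw [Real.log_div one_ne_zero (by positivity), Real.log_mul two_ne_zero hΔ.ne', Real.log_one] at this
    linarith
  · obtain ⟨M, hM⟩ := Filter.eventually_atTop.1 (H.hmin.tendsto_X.eventually_gt_atTop (1 / (2 * Δ)))
    have hex : ∃ m, 1 / (2 * Δ) < znorm (x (n₀ + m)) := ⟨M, hM _ (by omega)⟩
    classical
    obtain ⟨m, hm, hm'⟩ : ∃ m, znorm (x (n₀ + m)) ≤ 1 / (2 * Δ) ∧
        1 / (2 * Δ) < znorm (x (n₀ + m + 1)) := by
      have hpos : Nat.find hex ≠ 0 := by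
        intro h0
        have := Nat.find_spec hex
        rw [h0, add_zero] at this
        exact hR this
      refine ⟨Nat.find hex - 1, not_lt.1 (Nat.find_min hex (by omega)), ?_⟩
      have := Nat.find_spec hex
      rwa [show n₀ + (Nat.find hex - 1) + 1 = n₀ + Nat.find hex by omega]
    have hi : n₀ ≤ n₀ + m := by omega
    have h1 := hone _ hi
    have hl := H.L_le _ hi
    have hLp := H.L_pos _ hi
    have h2 : Δ * znorm (x (n₀ + m)) ≤ 1 / 2 := by
      calc Δ * znorm (x (n₀ + m)) ≤ Δ * (1 / (2 * Δ)) := by gcongr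
        _ = 1 / 2 := by field_simp
    have h3 : |(f : ℝ)| * (N * zL ξ (x (n₀ + m))) ≤ F * (N * zL ξ (x (n₀ + m))) := by gcongr
    have h4 := log_le_of_le_mul (K := 2 * N) one_pos (b := F * zL ξ (x (n₀ + m))) (by positivity)
      (by nlinarith)
    rw [Real.log_one, Real.log_mul two_ne_zero (by positivity), Real.log_mul (by positivity) hLp.ne'] at h4
    have h5 := Real.log_le_log (by positivity) hm'.le
    rw [Real.log_div one_ne_zero (by positivity), Real.log_mul two_ne_zero hΔ.ne', Real.log_one] at h5
    linarith

end EnumCtx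

end

section

lemma log_close {a b r : ℝ} (hb : b ≠ 0) (hr : 0 < r) (h : |b - a| ≤ r)
    (hlog : Real.log r + Real.log 2 ≤ Real.log |b|) :
    a ≠ 0 ∧ Real.log |a| ≤ Real.log |b| + Real.log 2 ∧ Real.log |b| ≤ Real.log |a| + Real.log 2 := by
  have hb' := abs_pos.2 hb
  rw [← Real.log_mul hr.ne' two_ne_zero, Real.log_le_log_iff (by positivity) hb'] at hlog
  have h1 : |b| ≤ |b - a| + |a| := by simpa using abs_add_le (b - a) a
  have h2 : |a| ≤ |b| + |b - a| := by simpa using abs_sub b (b - a)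
  have ha : 0 < |a| := by linarith
  refine ⟨abs_pos.1 ha, ?_, ?_⟩
  · rw [← Real.log_mul hb'.ne' two_ne_zero]
    exact Real.log_le_log ha (by linarith)
  · rw [← Real.log_mul ha.ne' two_ne_zero]
    exact Real.log_le_log hb' (by linarith)

lemma sform_swap (ξ : ℝ) (a b : Fin 4 → ℤ) : sform ξ a b = -sform ξ b a := by
  simp only [sform]; ring

namespace EnumCtx
variable {ξ N : ℝ} {x : ℕ → Fin 4 → ℤ} {n₀ : ℕ} {s : ℕ → ℕ}

lemma cdel_sub_le (G : EnumCtx ξ x N n₀ s) {i j : ℕ} (hi : n₀ ≤ i) (hj : n₀ ≤ j) :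
    |cdel ξ (x i) (x j) - x i 0 * sform ξ (x i) (x j)| ≤
      6 * N ^ 5 * (zL ξ (x i) * zL ξ (x i) * zL ξ (x j)) :=
  ((G.toMin.bd i hi).cdel_sub_le G.toMin.one_le G.toMin.hξ (G.toMin.bd j hj)).trans
    (le_of_eq (by ring))

/-- If `cdel` dominates the cubic error, then it is comparable to `x i 0 * sform`. -/
lemma log_cdel_close (G : EnumCtx ξ x N n₀ s) {i j : ℕ} (hi : n₀ ≤ i) (hj : n₀ ≤ j)
    (h0 : cdel ξ (x i) (x j) ≠ 0)
    (h : Real.log (6 * N ^ 5) + (2 * lL ξ x i + lL ξ x j) + Real.log 2 ≤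
      Real.log |cdel ξ (x i) (x j)|) :
    sform ξ (x i) (x j) ≠ 0 ∧
    Real.log |cdel ξ (x i) (x j)| ≤ lX x i + Real.log |sform ξ (x i) (x j)| + Real.log 2 ∧
    lX x i + Real.log |sform ξ (x i) (x j)| ≤
      Real.log |cdel ξ (x i) (x j)| + (Real.log 2 + Real.log N) := by
  have H := G.toMin
  have hN := H.one_le
  have hLi := H.L_pos i hi
  have hLj := H.L_pos j hj
  obtain ⟨h1, h2, h3⟩ := log_close (r := 6 * N ^ 5 * (zL ξ (x i) * zL ξ (x i) * zL ξ (x j))) h0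
    (by positivity) (G.cdel_sub_le hi hj) (by
      rw [Real.log_mul (by positivity) (by positivity), Real.log_mul (by positivity) hLj.ne',
        H.log_LL hi hi]
      change _ + (_ + lL ξ x j) + _ ≤ _
      linarith)
  have hs : sform ξ (x i) (x j) ≠ 0 := right_ne_zero_of_mul h1
  have hx0 : ((x i 0 : ℤ) : ℝ) ≠ 0 := by exact_mod_cast H.x0_ne hi
  rw [abs_mul, Real.log_mul (abs_ne_zero.2 hx0) (abs_ne_zero.2 hs)] at h2 h3
  obtain ⟨k1, k2⟩ := H.log_x0 hi
  change lX x i - _ ≤ _ at k1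
  change _ ≤ lX x i at k2
  exact ⟨hs, by linarith, by linarith⟩

lemma log_sform_lower (G : EnumCtx ξ x N n₀ s) : ∃ C, ∀ k, C ≤ lX x (s (k + 1)) →
    sform ξ (x (s (k + 1) - 1)) (x (s (k + 1))) ≠ 0 ∧
    -(lX x (s (k + 1)) + lL ξ x (s (k + 1) - 1) + lL ξ x (s (k + 1))) ≤
      0.4245069 * (Real.log |sform ξ (x (s (k + 1) - 1)) (x (s (k + 1)))| + lX x (s (k + 1))) + C := by
  have H := G.toMin
  have hN := H.one_le
  obtain ⟨C, hC⟩ := G.exists_log_le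
  have hN4 : N ^ 4 ≤ N ^ 5 := pow_le_pow_right₀ hN (by norm_num)
  have hN1 : 1 ≤ N ^ 4 := one_le_pow₀ hN
  have hN5 : 1 ≤ N ^ 5 := one_le_pow₀ hN
  set c₁ := Real.log (18 * N ^ 5) with hc₁
  set c₂ := Real.log (6 * N ^ 5) with hc₂
  have hc₁0 : 0 ≤ c₁ := Real.log_nonneg (by linarith)
  have hc₂0 : 0 ≤ c₂ := Real.log_nonneg (by linarith)
  have hl2 : 0 ≤ Real.log 2 := Real.log_nonneg (by norm_num)
  refine ⟨100 * (|C| + c₁ + c₂ + Real.log 2), fun k hX => ?_⟩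
  have hk := G.enum.ge (k + 1)
  set i := s (k + 1) with hi
  have hi0 : n₀ ≤ i := by omega
  have hi1 : n₀ ≤ i - 1 := by omega
  have hD := G.D_ne k
  rw [← hi] at hD
  have hone := H.one_le_of_C_ne hk hD
  set T := znorm (x i) * zL ξ (x i) * zL ξ (x (i - 1)) with hT
  have hT0 : 0 < T := mul_pos (mul_pos (H.X_pos hi0) (H.L_pos _ hi0)) (H.L_pos _ hi1)
  have hcf : |(cf (x i) (x (i - 1)) : ℝ)| ≤ 18 * N ^ 5 * T := by
    have h := H.cf_le hi0 hi1
    have h1 := (H.X_lt hi1 (by omega : i - 1 < i)).le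
    have h2 := (H.L_lt hi1 (by omega : i - 1 < i)).le
    have p0 := (H.X_pos hi0).le
    have p1 := (H.L_pos _ hi0).le
    have p2 := (H.L_pos _ hi1).le
    have h3 : znorm (x (i - 1)) * zL ξ (x i) * zL ξ (x i) ≤ T := by rw [hT]; gcongr
    have h4 : N ^ 4 * T ≤ N ^ 5 * T := by gcongr
    have h5 : N ^ 4 * (znorm (x (i - 1)) * zL ξ (x i) * zL ξ (x i)) ≤ N ^ 4 * T := by gcongr
    have h6 : 0 ≤ N ^ 5 * T := by positivity
    rw [← hT] at h
    linarith
  have hZ := hC _ _ _ hD hone hcf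
  rw [Real.log_mul (by positivity) hT0.ne', H.log_XLL hi0 hi0 hi1, ← hc₁] at hZ
  have hl := H.L_le i hi0
  have hp := H.L_le (i - 1) hi1
  rw [show i - 1 + 1 = i by omega] at hp
  have hYA := H.lX_le hi0 (Nat.le_succ i)
  change lL ξ x i ≤ -0.4245069 * lX x (i + 1) at hl
  change lL ξ x (i - 1) ≤ -0.4245069 * lX x i at hp
  have hCa := le_abs_self C
  have hC0 := abs_nonneg C
  obtain ⟨h1, h2, h3⟩ := G.log_cdel_close hi0 hi1 (cdel_ne_zero H.hlin hD) (by
    rw [cdel, ← hc₂]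
    linarith)
  have hsw : |sform ξ (x (i - 1)) (x i)| = |sform ξ (x i) (x (i - 1))| := by
    rw [sform_swap, abs_neg]
  refine ⟨fun h => h1 (by rw [sform_swap, h, neg_zero]), ?_⟩
  rw [hsw]
  rw [cdel] at h2
  linarith

lemma log_sform_upper (G : EnumCtx ξ x N n₀ s) {k : ℕ}
    (h0 : sform ξ (x (s k - 1)) (x (s k)) ≠ 0) :
    Real.log |sform ξ (x (s k - 1)) (x (s k))| ≤
      lL ξ x (s k - 1) + lL ξ x (s k) + Real.log (6 * N ^ 4) := by
  have H := G.toMin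
  have hk := G.enum.ge k
  have := log_le_of_le_mul (abs_pos.2 h0) (mul_pos (H.L_pos _ (by omega)) (H.L_pos _ (by omega)))
    (G.sform_le (i := s k - 1) (j := s k) (by omega) (by omega))
  rw [H.log_LL (by omega) (by omega)] at this
  linarith

/-- Logarithmic size of the first component of `C(y, u)`. -/
def lE (x : ℕ → Fin 4 → ℤ) (i : ℕ) : ℝ := Real.log (max 1 |(cf (x i) (x (i + 1)) : ℝ)|)

lemma lE_nonneg (x : ℕ → Fin 4 → ℤ) (i : ℕ) : 0 ≤ lE x i := Real.log_nonneg (le_max_left _ _)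

lemma lE_le (G : EnumCtx ξ x N n₀ s) (k : ℕ) :
    lE x (s k) ≤ lX x (s k + 1) + 2 * lL ξ x (s k) + Real.log (12 * N ^ 4) := by
  have H := G.toMin
  have hN := H.one_le
  have hk := G.enum.ge k
  have hE := G.E_ne k
  set i := s k
  have hi0 : n₀ ≤ i := by omega
  have hi1 : n₀ ≤ i + 1 := by omega
  have h1 := (H.X_lt hi0 (by omega : i < i + 1)).le
  have h2 := (H.L_lt hi0 (by omega : i < i + 1)).le
  have p0 := (H.X_pos hi0).le
  have p3 := H.X_pos hi1
  have p1 := H.L_pos _ hi0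
  have p2 := (H.L_pos _ hi1).le
  set T := znorm (x (i + 1)) * zL ξ (x i) * zL ξ (x i) with hT
  have hT0 : 0 < T := by positivity
  have h3 : znorm (x i) * zL ξ (x i) * zL ξ (x (i + 1)) ≤ T := by rw [hT]; gcongr
  have hcf := H.cf_le hi0 hi1
  have hcd := H.cdel_le hi0 hi1
  have h5 : N ^ 4 * (znorm (x i) * zL ξ (x i) * zL ξ (x (i + 1))) ≤ N ^ 4 * T := by gcongr
  have h6 : N ^ 2 * (znorm (x i) * zL ξ (x i) * zL ξ (x (i + 1))) ≤ N ^ 4 * T := by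
    gcongr
    first | exact hN | norm_num
  have h7 : 0 ≤ N ^ 4 * T := by positivity
  have hmax : max 1 |(cf (x i) (x (i + 1)) : ℝ)| ≤ 12 * N ^ 4 * T := by
    have hle : |(cf (x i) (x (i + 1)) : ℝ)| ≤ 12 * N ^ 4 * T := by
      rw [← hT] at hcf
      linarith
    refine max_le ?_ hle
    by_cases h0 : cf (x i) (x (i + 1)) = 0
    · have hg : cg (x i) (x (i + 1)) ≠ 0 := fun h => hE ⟨h0, h⟩
      have : (1 : ℝ) ≤ |(cg (x i) (x (i + 1)) : ℝ)| := by exact_mod_cast Int.one_le_abs hg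
      rw [cdel, h0] at hcd
      simp at hcd
      linarith
    · exact le_trans (by exact_mod_cast Int.one_le_abs h0) hle
  have := log_le_of_le_mul (by positivity) hT0 hmax
  rw [H.log_XLL hi1 hi0 hi0] at this
  unfold lE
  linarith

lemma le_lE (G : EnumCtx ξ x N n₀ s) : ∃ C, ∀ k,
    -0.4245069 * Real.log |cdel ξ (x (s k)) (x (s k + 1))| ≤ lE x (s k) + C := by
  obtain ⟨C, hC⟩ := G.exists_log_le
  exact ⟨C, fun k => hC _ _ _ (G.E_ne k) (le_max_left _ _) (le_max_right _ _)⟩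

lemma log_cdel_E (G : EnumCtx ξ x N n₀ s) : ∃ C, ∀ k, C ≤ lX x (s k) →
    Real.log |cdel ξ (x (s k)) (x (s k + 1))| ≤
      lX x (s k) + Real.log |sform ξ (x (s (k + 1) - 1)) (x (s (k + 1)))| + C ∧
    lX x (s k) + Real.log |sform ξ (x (s (k + 1) - 1)) (x (s (k + 1)))| ≤
      Real.log |cdel ξ (x (s k)) (x (s k + 1))| + C := by
  have H := G.toMin
  have hN := H.one_le
  obtain ⟨C, hC⟩ := G.le_lE
  have hN1 : 1 ≤ N ^ 4 := one_le_pow₀ hN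
  have hN5 : 1 ≤ N ^ 5 := one_le_pow₀ hN
  set c₁ := Real.log (12 * N ^ 4) with hc₁
  set c₂ := Real.log (6 * N ^ 5) with hc₂
  have hc₁0 : 0 ≤ c₁ := Real.log_nonneg (by linarith)
  have hc₂0 : 0 ≤ c₂ := Real.log_nonneg (by linarith)
  have hl2 : 0 ≤ Real.log 2 := Real.log_nonneg (by norm_num)
  have hlN : 0 ≤ Real.log N := Real.log_nonneg hN
  refine ⟨100 * (|C| + c₁ + c₂ + Real.log 2 + Real.log N), fun k hX => ?_⟩
  have hk := G.enum.ge k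
  have hi0 : n₀ ≤ s k := by omega
  have hi1 : n₀ ≤ s k + 1 := by omega
  have hZ := hC k
  have hE := G.lE_le k
  have hl := H.L_le _ hi0
  have hYA := H.lX_le hi0 (Nat.le_succ (s k))
  have hll := H.lL_le hi0 (Nat.le_succ (s k))
  simp only [Nat.succ_eq_add_one] at hYA hll
  change lL ξ x (s k) ≤ -0.4245069 * lX x (s k + 1) at hl
  have hCa := le_abs_self C
  have hC0 := abs_nonneg C
  obtain ⟨h1, h2, h3⟩ := G.log_cdel_close hi0 hi1 (cdel_ne_zero H.hlin (G.E_ne k)) (by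
    rw [← hc₂]
    linarith)
  rw [G.abs_sform_eq k]
  constructor <;> linarith

end EnumCtx

end

section

/-- The slope `g / f` of an integer vector, or a label when `f = 0`. -/
def vslope (f g : ℤ) (k : ℕ) : ℚ ⊕ ℕ := if f = 0 then Sum.inr k else Sum.inl (g / f)

lemma vslope_of_ne {f g : ℤ} {k : ℕ} (hf : f ≠ 0) : vslope f g k = Sum.inl ((g : ℚ) / f) := if_neg hf

lemma log_sub_slope {ξ : ℝ} {f g : ℤ} (hf : f ≠ 0) (h : (g : ℝ) - ξ * f ≠ 0) :
    Real.log |(f : ℝ)| - (-Real.log |(((g : ℚ) / f : ℚ) : ℝ) - ξ|) = Real.log |(g : ℝ) - ξ * f| := by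
  have hfR : (f : ℝ) ≠ 0 := by exact_mod_cast hf
  have e : (g : ℝ) - ξ * f = f * ((((g : ℚ) / f : ℚ) : ℝ) - ξ) := by
    push_cast
    field_simp
  rw [sub_neg_eq_add, e, abs_mul, Real.log_mul (abs_ne_zero.2 hfR)]
  rw [e] at h
  exact abs_ne_zero.2 (right_ne_zero_of_mul h)

lemma nonpar_of_slope_ne {ξ : ℝ} {f g f' g' : ℤ} {k k' : ℕ} (h : ¬ (f = 0 ∧ g = 0))
    (h' : ¬ (f' = 0 ∧ g' = 0)) (hd : (g : ℝ) - ξ * f ≠ 0) (hd' : (g' : ℝ) - ξ * f' ≠ 0)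
    (hne : vslope f g k ≠ vslope f' g' k') :
    0 ≤ Real.log (max 1 |(f : ℝ)|) + Real.log |(g' : ℝ) - ξ * f'| + Real.log 2 ∨
    0 ≤ Real.log (max 1 |(f' : ℝ)|) + Real.log |(g : ℝ) - ξ * f| + Real.log 2 := by
  have hF : (0 : ℝ) < max 1 |(f : ℝ)| := by positivity
  have hF' : (0 : ℝ) < max 1 |(f' : ℝ)| := by positivity
  have hl2 : 0 ≤ Real.log 2 := Real.log_nonneg (by norm_num)
  have hone : ∀ {a : ℝ}, 0 < a → 1 / 2 ≤ a → 0 ≤ Real.log a + Real.log 2 := by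
    intro a ha h
    rw [← Real.log_mul ha.ne' two_ne_zero]
    exact Real.log_nonneg (by linarith)
  by_cases hdet : f' * g - f * g' = 0
  · have hf0 : f = 0 ∧ f' = 0 := by
      by_cases hf : f = 0
      · refine ⟨hf, ?_⟩
        by_contra hf'
        rw [hf, zero_mul, sub_zero] at hdet
        exact h ⟨hf, (mul_eq_zero.1 hdet).resolve_left hf'⟩
      · by_cases hf' : f' = 0
        · rw [hf', zero_mul, zero_sub, neg_eq_zero] at hdet
          exact absurd ⟨hf', (mul_eq_zero.1 hdet).resolve_left hf⟩ h'
        · refine absurd ?_ hne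
          rw [vslope_of_ne hf, vslope_of_ne hf']
          congr 1
          rw [div_eq_div_iff (by exact_mod_cast hf) (by exact_mod_cast hf')]
          exact_mod_cast (by linarith : g * f' = g' * f)
    left
    have hg' : g' ≠ 0 := fun h0 => h' ⟨hf0.2, h0⟩
    have : (1 : ℝ) ≤ |(g' : ℝ)| := by exact_mod_cast Int.one_le_abs hg'
    rw [hf0.2]
    have h1 := Real.log_nonneg (le_max_left (1 : ℝ) |(f : ℝ)|)
    have h2 := Real.log_nonneg this
    simp only [Int.cast_zero, mul_zero, sub_zero]
    linarith
  · have h1 : (1 : ℝ) ≤ |((f' * g - f * g' : ℤ) : ℝ)| := by exact_mod_cast Int.one_le_abs hdet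
    rw [show ((f' * g - f * g' : ℤ) : ℝ) = f' * ((g : ℝ) - ξ * f) - f * (g' - ξ * f') by
      push_cast; ring] at h1
    have h2 := h1.trans (abs_sub_le' (abs_mul_le' (le_max_right 1 |(f' : ℝ)|) (le_refl |(g : ℝ) - ξ * f|))
      (abs_mul_le' (le_max_right 1 |(f : ℝ)|) (le_refl |(g' : ℝ) - ξ * f'|)))
    have hd1 := abs_pos.2 hd
    have hd1' := abs_pos.2 hd'
    rcases le_total (1 / 2) (max 1 |(f : ℝ)| * |(g' : ℝ) - ξ * f'|) with h3 | h3
    · left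
      rw [← Real.log_mul hF.ne' hd1'.ne']
      exact hone (by positivity) h3
    · right
      rw [← Real.log_mul hF'.ne' hd1.ne']
      exact hone (by positivity) (by linarith)

namespace EnumCtx
variable {ξ N : ℝ} {x : ℕ → Fin 4 → ℤ} {n₀ : ℕ} {s : ℕ → ℕ}

lemma point (G : EnumCtx ξ x N n₀ s) (k : ℕ) {i : ℕ} (hi : n₀ ≤ i) :
    0 ≤ lE x (s k) + lL ξ x i + Real.log (2 * N) ∨
    0 ≤ Real.log |cdel ξ (x (s k)) (x (s k + 1))| + lX x i + Real.log (2 * N) := by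
  have H := G.toMin
  have hN := H.one_le
  have hL := H.L_pos i hi
  have hX := H.X_pos hi
  have hd := abs_pos.2 (cdel_ne_zero H.hlin (G.E_ne k))
  have h := G.one_le_of_ne hi (G.E_ne k)
  change 1 ≤ |cdel ξ (x (s k)) (x (s k + 1))| * _ + _ at h
  change 0 < |cdel ξ (x (s k)) (x (s k + 1))| at hd
  set F := max 1 |(cf (x (s k)) (x (s k + 1)) : ℝ)| with hF
  have hF0 : 0 < F := by positivity
  have h2 : |(cf (x (s k)) (x (s k + 1)) : ℝ)| * (N * zL ξ (x i)) ≤ F * (N * zL ξ (x i)) := by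
    gcongr
    exact le_max_right _ _
  rcases le_total (1 / 2) (|cdel ξ (x (s k)) (x (s k + 1))| * znorm (x i)) with h3 | h3
  · right
    have := log_le_of_le_mul (K := 2 * N) one_pos (mul_pos hd hX) (by nlinarith [mul_pos hd hX])
    rw [Real.log_one, Real.log_mul hd.ne' hX.ne'] at this
    unfold lX
    linarith
  · left
    have := log_le_of_le_mul (K := 2 * N) one_pos (mul_pos hF0 hL) (by linarith)
    rw [Real.log_one, Real.log_mul hF0.ne' hL.ne'] at this
    unfold lE lL
    rw [← hF]
    linarith

/-- Consequences of `x (s k)` being close to the line on which `cf` is governed by `qval`. -/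
lemma log_cf (G : EnumCtx ξ x N n₀ s) : ∃ C, ∀ k i, s k < i → lX x (s k) + 2 * lL ξ x (s k) + C < 0 →
    cf (x (s k)) (x i) ≠ 0 ∧
    Real.log |(cf (x (s k)) (x i) : ℝ)| ≤ lE x (s k) + lX x i - lX x (s k + 1) + C ∧
    lE x (s k) + lX x i - lX x (s k + 1) ≤ Real.log |(cf (x (s k)) (x i) : ℝ)| + C := by
  have H := G.toMin
  have hN := H.one_le
  have hl2 : 0 ≤ Real.log 2 := Real.log_nonneg (by norm_num)
  have hlN : 0 ≤ Real.log N := Real.log_nonneg hN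
  have hN4 : 1 ≤ N ^ 4 := one_le_pow₀ hN
  set c := Real.log (6 * N ^ 4) with hc
  have hc0 : 0 ≤ c := Real.log_nonneg (by linarith)
  refine ⟨c + 2 * Real.log N + 3 * Real.log 2, fun k i hki hdom => ?_⟩
  have hk := G.enum.ge k
  have hE := G.E_ne k
  unfold lE
  set j := s k with hj
  have hj0 : n₀ ≤ j := by omega
  have hj1 : n₀ ≤ j + 1 := by omega
  have hi0 : n₀ ≤ i := by omega
  have hXj := H.X_pos hj0
  have hLj := H.L_pos _ hj0
  set r := 6 * N ^ 4 * (znorm (x j) * zL ξ (x j) * zL ξ (x j)) with hr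
  have hr0 : 0 < r := by positivity
  have hlr : Real.log r = c + (lX x j + 2 * lL ξ x j) := by
    rw [hr, Real.log_mul (by positivity) (by positivity), H.log_XLL hj0 hj0 hj0]
    ring
  have herr : ∀ m, j < m → |(cf (x j) (x m) : ℝ) - x m 0 * qval ξ (x j)| ≤ r := by
    intro m hm
    have hLm := (H.L_lt hj0 hm).le
    refine ((H.bd j hj0).cf_sub_le hN H.hξ (H.bd m (by omega))).trans ?_
    calc 6 * N ^ 2 * (znorm (x j) * (N * zL ξ (x j)) * (N * zL ξ (x m)))
        = 6 * N ^ 4 * (znorm (x j) * zL ξ (x j) * zL ξ (x m)) := by ring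
      _ ≤ r := by rw [hr]; gcongr
  have hcf1 : cf (x j) (x (j + 1)) ≠ 0 := by
    intro h0
    have hg : cg (x j) (x (j + 1)) ≠ 0 := fun h => hE ⟨h0, h⟩
    have h1 : (1 : ℝ) ≤ |(cg (x j) (x (j + 1)) : ℝ)| := by exact_mod_cast Int.one_le_abs hg
    have hcd := H.cdel_le hj0 hj1
    rw [cdel, h0] at hcd
    simp only [Int.cast_zero, mul_zero, sub_zero] at hcd
    have hLm := (H.L_lt hj0 (Nat.lt_succ_self j)).le
    have h2 : 6 * N ^ 2 * (znorm (x j) * zL ξ (x j) * zL ξ (x (j + 1))) ≤ r := by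
      have : N ^ 2 ≤ N ^ 4 := pow_le_pow_right₀ hN (by norm_num)
      have := H.L_pos _ hj1
      rw [hr]
      gcongr
    have h3 := Real.log_nonneg (h1.trans (hcd.trans h2))
    linarith
  have hone : (1 : ℝ) ≤ |(cf (x j) (x (j + 1)) : ℝ)| := by exact_mod_cast Int.one_le_abs hcf1
  have hcf1R : (cf (x j) (x (j + 1)) : ℝ) ≠ 0 := by exact_mod_cast hcf1
  have hlone := Real.log_nonneg hone
  rw [max_eq_right hone]
  obtain ⟨a1, a2, a3⟩ := log_close hcf1R hr0 (herr (j + 1) (Nat.lt_succ_self j)) (by linarith)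
  have hq : qval ξ (x j) ≠ 0 := right_ne_zero_of_mul a1
  have hx1 : ((x (j + 1) 0 : ℤ) : ℝ) ≠ 0 := by exact_mod_cast H.x0_ne hj1
  have hxi : ((x i 0 : ℤ) : ℝ) ≠ 0 := by exact_mod_cast H.x0_ne hi0
  rw [abs_mul, Real.log_mul (abs_ne_zero.2 hx1) (abs_ne_zero.2 hq)] at a2 a3
  obtain ⟨k1, k2⟩ := H.log_x0 hj1
  obtain ⟨k3, k4⟩ := H.log_x0 hi0
  change lX x (j + 1) - _ ≤ _ at k1
  change _ ≤ lX x (j + 1) at k2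
  change lX x i - _ ≤ _ at k3
  change _ ≤ lX x i at k4
  have hmon := H.lX_le hj1 (by omega : j + 1 ≤ i)
  have hlm : Real.log |(x i 0 : ℝ) * qval ξ (x j)| = Real.log |(x i 0 : ℝ)| + Real.log |qval ξ (x j)| := by
    rw [abs_mul, Real.log_mul (abs_ne_zero.2 hxi) (abs_ne_zero.2 hq)]
  obtain ⟨b1, b2, b3⟩ := log_close (a := (cf (x j) (x i) : ℝ)) (mul_ne_zero hxi hq) hr0
    (by rw [abs_sub_comm]; exact herr i hki) (by rw [hlm]; linarith)
  rw [hlm] at b2 b3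
  exact ⟨by exact_mod_cast b1, by linarith, by linarith⟩

lemma log_cdel_le (G : EnumCtx ξ x N n₀ s) {i j : ℕ} (hi : n₀ ≤ i) (hj : n₀ ≤ j)
    (h : cf (x i) (x j) ≠ 0) :
    Real.log |cdel ξ (x i) (x j)| ≤ lX x i + lL ξ x i + lL ξ x j + Real.log (6 * N ^ 2) := by
  have H := G.toMin
  have := log_le_of_le_mul (abs_pos.2 (cdel_ne_zero H.hlin fun h' => h h'.1))
    (mul_pos (mul_pos (H.X_pos hi) (H.L_pos _ hi)) (H.L_pos _ hj)) (H.cdel_le hi hj)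
  rw [H.log_XLL hi hi hj] at this
  rw [cdel]
  linarith

/-- The value `sform (x (s k)) (x (s (k + 1)))` is `sform (x (s k)) (x (s k + 1))` times a nonzero
integer of controlled size. -/
lemma log_sform_step (G : EnumCtx ξ x N n₀ s) : ∃ C, ∀ k,
    sform ξ (x (s (k + 1) - 1)) (x (s (k + 1))) ≠ 0 →
    sform ξ (x (s k)) (x (s (k + 1))) ≠ 0 ∧
    Real.log |sform ξ (x (s (k + 1) - 1)) (x (s (k + 1)))| ≤
      Real.log |sform ξ (x (s k)) (x (s (k + 1)))| ∧
    Real.log |sform ξ (x (s k)) (x (s (k + 1)))| ≤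
      Real.log |sform ξ (x (s (k + 1) - 1)) (x (s (k + 1)))| + lX x (s (k + 1)) - lX x (s k + 1) + C := by
  have H := G.toMin
  have hN := H.one_le
  refine ⟨Real.log (16 * N ^ 2), fun k h0 => ?_⟩
  have hk := G.enum.ge k
  have hlt := G.lt k
  have habs := G.abs_sform_eq k
  have h0' : sform ξ (x (s k)) (x (s k + 1)) ≠ 0 := by
    rw [← abs_pos, ← habs, abs_pos]; exact h0
  obtain ⟨α, β, γ, δ, hd, -, hy⟩ := G.unimodular k
  have hδ : δ ≠ 0 := by
    rintro rfl
    have hγ : |γ| = 1 := by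
      rw [mul_zero, zero_sub, abs_neg, abs_mul] at hd
      exact Int.eq_one_of_mul_eq_one_left (abs_nonneg _) hd
    have hX := H.X_lt (i := s k) (j := s (k + 1)) (by omega) hlt
    rw [hy] at hX
    rcases (abs_eq (by norm_num : (0 : ℤ) ≤ 1)).1 hγ with rfl | rfl <;> simp [znorm] at hX
  have hs : sform ξ (x (s k)) (x (s (k + 1))) = δ * sform ξ (x (s k)) (x (s k + 1)) := by
    rw [hy]
    simpa using sform_comb ξ (x (s k)) (x (s k + 1)) 1 0 γ δ
  have hm : ∀ q, mnr (x (s k)) (x (s (k + 1))) 0 q = δ * mnr (x (s k)) (x (s k + 1)) 0 q := by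
    intro q
    rw [hy]
    simpa using mnr_comb (x (s k)) (x (s k + 1)) 1 0 γ δ 0 q
  have hδR : (δ : ℝ) ≠ 0 := by exact_mod_cast hδ
  have hδ1 : (1 : ℝ) ≤ |(δ : ℝ)| := by exact_mod_cast Int.one_le_abs hδ
  obtain ⟨q, hq⟩ := H.exists_le_mnr (i := s k) (by omega)
  have hle := H.mnr_le (i := s k) (j := s (k + 1)) (by omega) hlt 0 q
  rw [hm, Int.cast_mul, abs_mul] at hle
  have hL := H.L_pos (s k) (by omega)
  have hXu := H.X_pos (i := s k + 1) (by omega)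
  have hXy := H.X_pos (i := s (k + 1)) (by omega)
  have hδX : |(δ : ℝ)| * znorm (x (s k + 1)) ≤ 16 * N ^ 2 * znorm (x (s (k + 1))) := by
    refine le_of_mul_le_mul_right ?_ hL
    calc |(δ : ℝ)| * znorm (x (s k + 1)) * zL ξ (x (s k))
        = |(δ : ℝ)| * (znorm (x (s k + 1)) * zL ξ (x (s k))) := by ring
      _ ≤ |(δ : ℝ)| * (4 * N * |(mnr (x (s k)) (x (s k + 1)) 0 q : ℝ)|) := by gcongr
      _ = 4 * N * (|(δ : ℝ)| * |(mnr (x (s k)) (x (s k + 1)) 0 q : ℝ)|) := by ring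
      _ ≤ 4 * N * (4 * N * (znorm (x (s (k + 1))) * zL ξ (x (s k)))) := by gcongr
      _ = _ := by ring
  have hlog := log_le_of_le_mul (mul_pos (abs_pos.2 hδR) hXu) hXy hδX
  rw [Real.log_mul (abs_ne_zero.2 hδR) hXu.ne'] at hlog
  have hl1 := Real.log_nonneg hδ1
  have e : Real.log |sform ξ (x (s k)) (x (s (k + 1)))| =
      Real.log |(δ : ℝ)| + Real.log |sform ξ (x (s (k + 1) - 1)) (x (s (k + 1)))| := by
    rw [hs, abs_mul, Real.log_mul (abs_ne_zero.2 hδR) (abs_ne_zero.2 h0'), habs]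
  refine ⟨by rw [hs]; exact mul_ne_zero hδR h0', by linarith, ?_⟩
  rw [e]
  unfold lX
  linarith

/-- A large value of `sform` forces a large `cdel`, up to the cubic error. -/
lemma log_sform_le_or (G : EnumCtx ξ x N n₀ s) : ∃ C, ∀ i j, n₀ ≤ i → n₀ ≤ j →
    sform ξ (x i) (x j) ≠ 0 → cf (x i) (x j) ≠ 0 →
    lX x i + Real.log |sform ξ (x i) (x j)| ≤ Real.log |cdel ξ (x i) (x j)| + C ∨
    lX x i + Real.log |sform ξ (x i) (x j)| ≤ 2 * lL ξ x i + lL ξ x j + C := by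
  have H := G.toMin
  have hN := H.one_le
  have hN5 : 1 ≤ N ^ 5 := one_le_pow₀ hN
  have hc : 0 ≤ Real.log (12 * N ^ 5) := Real.log_nonneg (by linarith)
  have hl2 : 0 ≤ Real.log 2 := Real.log_nonneg (by norm_num)
  have hlN : 0 ≤ Real.log N := Real.log_nonneg hN
  refine ⟨Real.log (12 * N ^ 5) + Real.log 2 + Real.log N, fun i j hi hj h0 hcf => ?_⟩
  have hx0 : ((x i 0 : ℤ) : ℝ) ≠ 0 := by exact_mod_cast H.x0_ne hi
  have hm := abs_pos.2 (mul_ne_zero hx0 h0)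
  have hd : cdel ξ (x i) (x j) ≠ 0 := cdel_ne_zero H.hlin fun h' => hcf h'.1
  have hlm : Real.log |(x i 0 : ℝ) * sform ξ (x i) (x j)| =
      Real.log |(x i 0 : ℝ)| + Real.log |sform ξ (x i) (x j)| := by
    rw [abs_mul, Real.log_mul (abs_ne_zero.2 hx0) (abs_ne_zero.2 h0)]
  obtain ⟨k1, -⟩ := H.log_x0 hi
  change lX x i - _ ≤ _ at k1
  have h := G.cdel_sub_le hi hj
  have hLi := H.L_pos i hi
  have hLj := H.L_pos j hj
  have htri : |(x i 0 : ℝ) * sform ξ (x i) (x j)| ≤ |cdel ξ (x i) (x j)| +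
      6 * N ^ 5 * (zL ξ (x i) * zL ξ (x i) * zL ξ (x j)) := by
    have := abs_sub_le' (le_refl |cdel ξ (x i) (x j)|) h
    rwa [sub_sub_cancel] at this
  rcases le_total (|(x i 0 : ℝ) * sform ξ (x i) (x j)|) (2 * |cdel ξ (x i) (x j)|) with h1 | h1
  · left
    have := log_le_of_le_mul hm (abs_pos.2 hd) h1
    linarith
  · right
    have := log_le_of_le_mul (K := 12 * N ^ 5) hm
      (b := zL ξ (x i) * zL ξ (x i) * zL ξ (x j)) (by positivity) (by linarith)
    rw [Real.log_mul (by positivity) hLj.ne', H.log_LL hi hi] at this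
    change _ ≤ _ + (_ + lL ξ x j) at this
    linarith

end EnumCtx

end

section

namespace EnumCtx
variable {ξ N : ℝ} {x : ℕ → Fin 4 → ℤ} {n₀ : ℕ} {s : ℕ → ℕ}

/-- Logarithm of the alternating form at consecutive points. -/
def lS (ξ : ℝ) (x : ℕ → Fin 4 → ℤ) (i : ℕ) : ℝ := Real.log |sform ξ (x (i - 1)) (x i)|

lemma log_sform_le (G : EnumCtx ξ x N n₀ s) {i j : ℕ} (hi : n₀ ≤ i) (hj : n₀ ≤ j)
    (h : sform ξ (x i) (x j) ≠ 0) :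
    Real.log |sform ξ (x i) (x j)| ≤ lL ξ x i + lL ξ x j + Real.log (6 * N ^ 4) := by
  have H := G.toMin
  have := log_le_of_le_mul (abs_pos.2 h) (mul_pos (H.L_pos _ hi) (H.L_pos _ hj)) (G.sform_le hi hj)
  rw [H.log_LL hi hj] at this
  linarith

lemma pluecker (G : EnumCtx ξ x N n₀ s) : ∃ C, ∀ k,
    (∀ i, k ≤ i → sform ξ (x (s (i + 1) - 1)) (x (s (i + 1))) ≠ 0) →
    cf (x (s (k + 1))) (x (s (k + 3))) ≠ 0 → cf (x (s k)) (x (s (k + 2))) ≠ 0 →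
    lS ξ x (s (k + 1)) + lS ξ x (s (k + 3)) ≤ lL ξ x (s k) + lL ξ x (s (k + 3)) +
      (lS ξ x (s (k + 2)) + lX x (s (k + 2)) - lX x (s (k + 1) + 1)) + C ∨
    ((lX x (s (k + 1)) + (lS ξ x (s (k + 1)) + lS ξ x (s (k + 3)) - lL ξ x (s k) - lL ξ x (s (k + 2))) ≤
          Real.log |cdel ξ (x (s (k + 1))) (x (s (k + 3)))| + C ∨
        lX x (s (k + 1)) + (lS ξ x (s (k + 1)) + lS ξ x (s (k + 3)) - lL ξ x (s k) - lL ξ x (s (k + 2))) ≤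
          2 * lL ξ x (s (k + 1)) + lL ξ x (s (k + 3)) + C) ∧
      (lX x (s k) + (lS ξ x (s (k + 1)) + lS ξ x (s (k + 3)) - lL ξ x (s (k + 1)) - lL ξ x (s (k + 3))) ≤
          Real.log |cdel ξ (x (s k)) (x (s (k + 2)))| + C ∨
        lX x (s k) + (lS ξ x (s (k + 1)) + lS ξ x (s (k + 3)) - lL ξ x (s (k + 1)) - lL ξ x (s (k + 3))) ≤
          2 * lL ξ x (s k) + lL ξ x (s (k + 2)) + C)) := by
  obtain ⟨C₁, h₁⟩ := G.log_sform_step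
  obtain ⟨C₂, h₂⟩ := G.log_sform_le_or
  have hN4 : 1 ≤ N ^ 4 := one_le_pow₀ G.toMin.one_le
  have hc : 0 ≤ Real.log (6 * N ^ 4) := Real.log_nonneg (by linarith)
  have hl2 : 0 ≤ Real.log 2 := Real.log_nonneg (by norm_num)
  refine ⟨|C₁| + |C₂| + Real.log (6 * N ^ 4) + Real.log 2, fun k hs hcf1 hcf0 => ?_⟩
  have hC₁ := le_abs_self C₁
  have hC₂ := le_abs_self C₂
  have hC₁' := abs_nonneg C₁
  have hC₂' := abs_nonneg C₂
  have g0 : n₀ ≤ s k := (Nat.le_succ _).trans (G.enum.ge k)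
  have g1 : n₀ ≤ s (k + 1) := (Nat.le_succ _).trans (G.enum.ge _)
  have g2 : n₀ ≤ s (k + 2) := (Nat.le_succ _).trans (G.enum.ge _)
  have g3 : n₀ ≤ s (k + 3) := (Nat.le_succ _).trans (G.enum.ge _)
  obtain ⟨a1, a2, -⟩ := h₁ k (hs k le_rfl)
  obtain ⟨b1, -, b3⟩ := h₁ (k + 1) (hs (k + 1) (by omega))
  obtain ⟨c1, c2, -⟩ := h₁ (k + 2) (hs (k + 2) (by omega))
  have hp := sform_pluecker ξ (x (s k)) (x (s (k + 1))) (x (s (k + 2))) (x (s (k + 3)))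
  rw [sform_swap ξ (x (s (k + 1))) (x (s k)), sform_swap ξ (x (s (k + 3))) (x (s (k + 1))),
    sform_swap ξ (x (s (k + 2))) (x (s k)), sform_swap ξ (x (s (k + 3))) (x (s k))] at hp
  simp only [add_assoc, Nat.reduceAdd] at a1 a2 b1 b3 c1 c2
  change lS ξ x (s (k + 1)) ≤ _ at a2
  change _ ≤ lS ξ x (s (k + 2)) + _ - _ + _ at b3
  change lS ξ x (s (k + 3)) ≤ _ at c2
  have u02 := G.log_sform_le g0 g2
  have u13 := G.log_sform_le g1 g3
  have u03 := G.log_sform_le g0 g3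
  have v13 := h₂ _ _ g1 g3
  have v02 := h₂ _ _ g0 g2
  generalize sform ξ (x (s k)) (x (s (k + 1))) = s01 at *
  generalize sform ξ (x (s (k + 1))) (x (s (k + 2))) = s12 at *
  generalize sform ξ (x (s (k + 2))) (x (s (k + 3))) = s23 at *
  generalize sform ξ (x (s k)) (x (s (k + 2))) = s02 at *
  generalize sform ξ (x (s (k + 1))) (x (s (k + 3))) = s13 at *
  generalize sform ξ (x (s k)) (x (s (k + 3))) = s03 at *
  have hpos : 0 < |s01 * s23| := abs_pos.2 (mul_ne_zero a1 c1)
  have hL : Real.log |s01 * s23| = Real.log |s01| + Real.log |s23| := by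
    rw [abs_mul, Real.log_mul (abs_ne_zero.2 a1) (abs_ne_zero.2 c1)]
  have htri : |s01 * s23| ≤ |s02 * s13| + |s12 * s03| := by
    rw [show s01 * s23 = s02 * s13 - s12 * s03 by linarith]
    exact abs_sub_le' le_rfl le_rfl
  rcases le_total |s01 * s23| (2 * |s12 * s03|) with h | h
  · left
    have hne : s12 * s03 ≠ 0 := by
      intro h0
      rw [h0, abs_zero, mul_zero] at h
      linarith
    have := log_le_of_le_mul hpos (abs_pos.2 hne) h
    rw [hL, abs_mul, Real.log_mul (abs_ne_zero.2 b1) (abs_ne_zero.2 (right_ne_zero_of_mul hne))] at this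
    linarith [u03 (right_ne_zero_of_mul hne)]
  · right
    have h' : |s01 * s23| ≤ 2 * |s02 * s13| := by linarith
    have hne : s02 * s13 ≠ 0 := by
      intro h0
      rw [h0, abs_zero, mul_zero] at h'
      linarith
    have n02 := left_ne_zero_of_mul hne
    have n13 := right_ne_zero_of_mul hne
    have := log_le_of_le_mul hpos (abs_pos.2 hne) h'
    rw [hL, abs_mul, Real.log_mul (abs_ne_zero.2 n02) (abs_ne_zero.2 n13)] at this
    refine ⟨(v13 n13 hcf1).imp (fun h => ?_) (fun h => ?_), (v02 n02 hcf0).imp (fun h => ?_) (fun h => ?_)⟩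
    · linarith [u02 n02]
    · linarith [u02 n02]
    · linarith [u13 n13]
    · linarith [u13 n13]

end EnumCtx

lemma MinCtx.exists_enumCtx {ξ N : ℝ} {x : ℕ → Fin 4 → ℤ} {n₀ : ℕ} (H : MinCtx ξ x N n₀) :
    ∃ n₁ s, EnumCtx ξ x N n₁ s := by
  obtain ⟨n₁, h1, hq⟩ := H.exists_q_ne
  have H1 := H.mono h1
  obtain ⟨n₂, h2, hk⟩ := H1.exists_kills_eq_zero hq
  have H2 := H1.mono h2
  have hinf : {i | i ∈ Iset x}.Infinite := H2.Iset_infinite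
  have hsm := Nat.nth_strictMono hinf
  refine ⟨n₂, fun k => Nat.nth (fun i => i ∈ Iset x) (k + (n₂ + 1)), H2,
    ⟨fun k => Nat.nth_mem_of_infinite hinf _, fun a b hab => hsm (by omega), fun k m hm hm' hI => ?_,
      fun k => (show n₂ + 1 ≤ k + (n₂ + 1) by omega).trans (hsm.id_le _)⟩, fun i hi => hq i (h2.trans hi), hk⟩
  obtain ⟨r, rfl⟩ : ∃ r, Nat.nth (fun i => i ∈ Iset x) r = m := by
    classical
    exact ⟨_, Nat.nth_count (p := fun i => i ∈ Iset x) hI⟩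
  have := hsm.lt_iff_lt.1 hm
  have := hsm.lt_iff_lt.1 hm'
  omega

namespace IsEnum
variable {x : ℕ → Fin 4 → ℤ} {n₀ : ℕ} {s : ℕ → ℕ}

lemma exists_eq (h : IsEnum x n₀ s) {K i : ℕ} (hi : i ∈ Iset x) (hK : s K ≤ i) : ∃ k, K ≤ k ∧ s k = i := by
  classical
  have hex : ∃ k, i < s k := ⟨i + 1, (Nat.lt_succ_self i).trans_le (h.mono.id_le _)⟩
  have hlt : K < Nat.find hex := by
    rw [Nat.lt_find_iff]
    exact fun m hm => not_lt.2 ((h.mono.monotone hm).trans hK)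
  refine ⟨Nat.find hex - 1, by omega, ?_⟩
  have h1 := not_lt.1 (Nat.find_min hex (m := Nat.find hex - 1) (by omega))
  have h2 := Nat.find_spec hex
  by_contra hne
  refine h.gap (Nat.find hex - 1) i (lt_of_le_of_ne h1 hne) ?_ hi
  rwa [show Nat.find hex - 1 + 1 = Nat.find hex by omega]

lemma consecIn (h : IsEnum x n₀ s) (k : ℕ) : ConsecIn (Iset x) (s k) (s (k + 1)) :=
  ⟨h.mem k, h.mem _, h.mono (Nat.lt_succ_self k), fun m hm hlt => by
    by_contra hcon
    exact h.gap k m hlt (not_le.1 hcon) hm⟩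

lemma eq_succ (h : IsEnum x n₀ s) {k j : ℕ} (hj : ConsecIn (Iset x) (s k) j) : j = s (k + 1) :=
  le_antisymm (hj.2.2.2 _ (h.mem _) (h.mono (Nat.lt_succ_self k)))
    ((h.consecIn k).2.2.2 _ hj.2.1 hj.2.2.1)

lemma mem_Jset (h : IsEnum x n₀ s) (k : ℕ) : s k ∈ Jset x ↔ Uspace x (s k) ≠ Uspace x (s (k + 1)) := by
  refine ⟨fun hJ => hJ.2 _ (h.consecIn k), fun hU => ⟨h.mem k, fun j hj => ?_⟩⟩
  rw [h.eq_succ hj]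
  exact hU

end IsEnum

end

section

namespace EnumCtx
variable {ξ N : ℝ} {x : ℕ → Fin 4 → ℤ} {n₀ : ℕ} {s : ℕ → ℕ}

/-- The quality of a slope; vertical directions are measured at the points of `t`. -/
def slopeQuality (ξ : ℝ) (x : ℕ → Fin 4 → ℤ) (t : ℕ → ℕ) : ℚ ⊕ ℕ → ℝ
  | Sum.inl r => -Real.log |(r : ℝ) - ξ|
  | Sum.inr m => -Real.log |(cg (x (t m)) (x (t m + 1)) : ℝ)|

lemma lE_sub_slopeQuality (G : EnumCtx ξ x N n₀ s) (K k : ℕ) :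
    lE x (s (k + K)) - slopeQuality ξ x (fun k => s (k + K))
      (vslope (cf (x (s (k + K))) (x (s (k + K) + 1))) (cg (x (s (k + K))) (x (s (k + K) + 1))) k) =
    Real.log |cdel ξ (x (s (k + K))) (x (s (k + K) + 1))| := by
  have hd := cdel_ne_zero G.toMin.hlin (G.E_ne (k + K))
  rw [lE, cdel]
  by_cases hf : cf (x (s (k + K))) (x (s (k + K) + 1)) = 0
  · simp [vslope, hf, slopeQuality]
  · have h1 : (1 : ℝ) ≤ |(cf (x (s (k + K))) (x (s (k + K) + 1)) : ℝ)| := by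
      exact_mod_cast Int.one_le_abs hf
    rw [vslope_of_ne hf, max_eq_right h1, slopeQuality]
    exact log_sub_slope hf hd

lemma log_cf_sub_slopeQuality (G : EnumCtx ξ x N n₀ s) (t : ℕ → ℕ) {i j : ℕ} (k : ℕ)
    (h : cf (x i) (x j) ≠ 0) :
    Real.log |(cf (x i) (x j) : ℝ)| -
      slopeQuality ξ x t (vslope (cf (x i) (x j)) (cg (x i) (x j)) k) =
    Real.log |cdel ξ (x i) (x j)| := by
  rw [vslope_of_ne h]
  exact log_sub_slope h (cdel_ne_zero G.toMin.hlin fun h' => h h'.1)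

theorem exists_logData (G : EnumCtx ξ x N n₀ s) : ∃ (S : LogData) (K : ℕ), ∀ k,
    S.J k ↔ Uspace x (s (k + K)) ≠ Uspace x (s (k + K + 1)) := by
  have H := G.toMin
  obtain ⟨C₁, height_le⟩ := G.height_le
  obtain ⟨C₂, height_ge⟩ := G.height_ge
  obtain ⟨C₃, nondeg⟩ := G.nondeg
  obtain ⟨C₄, h_le⟩ := G.h_le
  obtain ⟨C₅, J_le⟩ := G.J_le
  obtain ⟨C₆, sform_lower⟩ := G.log_sform_lower
  obtain ⟨C₇, le_lE⟩ := G.le_lE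
  obtain ⟨C₈, cdel_E⟩ := G.log_cdel_E
  obtain ⟨C₉, log_cf⟩ := G.log_cf
  obtain ⟨C₀, plu⟩ := G.pluecker
  obtain ⟨e, he⟩ := Finset.exists_le ({0, C₁, C₂, C₃, C₄, C₅, C₆, C₇, C₈, C₉, C₀,
    Real.log (6 * N ^ 4), Real.log (12 * N ^ 4), Real.log (2 * N), Real.log (6 * N ^ 2),
    Real.log 2} : Finset ℝ)
  simp only [Finset.mem_insert, Finset.mem_singleton, forall_eq_or_imp, forall_eq] at he
  obtain ⟨e0, e1, e2, e3, e4, e5, e6, e7, e8, e9, e10, e11, e12, e13, e14, e15⟩ := he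
  have hn : ∀ k, n₀ ≤ s k := fun k => (Nat.le_succ _).trans (G.enum.ge k)
  have hn' : ∀ k, n₀ ≤ s k - 1 := fun k => Nat.le_sub_of_add_le (G.enum.ge k)
  have htend : Filter.Tendsto (fun k => lX x (s k)) Filter.atTop Filter.atTop :=
    H.tendsto_log_X.comp G.enum.mono.tendsto_atTop
  obtain ⟨K, hK⟩ := Filter.eventually_atTop.1 (htend.eventually_ge_atTop (10000000000 * e + 1))
  have hbig : ∀ k, K ≤ k → e ≤ lX x (s k) := fun k hk => by linarith [hK k hk]
  have hlt : ∀ k, s k < s (k + 1) := fun k => G.enum.mono (Nat.lt_succ_self k)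
  have r1 : ∀ k, k + 1 + (K + 1) = k + (K + 1) + 1 := fun k => by omega
  have rA : ∀ k, k + 1 + K = k + (K + 1) := fun k => by omega
  have rA2 : ∀ k, k + 2 + K = k + (K + 1) + 1 := fun k => by omega
  have sform_ne : ∀ k, K ≤ k → sform ξ (x (s (k + 1) - 1)) (x (s (k + 1))) ≠ 0 :=
    fun k hk => (sform_lower k (e6.trans (hbig (k + 1) (by omega)))).1
  refine ⟨{
    Y := fun k => lX x (s (k + (K + 1)))
    A := fun k => lX x (s (k + K) + 1)
    l := fun k => lL ξ x (s (k + (K + 1)))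
    p := fun k => lL ξ x (s (k + (K + 1)) - 1)
    h := fun k => Real.log (normalHeight (Uspace x (s (k + (K + 1)))))
    σ := fun k => lS ξ x (s (k + (K + 1)))
    en := fun k => lE x (s (k + (K + 1)))
    J := fun k => Uspace x (s (k + (K + 1))) ≠ Uspace x (s (k + (K + 1) + 1))
    es := fun k => vslope (cf (x (s (k + (K + 1)))) (x (s (k + (K + 1)) + 1)))
      (cg (x (s (k + (K + 1)))) (x (s (k + (K + 1)) + 1))) k
    ρ := slopeQuality ξ x fun k => s (k + (K + 1))
    cn := fun k j => Real.log |(cf (x (s (k + (K + 1)))) (x (s (j + (K + 1)))) : ℝ)|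
    cs := fun k j => vslope (cf (x (s (k + (K + 1)))) (x (s (j + (K + 1)))))
      (cg (x (s (k + (K + 1)))) (x (s (j + (K + 1))))) k
    e := e
    e_nonneg := e0
    e_small := ?_
    Y_pos := ?_
    Y_unbounded := ?_
    J_inf := ?_
    A_le_Y := ?_
    Y_le_A := ?_
    l_le_p := ?_
    p_le_l := ?_
    l_le := ?_
    p_le := ?_
    height_le := ?_
    height_ge := ?_
    h_le := ?_
    J_le := ?_
    not_J_eq := ?_
    nondeg := ?_
    σ_le := ?_
    le_σ := ?_
    en_nonneg := fun k => lE_nonneg x _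
    en_le := ?_
    ed_le := ?_
    le_ed := ?_
    le_en := ?_
    point := ?_
    nonpar := ?_
    cn_le := ?_
    le_cn := ?_
    cd_le := ?_
    nonpar_c := ?_
    pluecker := ?_ }, K + 1, fun k => Iff.rfl⟩
  · linarith [hK (0 + (K + 1)) (by omega)]
  · linarith [hK (0 + (K + 1)) (by omega)]
  · intro M
    obtain ⟨m, hm⟩ := Filter.eventually_atTop.1 (htend.eventually_ge_atTop M)
    exact ⟨m, hm _ (by omega)⟩
  · intro k
    obtain ⟨m, hm, h⟩ := H.J_infinite G.enum (k + (K + 1))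
    exact ⟨m - (K + 1), by omega, by rwa [show m - (K + 1) + (K + 1) = m by omega]⟩
  · exact fun k => H.lX_le ((hn _).trans (Nat.le_succ _)) (hlt (k + K))
  · intro k
    rw [rA]
    exact H.lX_le (hn _) (Nat.le_succ _)
  · exact fun k => H.lL_le (hn' _) (Nat.sub_le _ _)
  · intro k
    rw [r1]
    exact H.lL_le (hn _) (Nat.le_sub_one_of_lt (hlt _))
  · intro k
    rw [rA]
    exact H.L_le _ (hn _)
  · intro k
    have := H.L_le _ (hn' (k + (K + 1)))
    have h1 := G.enum.ge (k + (K + 1))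
    rwa [Nat.sub_add_cancel (by omega)] at this
  · intro k
    rw [r1, rA]
    linarith [height_le (k + (K + 1))]
  · intro k
    rw [r1, rA]
    linarith [height_ge (k + (K + 1))]
  · intro k
    rw [r1]
    linarith [h_le (k + (K + 1))]
  · intro k hJ
    rw [r1]
    linarith [J_le _ hJ]
  · intro k hJ
    rw [r1, not_not.1 hJ]
  · exact fun k => (nondeg (k + K)).trans (add_le_add le_rfl e3)
  · exact fun k => (G.log_sform_upper (sform_ne (k + K) (by omega))).trans (by
      change _ ≤ lL ξ x (s (k + K + 1) - 1) + lL ξ x (s (k + K + 1)) + e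
      linarith)
  · exact fun k => (sform_lower (k + K) (e6.trans (hbig _ (by omega)))).2.trans (by
      change _ ≤ 0.4245069 * (lS ξ x (s (k + K + 1)) + lX x (s (k + K + 1))) + e
      rw [← lS]
      linarith)
  · intro k
    rw [rA]
    linarith [G.lE_le (k + (K + 1))]
  · intro k
    rw [r1, G.lE_sub_slopeQuality (K + 1) k]
    refine (cdel_E (k + (K + 1)) (e8.trans (hbig _ (by omega)))).1.trans ?_
    rw [← lS]
    linarith
  · intro k
    rw [r1, G.lE_sub_slopeQuality (K + 1) k]
    refine (cdel_E (k + (K + 1)) (e8.trans (hbig _ (by omega)))).2.trans ?_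
    linarith
  · intro k
    rw [G.lE_sub_slopeQuality (K + 1) k]
    linarith [le_lE (k + (K + 1))]
  · intro k i
    rw [G.lE_sub_slopeQuality (K + 1) k]
    refine (G.point (k + (K + 1)) (hn (i + (K + 1)))).imp (fun h => ?_) (fun h => ?_) <;> linarith
  · intro i k h
    rw [G.lE_sub_slopeQuality (K + 1) k, G.lE_sub_slopeQuality (K + 1) i]
    refine (nonpar_of_slope_ne (G.E_ne _) (G.E_ne _) (cdel_ne_zero H.hlin (G.E_ne _))
      (cdel_ne_zero H.hlin (G.E_ne _)) h).imp (fun h => ?_) (fun h => ?_) <;>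
    · rw [← lE, ← cdel] at h
      linarith
  · intro k j hkj hdom
    rw [rA]
    linarith [(log_cf _ _ (G.enum.mono (show k + (K + 1) < j + (K + 1) by omega)) (by linarith)).2.1]
  · intro k j hkj hdom
    rw [rA]
    linarith [(log_cf _ _ (G.enum.mono (show k + (K + 1) < j + (K + 1) by omega)) (by linarith)).2.2]
  · intro k j hkj hdom
    have hne := (log_cf _ _ (G.enum.mono (show k + (K + 1) < j + (K + 1) by omega)) (by linarith)).1
    rw [G.log_cf_sub_slopeQuality _ k hne]
    linarith [G.log_cdel_le (hn _) (hn _) hne]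
  · intro k j i hkj hdom h
    have hne := (log_cf _ _ (G.enum.mono (show k + (K + 1) < j + (K + 1) by omega)) (by linarith)).1
    have hne' : ¬ (cf (x (s (k + (K + 1)))) (x (s (j + (K + 1)))) = 0 ∧
        cg (x (s (k + (K + 1)))) (x (s (j + (K + 1)))) = 0) := fun h' => hne h'.1
    rw [G.log_cf_sub_slopeQuality _ k hne, G.lE_sub_slopeQuality (K + 1) i]
    have h1 : (1 : ℝ) ≤ |(cf (x (s (k + (K + 1)))) (x (s (j + (K + 1)))) : ℝ)| := by
      exact_mod_cast Int.one_le_abs hne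
    refine (nonpar_of_slope_ne hne' (G.E_ne _) (cdel_ne_zero H.hlin hne')
      (cdel_ne_zero H.hlin (G.E_ne _)) h).imp (fun h => ?_) (fun h => ?_)
    · rw [max_eq_right h1, ← cdel] at h
      linarith
    · rw [← lE, ← cdel] at h
      linarith
  · intro k hdom hdom'
    rw [r1] at hdom'
    have hne := (log_cf _ _ (G.enum.mono (show k + (K + 1) < k + (K + 1) + 2 by omega)) (by linarith)).1
    have hne' := (log_cf _ _ (G.enum.mono (show k + (K + 1) + 1 < k + (K + 1) + 3 by omega))
      (by linarith)).1
    simp only [r1, rA2]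
    rw [G.log_cf_sub_slopeQuality _ _ hne, G.log_cf_sub_slopeQuality _ _ hne']
    refine (plu (k + (K + 1)) (fun i hi => sform_ne i (by omega)) hne' hne).imp (fun h => ?_)
      fun h => ⟨h.1.imp (fun h => ?_) (fun h => ?_), h.2.imp (fun h => ?_) (fun h => ?_)⟩ <;>
    linarith
end EnumCtx

end

theorem statement16 (ξ : ℝ)
    (hξ : LinearIndependent ℚ ![(1 : ℝ), ξ, ξ ^ 2, ξ ^ 3])
    (c : ℝ) (hc : 0 < c)
    (happrox : ApproxHyp ξ c lambda3)
    (x : ℕ → Fin 4 → ℤ) (hmin : IsMinimalSeq ξ x) :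
    ∃ N : ℕ, ∀ i j : ℕ, N ≤ i → ConsecIn (Iset x) i j →
      Xor' (i ∈ Jset x) (j ∈ Jset x) := by
  obtain ⟨N, n₀, H⟩ := MinCtx.exists hξ hc happrox hmin
  obtain ⟨n₁, s, G⟩ := H.exists_enumCtx
  obtain ⟨S, K, hS⟩ := G.exists_logData
  obtain ⟨K', hK'⟩ := S.eventually_xor
  refine ⟨s (K' + K), fun i j hi hij => ?_⟩
  obtain ⟨k, hk, rfl⟩ := G.enum.exists_eq hij.1 hi
  obtain rfl := G.enum.eq_succ hij
  have := hK' (k - K) (by omega)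
  rw [hS, hS, show k - K + K = k by omega, show k - K + 1 + K = k + 1 by omega] at this
  rwa [G.enum.mem_Jset, G.enum.mem_Jset]
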